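/- Unconditionally, for every ε > 0 and every T > 0 there exists ρ' ∈ ℂ with ζ'(ρ') = 0, Re(ρ') > 1, Im(ρ') > T and |L(ρ',χ)| ≥ (e^{C₀}·φ(q)/q − ε)·log(log(Im ρ')). (Equivalently, limsup over critical points ρ' of ζ with Re(ρ') > 1 and Im(ρ') → ∞ of |L(ρ',χ)|/log log Im(ρ') is at least e^{C₀}·φ(q)/q.) -/

import Mathlib

open Filter Topology MeasureTheory Set in
/-- The function `t ↦ e^{-t} log t` is integrable on `(0, ∞)` with integral `-γ`. -/
theorem integrableOn_log_mul_exp_neg :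
    IntegrableOn (fun t : ℝ ↦ Real.log t * Real.exp (-t)) (Ioi 0) ∧
      ∫ t in Ioi (0 : ℝ), Real.log t * Real.exp (-t) = -Real.eulerMascheroniConstant := by
  have key := (mellin_hasDerivAt_of_isBigO_rpow (E := ℂ) (f := fun x : ℝ ↦ (Real.exp (-x) : ℂ))
    (a := 2) (b := 0) (s := 1) ?_ ?_ (by norm_num) ?_ (by norm_num))
  · have h1 := key.1
    have h2 := key.2
    have hG : (fun s ↦ mellin (fun x : ℝ ↦ (Real.exp (-x) : ℂ)) s) =ᶠ[𝓝 1] Complex.Gamma := by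
      have : ∀ᶠ s : ℂ in 𝓝 1, 0 < s.re :=
        Complex.continuous_re.continuousAt.eventually (lt_mem_nhds (by simp))
      filter_upwards [this] with s hs
      rw [Complex.Gamma_eq_integral hs, Complex.GammaIntegral_eq_mellin]
    have h3 := (hG.hasDerivAt_iff).1 h2
    have h4 := h3.unique Complex.hasDerivAt_Gamma_one
    rw [mellin] at h4
    unfold MellinConvergent at h1
    simp only [sub_self, Complex.cpow_zero, smul_eq_mul] at h1 h4
    constructor
    · have := h1.re
      refine this.congr (Eventually.of_forall fun t ↦ ?_)
      simp [← Complex.ofReal_mul, -Complex.ofReal_exp]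
    · have h5 : ∫ t in Ioi (0:ℝ), ((Real.log t * Real.exp (-t) : ℝ) : ℂ)
          = -(Real.eulerMascheroniConstant : ℂ) := by
        rw [← h4]; congr 1; ext t; push_cast; simp
      rw [integral_complex_ofReal] at h5
      exact_mod_cast h5
  · refine (Continuous.continuousOn ?_).locallyIntegrableOn measurableSet_Ioi
    exact Complex.continuous_ofReal.comp (Real.continuous_exp.comp continuous_neg)
  · rw [← Asymptotics.isBigO_norm_left]
    simp_rw [Complex.norm_real, Asymptotics.isBigO_norm_left]
    simpa only [neg_one_mul] using (isLittleO_exp_neg_mul_rpow_atTop zero_lt_one _).isBigO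
  · simp_rw [neg_zero, Real.rpow_zero]
    refine Asymptotics.isBigO_const_of_tendsto (?_ : Tendsto _ _ (𝓝 (1 : ℂ))) one_ne_zero
    rw [(by simp : (1 : ℂ) = Real.exp (-0))]
    exact (Complex.continuous_ofReal.comp
      (Real.continuous_exp.comp continuous_neg)).continuousWithinAt

open Filter Topology MeasureTheory Set in
theorem integrableOn_log_mul_exp_neg_mul {δ : ℝ} (hδ : 0 < δ) :
    IntegrableOn (fun v : ℝ ↦ δ * Real.exp (-(δ * v)) * Real.log v) (Ioi 0) ∧
      ∫ v in Ioi (0 : ℝ), δ * Real.exp (-(δ * v)) * Real.log v =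
        -Real.eulerMascheroniConstant - Real.log δ := by
  obtain ⟨h1, h2⟩ := integrableOn_log_mul_exp_neg
  have e1 : IntegrableOn (fun v : ℝ ↦ Real.log (δ * v) * Real.exp (-(δ * v))) (Ioi 0) := by
    have := (integrableOn_Ioi_comp_mul_left_iff
      (fun t : ℝ ↦ Real.log t * Real.exp (-t)) 0 hδ).2 (by simpa using h1)
    exact this
  have e2 : IntegrableOn (fun v : ℝ ↦ Real.exp (-δ * v)) (Ioi 0) :=
    integrableOn_exp_mul_Ioi (by linarith) 0
  have hc : EqOn (fun v : ℝ ↦ δ * (Real.log (δ * v) * Real.exp (-(δ * v))) -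
      δ * Real.log δ * Real.exp (-δ * v))
      (fun v : ℝ ↦ δ * Real.exp (-(δ * v)) * Real.log v) (Ioi 0) := by
    intro v hv
    simp only
    rw [Real.log_mul hδ.ne' (ne_of_gt hv), neg_mul]
    ring
  constructor
  · have e3 : IntegrableOn (fun v : ℝ ↦ δ * (Real.log (δ * v) * Real.exp (-(δ * v))) -
      δ * Real.log δ * Real.exp (-δ * v)) (Ioi 0) := (e1.const_mul δ).sub (e2.const_mul _)
    exact e3.congr_fun hc measurableSet_Ioi
  · rw [← setIntegral_congr_fun measurableSet_Ioi hc,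
      integral_sub (e1.const_mul δ) (e2.const_mul _), integral_const_mul, integral_const_mul,
      integral_comp_mul_left_Ioi (fun t : ℝ ↦ Real.log t * Real.exp (-t)) 0 hδ,
      integral_exp_mul_Ioi (by linarith)]
    simp only [mul_zero, h2, Real.exp_zero, smul_eq_mul]
    field_simp

/-- `-log (1 - 1/p)`, the logarithm of the Euler factor of `ζ` at `1`. -/
noncomputable def eulerLog (p : ℕ) : ℝ := -Real.log (1 - (p : ℝ)⁻¹)

theorem eulerLog_nonneg (p : ℕ) : 0 ≤ eulerLog p := by
  unfold eulerLog
  rcases Nat.eq_zero_or_pos p with rfl | hp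
  · simp
  have h1 : (p : ℝ)⁻¹ ≤ 1 := inv_le_one_of_one_le₀ (by exact_mod_cast hp)
  have h2 : 0 ≤ (p : ℝ)⁻¹ := by positivity
  have := Real.log_nonpos (x := 1 - (p : ℝ)⁻¹) (by linarith) (by linarith)
  linarith

/-- For `0 ≤ c ≤ 1` one has `-log (1 - c x) ≤ c (-log (1 - x))` by convexity. -/
theorem neg_log_one_sub_mul_le {c x : ℝ} (hc0 : 0 ≤ c) (hc1 : c ≤ 1) (hx1 : x < 1) :
    -Real.log (1 - c * x) ≤ c * -Real.log (1 - x) := by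
  have h := strictConcaveOn_log_Ioi.concaveOn.2 (x := 1 - x) (y := 1)
    (by simpa using hx1) (by simp) hc0 (sub_nonneg.2 hc1) (by ring)
  simp only [smul_eq_mul, Real.log_one, mul_zero, add_zero] at h
  have e : c * (1 - x) + (1 - c) * 1 = 1 - c * x := by ring
  rw [e] at h
  linarith

open Filter Topology MeasureTheory Set in
/-- A lower bound, along a sequence, for the sums in Mertens' third theorem. -/
theorem exists_le_sum_eulerLog {lam : ℝ} (hlam : lam < Real.eulerMascheroniConstant) (X : ℕ) :
    ∃ y : ℕ, X ≤ y ∧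
      Real.log (Real.log y) + lam ≤ ∑ p ∈ Nat.primesLE y, eulerLog p := by
  by_contra! hcon
  set X₀ := max X 3 with hX₀
  set x₀ := Real.log X₀ with hx₀
  set C := ∑ p ∈ Nat.primesLE X₀, eulerLog p with hC
  have hmono : ∀ m n : ℕ, m ≤ n →
      ∑ p ∈ Nat.primesLE m, eulerLog p ≤ ∑ p ∈ Nat.primesLE n, eulerLog p := by
    intro m n hmn
    refine Finset.sum_le_sum_of_subset_of_nonneg ?_ fun _ _ _ ↦ eulerLog_nonneg _
    intro p hp
    rw [Nat.mem_primesLE] at hp ⊢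
    exact ⟨hp.1.trans hmn, hp.2⟩
  have hx₀1 : 1 ≤ x₀ := by
    rw [hx₀, Real.le_log_iff_exp_le (by positivity)]
    have : (3 : ℝ) ≤ X₀ := by exact_mod_cast le_max_right X 3
    linarith [Real.exp_one_lt_three]
  set h : ℝ → ℝ := indicator (Ioc 0 x₀) (fun v ↦ C + |Real.log v| + |lam|) with hh
  have hC0 : 0 ≤ C := Finset.sum_nonneg fun _ _ ↦ eulerLog_nonneg _
  have hh0 : ∀ v, 0 ≤ h v := fun v ↦ indicator_nonneg (fun v _ ↦ by positivity) v
  have hInt : IntegrableOn h (Ioi 0) := by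
    refine Integrable.integrableOn ?_
    rw [hh, integrable_indicator_iff measurableSet_Ioc]
    have : IntervalIntegrable (fun v ↦ C + |Real.log v| + |lam|) volume 0 x₀ := by
      refine ((intervalIntegrable_const).add ?_).add intervalIntegrable_const
      exact (intervalIntegral.intervalIntegrable_log').abs
    exact (intervalIntegrable_iff_integrableOn_Ioc_of_le (by linarith)).1 this
  set D := ∫ v in Ioi (0 : ℝ), h v with hD
  -- pointwise bound for the partial sums
  have hpt : ∀ (n : ℕ) (v : ℝ), 0 < v →
      ∑ p ∈ Nat.primesBelow n, indicator (Ioi (Real.log p)) (fun _ ↦ eulerLog p) v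
        ≤ Real.log v + lam + h v := by
    intro n v hv
    have h1 : ∑ p ∈ Nat.primesBelow n, indicator (Ioi (Real.log p)) (fun _ ↦ eulerLog p) v
        ≤ ∑ p ∈ Nat.primesLE ⌊Real.exp v⌋₊, eulerLog p := by
      rw [← Finset.sum_filter_add_sum_filter_not _ (fun p : ℕ ↦ Real.log p < v)]
      have z : ∑ p ∈ (Nat.primesBelow n).filter (fun p : ℕ ↦ ¬ Real.log p < v),
          indicator (Ioi (Real.log p)) (fun _ ↦ eulerLog p) v = 0 := by
        refine Finset.sum_eq_zero fun p hp ↦ ?_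
        rw [Finset.mem_filter] at hp
        exact indicator_of_notMem (by simpa using hp.2) _
      rw [z, add_zero]
      calc _ ≤ ∑ p ∈ (Nat.primesBelow n).filter (fun p : ℕ ↦ Real.log p < v), eulerLog p := by
            refine Finset.sum_le_sum fun p hp ↦ ?_
            exact indicator_le_self' (fun _ _ ↦ eulerLog_nonneg _) _
        _ ≤ _ := by
            refine Finset.sum_le_sum_of_subset_of_nonneg ?_ fun _ _ _ ↦ eulerLog_nonneg _
            intro p hp
            rw [Finset.mem_filter, Nat.mem_primesBelow] at hp
            rw [Nat.mem_primesLE]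
            refine ⟨Nat.le_floor ?_, hp.1.2⟩
            rw [← Real.log_le_iff_le_exp (by exact_mod_cast hp.1.2.pos)]
            exact hp.2.le
    refine h1.trans ?_
    rcases le_or_gt v x₀ with hv' | hv'
    · have : h v = C + |Real.log v| + |lam| := indicator_of_mem (show v ∈ Ioc 0 x₀ from ⟨hv, hv'⟩) _
      rw [this]
      have h2 : ∑ p ∈ Nat.primesLE ⌊Real.exp v⌋₊, eulerLog p ≤ C := by
        refine hmono _ _ ?_
        refine Nat.floor_le_of_le ?_
        rw [← Real.le_log_iff_exp_le (by positivity)]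
        exact hv'
      linarith [neg_abs_le (Real.log v), neg_abs_le lam]
    · have hX : X₀ ≤ ⌊Real.exp v⌋₊ := by
        refine Nat.le_floor ?_
        rw [← Real.log_le_iff_le_exp (by positivity)]
        exact hv'.le
      have h2 := hcon ⌊Real.exp v⌋₊ ((le_max_left _ _).trans hX)
      have hX' : (X₀ : ℝ) ≤ (⌊Real.exp v⌋₊ : ℝ) := by exact_mod_cast hX
      have hXpos : (0 : ℝ) < X₀ := by positivity
      have h3 : Real.log (⌊Real.exp v⌋₊ : ℝ) ≤ v := by
        rw [Real.log_le_iff_le_exp (hXpos.trans_le hX')]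
        exact Nat.floor_le (Real.exp_pos _).le
      have h4 : x₀ ≤ Real.log (⌊Real.exp v⌋₊ : ℝ) := Real.log_le_log hXpos hX'
      have h5 : Real.log (Real.log (⌊Real.exp v⌋₊ : ℝ)) ≤ Real.log v :=
        Real.log_le_log (by linarith) h3
      linarith [hh0 v]
  have hbound : ∀ δ : ℝ, 0 < δ → δ < 1 → Real.log (riemannZeta ((1 + δ : ℝ) : ℂ)).re + Real.log δ ≤
      lam - Real.eulerMascheroniConstant + δ * D := by
    intro δ hδ hδ1
    obtain ⟨i1, i2⟩ := integrableOn_log_mul_exp_neg_mul hδ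
    have i3 : IntegrableOn (fun v : ℝ ↦ Real.exp (-δ * v)) (Ioi 0) :=
      integrableOn_exp_mul_Ioi (by linarith) 0
    have hfin : ∀ n : ℕ, ∑ p ∈ Nat.primesBelow n, (p : ℝ) ^ (-δ) * eulerLog p ≤
        -Real.eulerMascheroniConstant - Real.log δ + lam + δ * D := by
      intro n
      have e1 : ∀ p ∈ Nat.primesBelow n, IntegrableOn (fun v : ℝ ↦ δ * Real.exp (-δ * v) *
          indicator (Ioi (Real.log p)) (fun _ ↦ eulerLog p) v) (Ioi 0) ∧
          ∫ v in Ioi (0:ℝ), δ * Real.exp (-δ * v) *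
            indicator (Ioi (Real.log p)) (fun _ ↦ eulerLog p) v = (p : ℝ) ^ (-δ) * eulerLog p := by
        intro p hp
        have hp' := (Nat.mem_primesBelow.1 hp).2
        have hlp : 0 ≤ Real.log p := Real.log_natCast_nonneg p
        have hfun : (fun v : ℝ ↦ δ * Real.exp (-δ * v) *
          indicator (Ioi (Real.log p)) (fun _ ↦ eulerLog p) v) =
          indicator (Ioi (Real.log p)) (fun v ↦ δ * eulerLog p * Real.exp (-δ * v)) := by
          ext v
          by_cases hv : v ∈ Ioi (Real.log p)
          · rw [indicator_of_mem hv, indicator_of_mem hv]; ring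
          · rw [indicator_of_notMem hv, indicator_of_notMem hv]; ring
        rw [hfun]
        have i4 : IntegrableOn (fun v : ℝ ↦ δ * eulerLog p * Real.exp (-δ * v))
          (Ioi (Real.log p)) := (i3.mono_set (Ioi_subset_Ioi hlp)).const_mul _
        constructor
        · exact ((integrable_indicator_iff measurableSet_Ioi).2 i4).integrableOn
        · rw [setIntegral_indicator measurableSet_Ioi, inter_eq_right.2 (Ioi_subset_Ioi hlp),
            integral_const_mul, integral_exp_mul_Ioi (by linarith),
            Real.rpow_def_of_pos (by exact_mod_cast hp'.pos)]
          rw [mul_comm (-δ) (Real.log p)]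
          field_simp
      rw [← Finset.sum_congr rfl fun p hp ↦ (e1 p hp).2,
        ← integral_finsetSum _ fun p hp ↦ (e1 p hp).1]
      have i6 : IntegrableOn (fun v : ℝ ↦ δ * Real.exp (-(δ * v)) * Real.log v +
        lam * δ * Real.exp (-δ * v)) (Ioi 0) := i1.add (i3.const_mul _)
      have i5 : IntegrableOn (fun v : ℝ ↦ δ * Real.exp (-(δ * v)) * Real.log v +
        lam * δ * Real.exp (-δ * v) + δ * h v) (Ioi 0) :=
        i6.add (hInt.const_mul _)
      calc _ ≤ ∫ v in Ioi (0:ℝ), (δ * Real.exp (-(δ * v)) * Real.log v +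
            lam * δ * Real.exp (-δ * v) + δ * h v) := by
            refine setIntegral_mono_on (integrable_finsetSum _ fun p hp ↦ (e1 p hp).1) i5
              measurableSet_Ioi fun v hv ↦ ?_
            rw [← Finset.mul_sum]
            have h1 := hpt n v hv
            have h2 : Real.exp (-δ * v) ≤ 1 := by
              rw [Real.exp_le_one_iff]
              have := mul_pos hδ hv
              linarith
            calc _ ≤ δ * Real.exp (-δ * v) * (Real.log v + lam + h v) := by gcongr
              _ ≤ _ := by
                rw [neg_mul]
                rw [neg_mul] at h2
                have : δ * Real.exp (-(δ * v)) * h v ≤ δ * 1 * h v := by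
                  gcongr
                  exact hh0 v
                linarith
        _ = _ := by
            rw [integral_add i6 (hInt.const_mul _),
              integral_add i1 (i3.const_mul _), i2, integral_const_mul, integral_const_mul,
              integral_exp_mul_Ioi (by linarith)]
            simp only [mul_zero, Real.exp_zero]
            field_simp
            rfl
    have hlim := riemannZeta_eulerProduct (s := ((1 + δ : ℝ) : ℂ)) (by simp [hδ])
    have hlim' := (Complex.continuous_re.tendsto _).comp hlim
    have hre : ∀ n : ℕ, (∏ p ∈ Nat.primesBelow n, (1 - (p : ℂ) ^ (-((1 + δ : ℝ) : ℂ)))⁻¹).re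
        = Real.exp (∑ p ∈ Nat.primesBelow n, -Real.log (1 - (p : ℝ) ^ (-(1 + δ)))) := by
      intro n
      rw [Real.exp_sum]
      have : ∏ p ∈ Nat.primesBelow n, (1 - (p : ℂ) ^ (-((1 + δ : ℝ) : ℂ)))⁻¹ =
        ((∏ p ∈ Nat.primesBelow n, Real.exp (-Real.log (1 - (p : ℝ) ^ (-(1 + δ)))) : ℝ) : ℂ) := by
        rw [Complex.ofReal_prod]
        refine Finset.prod_congr rfl fun p hp ↦ ?_
        have hp' := (Nat.mem_primesBelow.1 hp).2
        have h1 : (p : ℝ) ^ (-(1 + δ)) < 1 :=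
          Real.rpow_lt_one_of_one_lt_of_neg (by exact_mod_cast hp'.one_lt) (by linarith)
        rw [Real.exp_neg, Real.exp_log (by linarith)]
        push_cast
        rw [Complex.ofReal_cpow (by positivity)]
        push_cast
        rfl
      rw [this, Complex.ofReal_re]
    have hle : ∀ n : ℕ, (∏ p ∈ Nat.primesBelow n, (1 - (p : ℂ) ^ (-((1 + δ : ℝ) : ℂ)))⁻¹).re ≤
        Real.exp (-Real.eulerMascheroniConstant - Real.log δ + lam + δ * D) := by
      intro n
      rw [hre, Real.exp_le_exp]
      refine le_trans (Finset.sum_le_sum fun p hp ↦ ?_) (hfin n)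
      have hp' := (Nat.mem_primesBelow.1 hp).2
      have hp1 : (1 : ℝ) < p := by exact_mod_cast hp'.one_lt
      have h1 : (p : ℝ) ^ (-(1 + δ)) = (p : ℝ) ^ (-δ) * (p : ℝ)⁻¹ := by
        rw [← Real.rpow_neg_one, ← Real.rpow_add (by linarith)]
        congr 1; ring
      rw [h1]
      exact neg_log_one_sub_mul_le (by positivity)
        (Real.rpow_le_one_of_one_le_of_nonpos hp1.le (by linarith)) (inv_lt_one_of_one_lt₀ hp1)
    have hge : 1 ≤ (riemannZeta ((1 + δ : ℝ) : ℂ)).re := by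
      refine ge_of_tendsto' hlim' fun n ↦ ?_
      simp only [Function.comp]
      rw [hre]
      refine Real.one_le_exp (Finset.sum_nonneg fun p hp ↦ ?_)
      have hp' := (Nat.mem_primesBelow.1 hp).2
      have h1 : (p : ℝ) ^ (-(1 + δ)) < 1 :=
          Real.rpow_lt_one_of_one_lt_of_neg (by exact_mod_cast hp'.one_lt) (by linarith)
      have h2 : 0 ≤ (p : ℝ) ^ (-(1 + δ)) := by positivity
      have := Real.log_nonpos (x := 1 - (p : ℝ) ^ (-(1 + δ))) (by linarith) (by linarith)
      linarith
    have h := le_of_tendsto' hlim' hle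
    have := Real.log_le_log (by linarith) h
    rw [Real.log_exp] at this
    linarith
  -- compare with the behaviour of `ζ` at `1`
  have hz := log_riemannZeta_add_log_sub_isLittleO_ofReal.tendsto_div_nhds_zero
  simp only [div_one] at hz
  have hz' : Tendsto (fun δ : ℝ ↦ Real.log (riemannZeta ((1 + δ : ℝ) : ℂ)).re + Real.log δ)
      (𝓝[>] 0) (𝓝 0) := by
    have hmap : Tendsto (fun δ : ℝ ↦ 1 + δ) (𝓝[>] 0) (𝓝[>] 1) := by
      refine tendsto_nhdsWithin_iff.2 ⟨?_, ?_⟩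
      · have : Tendsto (fun δ : ℝ ↦ 1 + δ) (𝓝 0) (𝓝 (1 + 0)) :=
          (continuous_const.add continuous_id).tendsto 0
        rw [add_zero] at this
        exact this.mono_left nhdsWithin_le_nhds
      · filter_upwards [self_mem_nhdsWithin] with δ hδ
        simpa using hδ
    refine (hz.comp hmap).congr fun δ ↦ ?_
    simp
  have hr : Tendsto (fun δ : ℝ ↦ lam - Real.eulerMascheroniConstant + δ * D) (𝓝[>] 0)
      (𝓝 (lam - Real.eulerMascheroniConstant + 0 * D)) :=
    ((continuous_const.add (continuous_id.mul continuous_const)).tendsto 0).mono_left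
      nhdsWithin_le_nhds
  have := le_of_tendsto_of_tendsto hz' hr (by
    filter_upwards [Ioo_mem_nhdsGT (show (0 : ℝ) < 1 by norm_num)] with δ hδ
    exact hbound δ hδ.1 hδ.2)
  linarith

theorem norm_sum_range_dirichletCharacter_le {q : ℕ} [NeZero q] {χ : DirichletCharacter ℂ q}
    (hχ : χ ≠ 1) (N : ℕ) : ‖∑ n ∈ Finset.range N, χ n‖ ≤ q := by
  have hq : ∑ n ∈ Finset.range q, χ n = 0 := by
    rw [← MulChar.sum_eq_zero_of_ne_one hχ]
    refine Finset.sum_nbij' (fun n : ℕ ↦ (n : ZMod q)) (fun a ↦ a.val) (by simp)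
      (fun a _ ↦ by simpa using ZMod.val_lt a) (fun n hn ↦ ?_) (fun a _ ↦ by simp) (by simp)
    exact ZMod.val_cast_of_lt (by simpa using hn)
  have key : ∀ k r : ℕ, ∑ n ∈ Finset.range (q * k + r), χ n = ∑ n ∈ Finset.range r, χ n := by
    intro k r
    induction k with
    | zero => simp
    | succ k ih =>
      rw [show q * (k + 1) + r = q + (q * k + r) by ring, Finset.sum_range_add, hq, zero_add,
        ← ih]
      simp
  rw [← Nat.div_add_mod N q, key]
  calc _ ≤ ∑ n ∈ Finset.range (N % q), ‖χ n‖ := norm_sum_le _ _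
    _ ≤ ∑ n ∈ Finset.range (N % q), 1 := Finset.sum_le_sum fun n _ ↦ χ.norm_le_one n
    _ = (N % q : ℕ) := by simp
    _ ≤ q := by exact_mod_cast (Nat.mod_lt _ (NeZero.pos q)).le

/-- Summation by parts for a bounded-oscillation sequence against an antitone weight. -/
theorem norm_sum_Ico_mul_le_of_antitoneOn {c : ℕ → ℂ} {B : ℝ}
    (hc : ∀ N, ‖∑ n ∈ Finset.range N, c n‖ ≤ B) {f : ℕ → ℝ} {a : ℕ}
    (hf : AntitoneOn f (Set.Ici a)) (hf0 : ∀ n, 0 ≤ f n) {b : ℕ} (hab : a ≤ b) :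
    ‖∑ n ∈ Finset.Ico a b, (f n : ℂ) * c n‖ ≤ 2 * B * f a := by
  set S : ℕ → ℂ := fun N ↦ ∑ n ∈ Finset.range N, c n - ∑ n ∈ Finset.range a, c n with hS
  have hSB : ∀ N, ‖S N‖ ≤ 2 * B := fun N ↦ by
    refine (norm_sub_le _ _).trans ?_
    linarith [hc N, hc a]
  have hsucc : ∀ N, S (N + 1) = S N + c N := fun N ↦ by
    simp only [hS, Finset.sum_range_succ]; ring
  have hid : ∀ b, a ≤ b → ∑ n ∈ Finset.Ico a b, (f n : ℂ) * c n =
      f b * S b + ∑ n ∈ Finset.Ico a b, ((f n - f (n + 1) : ℝ) : ℂ) * S (n + 1) := by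
    intro b hb
    induction b, hb using Nat.le_induction with
    | base => simp [hS]
    | succ b hb ih =>
      rw [Finset.sum_Ico_succ_top hb, ih, Finset.sum_Ico_succ_top hb, hsucc]
      push_cast
      ring
  have hdiff : ∀ n, a ≤ n → 0 ≤ f n - f (n + 1) := fun n hn ↦
    sub_nonneg.2 (hf hn (Set.mem_Ici.2 (by omega)) (Nat.le_succ n))
  rw [hid b hab]
  calc _ ≤ ‖(f b : ℂ) * S b‖ + ∑ n ∈ Finset.Ico a b, ‖((f n - f (n + 1) : ℝ) : ℂ) * S (n + 1)‖ :=
        (norm_add_le _ _).trans (by gcongr; exact norm_sum_le _ _)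
    _ ≤ f b * (2 * B) + ∑ n ∈ Finset.Ico a b, (f n - f (n + 1)) * (2 * B) := by
        gcongr with n hn
        · rw [norm_mul, Complex.norm_real, Real.norm_of_nonneg (hf0 b)]
          exact mul_le_mul_of_nonneg_left (hSB b) (hf0 b)
        · rw [norm_mul, Complex.norm_real, Real.norm_of_nonneg (hdiff n (Finset.mem_Ico.1 hn).1)]
          exact mul_le_mul_of_nonneg_left (hSB _) (hdiff n (Finset.mem_Ico.1 hn).1)
    _ = 2 * B * f a := by
        rw [← Finset.sum_mul]
        have : ∑ n ∈ Finset.Ico a b, (f n - f (n + 1)) = f a - f b := by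
          have := Finset.sum_Ico_sub f hab
          rw [← neg_inj, ← Finset.sum_neg_distrib]
          simpa using this
        rw [this]; ring

open Filter Topology in
theorem norm_LFunction_one_sub_sum_le {q : ℕ} [NeZero q] {χ : DirichletCharacter ℂ q}
    (hχ : χ ≠ 1) {N : ℕ} (hN : 0 < N) :
    ‖DirichletCharacter.LFunction χ 1 - ∑ n ∈ Finset.range N, χ n / n‖ ≤ 2 * q / N := by
  have h1 : ∀ s : ℝ, 1 < s →
      ‖DirichletCharacter.LFunction χ s - ∑ n ∈ Finset.range N, χ n * (n : ℂ) ^ (-(s : ℂ))‖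
        ≤ 2 * q / N := by
    intro s hs
    have hs' : 1 < (s : ℂ).re := by simpa
    rw [DirichletCharacter.LFunction_eq_LSeries χ hs']
    have hsum := (DirichletCharacter.LSeriesSummable_of_one_lt_re χ hs').hasSum.tendsto_sum_nat
    have hlim := (hsum.sub_const (∑ n ∈ Finset.range N, χ n * (n : ℂ) ^ (-(s : ℂ)))).norm
    refine le_of_tendsto hlim ?_
    filter_upwards [eventually_ge_atTop N] with M hM
    have hterm : ∀ n : ℕ, LSeries.term (fun n ↦ χ n) s n = χ n * (n : ℂ) ^ (-(s : ℂ)) := by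
      intro n
      rw [LSeries.term_of_ne_zero' (Complex.ne_zero_of_one_lt_re hs'), Complex.cpow_neg,
        div_eq_mul_inv]
    simp_rw [hterm]
    rw [← Finset.sum_Ico_eq_sub _ hM]
    have := norm_sum_Ico_mul_le_of_antitoneOn (norm_sum_range_dirichletCharacter_le hχ)
      (f := fun n : ℕ ↦ (n : ℝ) ^ (-s)) (a := N) (fun m hm n hn hmn ↦ by
        have : (0 : ℝ) < m := by exact_mod_cast hN.trans_le hm
        exact Real.rpow_le_rpow_of_nonpos this (by exact_mod_cast hmn) (by linarith))
      (fun n ↦ by positivity) hM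
    calc _ = ‖∑ n ∈ Finset.Ico N M, (((n : ℝ) ^ (-s) : ℝ) : ℂ) * χ n‖ := by
          congr 1
          refine Finset.sum_congr rfl fun n _ ↦ ?_
          rw [Complex.ofReal_cpow (by positivity)]
          push_cast
          ring
      _ ≤ _ := this
      _ ≤ 2 * q / N := by
          rw [div_eq_mul_inv]
          have hN1 : (1 : ℝ) ≤ N := by exact_mod_cast hN
          gcongr
          rw [← Real.rpow_neg_one]
          exact Real.rpow_le_rpow_of_exponent_le hN1 (by linarith)
  have hc : Tendsto (fun s : ℝ ↦
      ‖DirichletCharacter.LFunction χ s - ∑ n ∈ Finset.range N, χ n * (n : ℂ) ^ (-(s : ℂ))‖)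
      (𝓝[>] 1) (𝓝 ‖DirichletCharacter.LFunction χ 1 - ∑ n ∈ Finset.range N, χ n / n‖) := by
    have hcast : Tendsto (fun s : ℝ ↦ (s : ℂ)) (𝓝[>] 1) (𝓝 1) := by
      have := (Complex.continuous_ofReal.tendsto 1).mono_left
        (nhdsWithin_le_nhds (s := Set.Ioi (1 : ℝ)))
      simpa using this
    refine (Tendsto.sub ?_ (tendsto_finsetSum _ fun n _ ↦ ?_)).norm
    · exact ((DirichletCharacter.differentiable_LFunction hχ).continuous.tendsto 1).comp hcast
    · rcases Nat.eq_zero_or_pos n with rfl | hn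
      · have : Tendsto (fun s : ℝ ↦ χ (0 : ℕ) * ((0 : ℕ) : ℂ) ^ (-(s : ℂ))) (𝓝[>] 1) (𝓝 0) := by
          refine tendsto_const_nhds.congr' ?_
          filter_upwards [self_mem_nhdsWithin] with s hs
          have : -(s : ℂ) ≠ 0 := by
            have : s ≠ 0 := by
              have : 1 < s := hs
              linarith
            simpa using this
          simp [Complex.zero_cpow this]
        simpa using this
      · have hn' : (n : ℂ) ≠ 0 := by exact_mod_cast hn.ne'
        have h2 : Tendsto (fun s : ℝ ↦ (n : ℂ) ^ (-(s : ℂ))) (𝓝[>] 1) (𝓝 ((n : ℂ) ^ (-(1 : ℂ)))) :=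
          (hcast.neg).const_cpow (Or.inl hn')
        rw [Complex.cpow_neg_one] at h2
        simpa [div_eq_mul_inv] using h2.const_mul (χ n)
  refine le_of_tendsto hc ?_
  filter_upwards [self_mem_nhdsWithin] with s hs using h1 s hs

theorem exists_norm_sum_mul_log_div_le {q : ℕ} [NeZero q] {χ : DirichletCharacter ℂ q}
    (hχ : χ ≠ 1) :
    ∃ A : ℝ, ∀ N : ℕ, ‖∑ n ∈ Finset.Ioc 0 N, χ n * Real.log n / n‖ ≤ A := by
  refine ⟨∑ n ∈ Finset.range 3, Real.log n / n + 2 * q * (Real.log 3 / 3), fun N ↦ ?_⟩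
  have h0 : ∀ n : ℕ, 0 ≤ Real.log n / n := fun n ↦
    div_nonneg (Real.log_natCast_nonneg n) (Nat.cast_nonneg n)
  have hterm : ∀ n : ℕ, ‖χ n * Real.log n / n‖ ≤ Real.log n / n := by
    intro n
    rw [mul_div_assoc, norm_mul]
    calc _ ≤ 1 * ‖((Real.log n : ℝ) : ℂ) / n‖ := by gcongr; exact χ.norm_le_one n
      _ = Real.log n / n := by
        rw [one_mul, ← Complex.ofReal_natCast, ← Complex.ofReal_div, Complex.norm_real,
          Real.norm_of_nonneg (h0 n)]
  have hqn : 0 ≤ 2 * q * (Real.log 3 / 3) := by positivity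
  have e : ∑ n ∈ Finset.Ioc 0 N, χ n * Real.log n / n =
      ∑ n ∈ Finset.range (N + 1), χ n * Real.log n / n := by
    rw [Finset.range_eq_Ico, Finset.sum_eq_sum_Ico_succ_bot (by omega)]
    simp only [Nat.cast_zero, Real.log_zero, Complex.ofReal_zero, mul_zero, div_zero, zero_add]
    rfl
  rw [e]
  rcases le_or_gt (N + 1) 3 with h | h
  · calc _ ≤ ∑ n ∈ Finset.range (N + 1), ‖χ n * Real.log n / n‖ := norm_sum_le _ _
      _ ≤ ∑ n ∈ Finset.range (N + 1), Real.log n / n := Finset.sum_le_sum fun n _ ↦ hterm n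
      _ ≤ ∑ n ∈ Finset.range 3, Real.log n / n :=
        Finset.sum_le_sum_of_subset_of_nonneg (Finset.range_mono h) fun n _ _ ↦ h0 n
      _ ≤ _ := by linarith
  · rw [Finset.range_eq_Ico, ← Finset.sum_Ico_consecutive _ (Nat.zero_le 3) h.le,
      ← Finset.range_eq_Ico]
    refine (norm_add_le _ _).trans (add_le_add ?_ ?_)
    · exact (norm_sum_le _ _).trans (Finset.sum_le_sum fun n _ ↦ hterm n)
    · have := norm_sum_Ico_mul_le_of_antitoneOn (norm_sum_range_dirichletCharacter_le hχ)
        (f := fun n : ℕ ↦ Real.log n / n) (a := 3) (fun m hm n hn hmn ↦ by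
          have h3 : ∀ k : ℕ, k ∈ Set.Ici 3 → (k : ℝ) ∈ Set.Ici (Real.exp 1) := fun k hk ↦ by
            have : (3 : ℝ) ≤ k := by exact_mod_cast hk
            exact Real.exp_one_lt_three.le.trans this
          exact Real.log_div_self_antitoneOn (h3 m hm) (h3 n hn) (by exact_mod_cast hmn))
        h0 h.le
      refine le_trans (le_of_eq ?_) (this.trans (by simp))
      congr 1
      refine Finset.sum_congr rfl fun n _ ↦ ?_
      push_cast
      ring

open ArithmeticFunction in
theorem exists_norm_sum_mul_vonMangoldt_div_le {q : ℕ} [NeZero q] {χ : DirichletCharacter ℂ q}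
    (hχ : χ ≠ 1) :
    ∃ A : ℝ, ∀ N : ℕ, ‖∑ n ∈ Finset.Ioc 0 N, χ n * (vonMangoldt n : ℝ) / n‖ ≤ A := by
  obtain ⟨A, hA⟩ := exists_norm_sum_mul_log_div_le hχ
  have hL := DirichletCharacter.LFunction_apply_one_ne_zero hχ
  set L := DirichletCharacter.LFunction χ 1 with hLdef
  refine ⟨(A + 2 * q * (Real.log 4 + 4)) / ‖L‖, fun N ↦ ?_⟩
  rw [le_div_iff₀ (norm_pos_iff.2 hL)]
  let f : ArithmeticFunction ℂ := ⟨fun n ↦ χ n * (vonMangoldt n : ℝ) / n, by simp⟩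
  let g : ArithmeticFunction ℂ := ⟨fun n ↦ χ n / n, by simp⟩
  have hfg : ∀ n, (f * g) n = χ n * Real.log n / n := by
    intro n
    rw [mul_apply, ← vonMangoldt_sum, ← Nat.sum_divisorsAntidiagonal (fun i _ ↦ vonMangoldt i),
      Complex.ofReal_sum, Finset.mul_sum, Finset.sum_div]
    refine Finset.sum_congr rfl fun x hx ↦ ?_
    obtain ⟨h1, h2⟩ := Nat.mem_divisorsAntidiagonal.1 hx
    simp only [f, g, coe_mk]
    rw [← h1]
    push_cast
    rw [map_mul]
    ring
  have hsum := sum_Ioc_mul_eq_sum_sum f g N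
  simp_rw [hfg] at hsum
  rw [mul_comm, ← norm_mul, Finset.mul_sum]
  have hdiff : ∑ n ∈ Finset.Ioc 0 N, L * (χ n * (vonMangoldt n : ℝ) / n) =
      ∑ n ∈ Finset.Ioc 0 N, χ n * Real.log n / n +
      ∑ n ∈ Finset.Ioc 0 N, f n * (L - ∑ m ∈ Finset.Ioc 0 (N / n), g m) := by
    rw [hsum, ← Finset.sum_add_distrib]
    refine Finset.sum_congr rfl fun n _ ↦ ?_
    simp only [f, coe_mk]
    ring
  rw [hdiff]
  refine (norm_add_le _ _).trans (add_le_add (hA N) ?_)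
  have hpsi : ∑ n ∈ Finset.Ioc 0 N, vonMangoldt n ≤ (Real.log 4 + 4) * N := by
    have := Chebyshev.psi_le_const_mul_self (x := (N : ℝ)) (by positivity)
    simpa [Chebyshev.psi] using this
  rcases Nat.eq_zero_or_pos N with rfl | hN
  · simp; positivity
  have hNr : (0 : ℝ) < N := by exact_mod_cast hN
  calc _ ≤ ∑ n ∈ Finset.Ioc 0 N, ‖f n * (L - ∑ m ∈ Finset.Ioc 0 (N / n), g m)‖ := norm_sum_le _ _
    _ ≤ ∑ n ∈ Finset.Ioc 0 N, vonMangoldt n * (2 * q / N) := by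
      refine Finset.sum_le_sum fun n hn ↦ ?_
      have hn0 : 0 < n := (Finset.mem_Ioc.1 hn).1
      have hnr : (0 : ℝ) < n := by exact_mod_cast hn0
      have h1 : ‖f n‖ ≤ vonMangoldt n / n := by
        simp only [f, coe_mk]
        rw [mul_div_assoc, norm_mul]
        calc _ ≤ 1 * ‖((vonMangoldt n : ℝ) : ℂ) / n‖ := by gcongr; exact χ.norm_le_one n
          _ = _ := by
            rw [one_mul, ← Complex.ofReal_natCast, ← Complex.ofReal_div, Complex.norm_real,
              Real.norm_of_nonneg (by positivity)]
      have h2 : ‖L - ∑ m ∈ Finset.Ioc 0 (N / n), g m‖ ≤ 2 * q / (N / n : ℝ) := by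
        have h3 := norm_LFunction_one_sub_sum_le hχ (N := N / n + 1) (Nat.succ_pos _)
        have e : ∑ m ∈ Finset.Ioc 0 (N / n), g m = ∑ n ∈ Finset.range (N / n + 1), χ n / n := by
          rw [Finset.range_eq_Ico, Finset.sum_eq_sum_Ico_succ_bot (Nat.succ_pos _)]
          simp only [g, coe_mk, Nat.cast_zero, div_zero, zero_add]
          rfl
        rw [e]
        refine h3.trans ?_
        have h4 : (N / n : ℝ) ≤ ((N / n + 1 : ℕ) : ℝ) := by
          rw [div_le_iff₀ hnr]
          have := (Nat.lt_mul_div_succ N hn0).le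
          exact_mod_cast (by nlinarith : N ≤ (N / n + 1) * n)
        gcongr
      rw [norm_mul]
      calc _ ≤ vonMangoldt n / n * (2 * q / (N / n : ℝ)) := by gcongr
        _ = _ := by field_simp
    _ ≤ _ := by
      rw [← Finset.sum_mul]
      calc _ ≤ (Real.log 4 + 4) * N * (2 * q / N) := by gcongr
        _ = _ := by field_simp

open ArithmeticFunction in
theorem exists_sum_not_prime_vonMangoldt_div_le :
    ∃ C : ℝ, ∀ N : ℕ, ∑ n ∈ Finset.Ioc 0 N, (if n.Prime then 0 else vonMangoldt n) / n ≤ C := by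
  have hs := vonMangoldt.summable_residueClass_non_primes_div (q := 1) (a := 0)
  have e : ∀ n : ℕ, vonMangoldt.residueClass (0 : ZMod 1) n = vonMangoldt n := fun n ↦
    Set.indicator_of_mem (by simp [Subsingleton.elim (n : ZMod 1) 0]) _
  simp_rw [e] at hs
  refine ⟨_, fun N ↦ hs.sum_le_tsum _ fun n _ ↦ ?_⟩
  split_ifs
  · simp
  · exact div_nonneg vonMangoldt_nonneg (Nat.cast_nonneg _)

open ArithmeticFunction in
/-- Mertens' estimate for a nonprincipal character: `∑_{p ≤ N} χ(p) log p / p = O(1)`. -/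
theorem exists_norm_sum_primes_mul_log_div_le {q : ℕ} [NeZero q] {χ : DirichletCharacter ℂ q}
    (hχ : χ ≠ 1) :
    ∃ A : ℝ, ∀ N : ℕ, ‖∑ p ∈ Nat.primesLE N, χ p * Real.log p / p‖ ≤ A := by
  obtain ⟨A, hA⟩ := exists_norm_sum_mul_vonMangoldt_div_le hχ
  obtain ⟨C, hC⟩ := exists_sum_not_prime_vonMangoldt_div_le
  refine ⟨A + C, fun N ↦ ?_⟩
  have e : ∑ p ∈ Nat.primesLE N, χ p * Real.log p / p =
      ∑ n ∈ Finset.Ioc 0 N, χ n * (vonMangoldt n : ℝ) / n -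
      ∑ n ∈ Finset.Ioc 0 N, χ n * ((if n.Prime then 0 else vonMangoldt n : ℝ) : ℂ) / n := by
    rw [← Finset.sum_sub_distrib]
    have : Nat.primesLE N = (Finset.Ioc 0 N).filter Nat.Prime := by
      ext p
      simp only [Nat.mem_primesLE, Finset.mem_filter, Finset.mem_Ioc]
      exact ⟨fun h ↦ ⟨⟨h.2.pos, h.1⟩, h.2⟩, fun h ↦ ⟨h.1.2, h.2⟩⟩
    rw [this, Finset.sum_filter]
    refine Finset.sum_congr rfl fun n _ ↦ ?_
    split_ifs with h
    · simp [vonMangoldt_apply_prime h]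
    · simp
  rw [e]
  refine (norm_sub_le _ _).trans (add_le_add (hA N) (le_trans ?_ (hC N)))
  refine (norm_sum_le _ _).trans (Finset.sum_le_sum fun n _ ↦ ?_)
  have h0 : 0 ≤ (if n.Prime then 0 else vonMangoldt n : ℝ) := by
    split_ifs
    · exact le_rfl
    · exact vonMangoldt_nonneg
  rw [mul_div_assoc, norm_mul]
  calc _ ≤ 1 * ‖((if n.Prime then 0 else vonMangoldt n : ℝ) : ℂ) / n‖ := by
        gcongr; exact χ.norm_le_one n
    _ = _ := by
      rw [one_mul, ← Complex.ofReal_natCast, ← Complex.ofReal_div, Complex.norm_real,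
        Real.norm_of_nonneg (by positivity)]

/-- The oscillating factor `n ^ (-it)`. -/
noncomputable def osc (n : ℕ) (t : ℝ) : ℂ := Complex.exp (-(t * Real.log n : ℝ) * Complex.I)

theorem norm_osc (n : ℕ) (t : ℝ) : ‖osc n t‖ = 1 := by
  rw [osc, ← Complex.ofReal_neg, Complex.norm_exp_ofReal_mul_I]

theorem osc_one (t : ℝ) : osc 1 t = 1 := by simp [osc]

theorem osc_mul {m n : ℕ} (hm : m ≠ 0) (hn : n ≠ 0) (t : ℝ) :
    osc (m * n) t = osc m t * osc n t := by
  rw [osc, osc, osc, ← Complex.exp_add, Nat.cast_mul, Real.log_mul (by exact_mod_cast hm)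
    (by exact_mod_cast hn)]
  congr 1
  push_cast
  ring

theorem osc_pow {n : ℕ} (hn : n ≠ 0) (k : ℕ) (t : ℝ) : osc (n ^ k) t = osc n t ^ k := by
  induction k with
  | zero => simp [osc_one]
  | succ k ih => rw [pow_succ, osc_mul (pow_ne_zero _ hn) hn, ih, pow_succ]

@[fun_prop]
theorem continuous_osc (n : ℕ) : Continuous (osc n) := by
  unfold osc
  fun_prop

open intervalIntegral in
theorem norm_integral_osc_mul_conj_le {m n N : ℕ} (hm : 1 ≤ m) (hn : 1 ≤ n) (hmN : m ≤ N)
    (hnN : n ≤ N) (hmn : m ≠ n) (a b : ℝ) :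
    ‖∫ t in a..b, osc m t * (starRingEnd ℂ) (osc n t)‖ ≤ 2 * N := by
  have hm0 : (0 : ℝ) < m := by exact_mod_cast hm
  have hn0 : (0 : ℝ) < n := by exact_mod_cast hn
  have hN0 : (0 : ℝ) < N := hm0.trans_le (by exact_mod_cast hmN)
  have key : ∀ {u v : ℕ}, 1 ≤ u → u < v → v ≤ N → 1 / (N : ℝ) ≤ Real.log v - Real.log u := by
    intro u v hu huv hv
    have hu0 : (0 : ℝ) < u := by exact_mod_cast hu
    have hv0 : (0 : ℝ) < v := by exact_mod_cast Nat.zero_lt_of_lt huv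
    have h1 := Real.one_sub_inv_le_log_of_pos (div_pos hv0 hu0)
    rw [Real.log_div hv0.ne' hu0.ne', inv_div] at h1
    refine le_trans ?_ h1
    have h2 : (u : ℝ) + 1 ≤ v := by exact_mod_cast huv
    have h3 : (v : ℝ) ≤ N := by exact_mod_cast hv
    calc 1 / (N : ℝ) ≤ 1 / v := one_div_le_one_div_of_le hv0 h3
      _ ≤ _ := by rw [one_sub_div hv0.ne']; gcongr; linarith
  have hc : 1 / (N : ℝ) ≤ |Real.log n - Real.log m| := by
    rcases lt_or_gt_of_ne hmn with h | h
    · exact (key hm h hnN).trans (le_abs_self _)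
    · rw [abs_sub_comm]
      exact (key hn h hmN).trans (le_abs_self _)
  set c : ℝ := Real.log n - Real.log m with hcdef
  have hc0 : c ≠ 0 := by
    intro h
    rw [h, abs_zero] at hc
    have := one_div_pos.2 hN0
    linarith
  have e : ∀ t : ℝ, osc m t * (starRingEnd ℂ) (osc n t) = Complex.exp ((c * Complex.I) * t) := by
    intro t
    rw [osc, osc, ← Complex.exp_conj, ← Complex.exp_add]
    congr 1
    simp only [map_mul, map_neg, Complex.conj_ofReal, Complex.conj_I, hcdef]
    push_cast
    ring
  simp_rw [e]
  have hcI : (c : ℂ) * Complex.I ≠ 0 := mul_ne_zero (by exact_mod_cast hc0) Complex.I_ne_zero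
  rw [integral_exp_mul_complex hcI, norm_div, norm_mul, Complex.norm_I, mul_one, Complex.norm_real,
    Real.norm_eq_abs]
  have h1 : ∀ x : ℝ, ‖Complex.exp ((c * Complex.I) * x)‖ = 1 := by
    intro x
    have : (c : ℂ) * Complex.I * x = ((c * x : ℝ) : ℂ) * Complex.I := by push_cast; ring
    rw [this, Complex.norm_exp_ofReal_mul_I]
  have h2 := norm_sub_le (Complex.exp ((c * Complex.I) * b)) (Complex.exp ((c * Complex.I) * a))
  rw [h1, h1] at h2
  calc _ ≤ 2 / (1 / (N : ℝ)) := by gcongr; linarith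
    _ = _ := by field_simp

open intervalIntegral in
/-- A crude mean value theorem for Dirichlet polynomials. -/
theorem abs_integral_norm_sq_sub_le {ι : Type*} (s : Finset ι) (ν : ι → ℕ) (b : ι → ℂ) {N : ℕ}
    (hν : Set.InjOn ν s) (h1 : ∀ i ∈ s, 1 ≤ ν i) (h2 : ∀ i ∈ s, ν i ≤ N) {T : ℝ} :
    |(∫ t in T..2 * T, ‖∑ i ∈ s, b i * osc (ν i) t‖ ^ 2) - T * ∑ i ∈ s, ‖b i‖ ^ 2| ≤
      2 * N ^ 2 * ∑ i ∈ s, ‖b i‖ ^ 2 := by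
  classical
  have hcard : (s.card : ℝ) ≤ N := by
    have : s.card ≤ (Finset.Icc 1 N).card :=
      Finset.card_le_card_of_injOn ν (fun i hi ↦ by simp [h1 i hi, h2 i hi]) hν
    rw [Nat.card_Icc, Nat.add_sub_cancel] at this
    exact_mod_cast this
  have hsq : ∀ t : ℝ, ((‖∑ i ∈ s, b i * osc (ν i) t‖ ^ 2 : ℝ) : ℂ) =
      ∑ i ∈ s, ∑ j ∈ s, b i * (starRingEnd ℂ) (b j) *
        (osc (ν i) t * (starRingEnd ℂ) (osc (ν j) t)) := by
    intro t
    rw [Complex.ofReal_pow, ← Complex.mul_conj', map_sum, Finset.sum_mul_sum]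
    refine Finset.sum_congr rfl fun i _ ↦ Finset.sum_congr rfl fun j _ ↦ ?_
    rw [map_mul]
    ring
  have hInt : ((∫ t in T..2 * T, ‖∑ i ∈ s, b i * osc (ν i) t‖ ^ 2 : ℝ) : ℂ) =
      ∑ i ∈ s, ∑ j ∈ s, b i * (starRingEnd ℂ) (b j) *
        ∫ t in T..2 * T, (osc (ν i) t * (starRingEnd ℂ) (osc (ν j) t)) := by
    rw [← intervalIntegral.integral_ofReal]
    simp_rw [hsq]
    have hc : ∀ i j, Continuous fun t ↦ (osc (ν i) t * (starRingEnd ℂ) (osc (ν j) t)) := by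
      intro i j
      exact (continuous_osc _).mul (Complex.continuous_conj.comp (continuous_osc _))
    rw [intervalIntegral.integral_finsetSum]
    · refine Finset.sum_congr rfl fun i _ ↦ ?_
      rw [intervalIntegral.integral_finsetSum]
      · refine Finset.sum_congr rfl fun j _ ↦ ?_
        rw [intervalIntegral.integral_const_mul]
      · intro j _
        exact (continuous_const.mul (hc i j)).intervalIntegrable _ _
    · intro i _
      exact (continuous_finsetSum _ fun j _ ↦
        continuous_const.mul (hc i j)).intervalIntegrable _ _
  have hdiag : ((T * ∑ i ∈ s, ‖b i‖ ^ 2 : ℝ) : ℂ) = ∑ i ∈ s, ∑ j ∈ s, if i = j then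
      b i * (starRingEnd ℂ) (b j) *
        ∫ t in T..2 * T, (osc (ν i) t * (starRingEnd ℂ) (osc (ν j) t)) else 0 := by
    simp only [Finset.sum_ite_eq]
    push_cast
    rw [Finset.mul_sum]
    refine Finset.sum_congr rfl fun i hi ↦ ?_
    rw [if_pos hi]
    simp_rw [Complex.mul_conj', norm_osc]
    simp
    ring
  rw [← Real.norm_eq_abs, ← Complex.norm_real, Complex.ofReal_sub, hInt, hdiag,
    ← Finset.sum_sub_distrib]
  simp_rw [← Finset.sum_sub_distrib]
  calc _ ≤ ∑ i ∈ s, ∑ j ∈ s, ‖b i‖ * ‖b j‖ * (2 * N) := by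
        refine (norm_sum_le _ _).trans (Finset.sum_le_sum fun i hi ↦ (norm_sum_le _ _).trans
          (Finset.sum_le_sum fun j hj ↦ ?_))
        split_ifs with h
        · rw [sub_self, norm_zero]
          positivity
        · rw [sub_zero, norm_mul, norm_mul, RCLike.norm_conj]
          gcongr
          exact norm_integral_osc_mul_conj_le (h1 i hi) (h1 j hj) (h2 i hi) (h2 j hj)
            (fun e ↦ h (hν hi hj e)) _ _
    _ = (2 * N) * (∑ i ∈ s, ‖b i‖) ^ 2 := by
        rw [sq, Finset.sum_mul_sum, Finset.mul_sum]
        refine Finset.sum_congr rfl fun i _ ↦ ?_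
        rw [Finset.mul_sum]
        exact Finset.sum_congr rfl fun j _ ↦ by ring
    _ ≤ (2 * N) * (N * ∑ i ∈ s, ‖b i‖ ^ 2) := by
        gcongr
        refine sq_sum_le_card_mul_sum_sq.trans ?_
        gcongr
    _ = _ := by ring

theorem exists_prod_geom_sum_eq (s : Finset ℕ) (hs : ∀ p ∈ s, p.Prime) (θ : ℕ → ℂ)
    (hθ : ∀ p ∈ s, ‖θ p‖ = 1) (K : ℕ) :
    ∃ (ι : Type) (D : Finset ι) (ν : ι → ℕ) (b : ι → ℂ), Set.InjOn ν D ∧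
      (∀ i ∈ D, 1 ≤ ν i) ∧ (∀ i ∈ D, ν i ≤ ∏ p ∈ s, p ^ K) ∧
      (∀ i ∈ D, ∀ p, p.Prime → p ∣ ν i → p ∈ s) ∧ (∀ i ∈ D, ‖b i‖ = 1) ∧
      D.card = (K + 1) ^ s.card ∧
      ∀ t : ℝ, ∏ p ∈ s, ∑ k ∈ Finset.range (K + 1), (θ p * osc p t) ^ k =
        ∑ i ∈ D, b i * osc (ν i) t := by
  classical
  induction s using Finset.induction_on with
  | empty =>
    refine ⟨Unit, {()}, fun _ ↦ 1, fun _ ↦ 1, by simp, by simp, by simp, ?_, by simp, by simp, ?_⟩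
    · intro i _ p hp h
      exact absurd (Nat.dvd_one.1 h) hp.one_lt.ne'
    · simp [osc_one]
  | insert p s hp ih =>
    obtain ⟨ι, D, ν, b, hν, h1, hle, hdvd, hb, hcard, hsum⟩ :=
      ih (fun q hq ↦ hs q (Finset.mem_insert_of_mem hq))
        (fun q hq ↦ hθ q (Finset.mem_insert_of_mem hq))
    have hpp := hs p (Finset.mem_insert_self _ _)
    have hnd : ∀ i ∈ D, ¬ p ∣ ν i := fun i hi h ↦ hp (hdvd i hi p hpp h)
    refine ⟨ℕ × ι, Finset.range (K + 1) ×ˢ D, fun x ↦ p ^ x.1 * ν x.2,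
      fun x ↦ θ p ^ x.1 * b x.2, ?_, ?_, ?_, ?_, ?_, ?_, ?_⟩
    · rintro ⟨k, i⟩ hx ⟨l, j⟩ hy h
      simp only [Finset.coe_product, Set.mem_prod, Finset.mem_coe] at hx hy h
      have hk : ∀ (k : ℕ) (i : ι), i ∈ D → (p ^ k * ν i).factorization p = k := by
        intro k i hi
        rw [Nat.factorization_mul (pow_ne_zero _ hpp.ne_zero) (by have := h1 i hi; omega)]
        simp [hpp.factorization_self, Nat.factorization_eq_zero_of_not_dvd (hnd i hi)]
      have hkl : k = l := by rw [← hk k i hx.2, h, hk l j hy.2]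
      subst hkl
      rw [hν hx.2 hy.2 (Nat.eq_of_mul_eq_mul_left (pow_pos hpp.pos _) h)]
    · rintro ⟨k, i⟩ hx
      exact Nat.mul_pos (pow_pos hpp.pos _) (h1 i (Finset.mem_product.1 hx).2)
    · rintro ⟨k, i⟩ hx
      rw [Finset.mem_product, Finset.mem_range] at hx
      rw [Finset.prod_insert hp]
      exact Nat.mul_le_mul (Nat.pow_le_pow_right hpp.pos (by omega)) (hle i hx.2)
    · rintro ⟨k, i⟩ hx r hr hri
      rw [Finset.mem_product] at hx
      rcases (Nat.Prime.dvd_mul hr).1 hri with h | h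
      · rw [(Nat.prime_dvd_prime_iff_eq hr hpp).1 (hr.dvd_of_dvd_pow h)]
        exact Finset.mem_insert_self _ _
      · exact Finset.mem_insert_of_mem (hdvd i hx.2 r hr h)
    · rintro ⟨k, i⟩ hx
      rw [norm_mul, norm_pow, hθ p (Finset.mem_insert_self _ _), hb i (Finset.mem_product.1 hx).2]
      simp
    · rw [Finset.card_product, Finset.card_range, hcard, Finset.card_insert_of_notMem hp, pow_succ']
    · intro t
      rw [Finset.prod_insert hp, hsum, Finset.sum_mul_sum, Finset.sum_product]
      refine Finset.sum_congr rfl fun k _ ↦ Finset.sum_congr rfl fun i hi ↦ ?_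
      rw [osc_mul (pow_ne_zero _ hpp.ne_zero) (Nat.one_le_iff_ne_zero.1 (h1 i hi)), osc_pow hpp.ne_zero,
        mul_pow]
      ring

theorem integral_norm_sq_bounds {ι : Type*} (s : Finset ι) (ν : ι → ℕ) (b : ι → ℂ) {N : ℕ}
    (hν : Set.InjOn ν s) (h1 : ∀ i ∈ s, 1 ≤ ν i) (h2 : ∀ i ∈ s, ν i ≤ N) {T : ℝ}
    (hT : 4 * (N : ℝ) ^ 2 ≤ T) :
    T / 2 * ∑ i ∈ s, ‖b i‖ ^ 2 ≤ ∫ t in T..2 * T, ‖∑ i ∈ s, b i * osc (ν i) t‖ ^ 2 ∧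
      ∫ t in T..2 * T, ‖∑ i ∈ s, b i * osc (ν i) t‖ ^ 2 ≤ 3 * T / 2 * ∑ i ∈ s, ‖b i‖ ^ 2 := by
  have h := abs_le.1 (abs_integral_norm_sq_sub_le s ν b hν h1 h2 (T := T))
  have h3 : 2 * (N : ℝ) ^ 2 * ∑ i ∈ s, ‖b i‖ ^ 2 ≤ T / 2 * ∑ i ∈ s, ‖b i‖ ^ 2 := by
    gcongr
    linarith
  constructor <;> linarith [h.1, h.2]

/-- Resonance: a common value of `t` at which all `θ p * p ^ (-it)` with `p ∈ s` are close to `1`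
on average, while some Dirichlet polynomials supported on other primes are of their mean square
size. -/
theorem exists_resonance {J : Type*} [Fintype J] (s Q : Finset ℕ) (hs : ∀ p ∈ s, p.Prime)
    (hQ : ∀ p ∈ Q, p.Prime) (hsQ : Disjoint s Q) (θ : ℕ → ℂ) (hθ : ∀ p ∈ s, ‖θ p‖ = 1) {K Z N : ℕ}
    (hZ : 1 ≤ Z) (hQZ : ∀ p ∈ Q, p ≤ Z) (hN : (∏ p ∈ s, p ^ K) * Z ≤ N) {T : ℝ}
    (hT : 4 * (N : ℝ) ^ 2 ≤ T) (w : ℕ → ℝ) (hw : ∀ p, 0 ≤ w p) (a : J → ℕ → ℂ) {e : ℝ} (he : 0 < e)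
    (hle : ∑ p ∈ s, w p * (4 / (K + 1)) + ∑ j, ∑ p ∈ Q, ‖a j p‖ ^ 2 ≤ e) :
    ∃ t ∈ Set.Icc T (2 * T), ∑ p ∈ s, w p * ‖1 - θ p * osc p t‖ ^ 2 +
      ∑ j, ‖∑ p ∈ Q, a j p * osc p t‖ ^ 2 ≤ 4 * e := by
  classical
  have hprod : 1 ≤ ∏ p ∈ s, p ^ K := Finset.one_le_prod' fun p hp ↦ Nat.one_le_pow _ _ (hs p hp).pos
  have hN1 : 1 ≤ N := le_trans (Nat.mul_pos hprod hZ) hN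
  have hT0 : 0 < T := lt_of_lt_of_le (by positivity) hT
  have hprodN : ∏ p ∈ s, p ^ K ≤ N := (Nat.le_mul_of_pos_right _ hZ).trans hN
  set D : ℝ := ((K : ℝ) + 1) ^ s.card with hD
  have hD0 : 0 < D := by positivity
  let R : ℝ → ℂ := fun t ↦ ∏ p ∈ s, ∑ k ∈ Finset.range (K + 1), (θ p * osc p t) ^ k
  have hRc : Continuous R := by fun_prop
  have hR : T / 2 * D ≤ ∫ t in T..2 * T, ‖R t‖ ^ 2 := by
    obtain ⟨ι, I, ν, b, hν, h1, h2, -, hb, hcard, hsum⟩ := exists_prod_geom_sum_eq s hs θ hθ K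
    have := (integral_norm_sq_bounds I ν b hν h1 (fun i hi ↦ (h2 i hi).trans hprodN) hT).1
    simp_rw [← hsum] at this
    rwa [Finset.sum_congr rfl (fun i hi ↦ by rw [hb i hi, one_pow]), Finset.sum_const, hcard,
      nsmul_one, Nat.cast_pow, Nat.cast_add, Nat.cast_one] at this
  have hP : ∀ p ∈ s, ∫ t in T..2 * T, ‖R t‖ ^ 2 * ‖1 - θ p * osc p t‖ ^ 2 ≤
      3 * T / 2 * D * (4 / (K + 1)) := by
    intro p hp
    obtain ⟨ι, I, ν, b, hν, h1, h2, -, hb, hcard, hsum⟩ := exists_prod_geom_sum_eq (s.erase p)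
      (fun q hq ↦ hs q (Finset.mem_of_mem_erase hq)) θ
      (fun q hq ↦ hθ q (Finset.mem_of_mem_erase hq)) K
    have hle' : ∏ q ∈ s.erase p, q ^ K ≤ ∏ q ∈ s, q ^ K :=
      Finset.prod_le_prod_of_subset_of_one_le' (Finset.erase_subset _ _)
        fun q hq _ ↦ Nat.one_le_pow _ _ (hs q hq).pos
    have hub := (integral_norm_sq_bounds I ν b hν h1
      (fun i hi ↦ ((h2 i hi).trans hle').trans hprodN) hT).2
    rw [Finset.sum_congr rfl (fun i hi ↦ by rw [hb i hi, one_pow]), Finset.sum_const, hcard,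
      nsmul_one, Nat.cast_pow, Nat.cast_add, Nat.cast_one] at hub
    have hDp : D = ((K : ℝ) + 1) ^ (s.erase p).card * (K + 1) := by
      rw [hD, ← pow_succ, Finset.card_erase_add_one hp]
    calc _ ≤ ∫ t in T..2 * T, 4 * ‖∑ i ∈ I, b i * osc (ν i) t‖ ^ 2 := by
          refine intervalIntegral.integral_mono_on (by linarith) (Continuous.intervalIntegrable
            (by fun_prop) _ _) (Continuous.intervalIntegrable (by fun_prop) _ _) fun t _ ↦ ?_
          have e1 : ‖R t‖ ^ 2 * ‖1 - θ p * osc p t‖ ^ 2 = (‖1 - (θ p * osc p t) ^ (K + 1)‖ *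
              ‖∑ i ∈ I, b i * osc (ν i) t‖) ^ 2 := by
            rw [← hsum, ← mul_pow, ← norm_mul, ← norm_mul, ← mul_neg_geom_sum]
            simp only [R]
            rw [← Finset.mul_prod_erase s _ hp]
            congr 2
            ring
          have e2 : ‖1 - (θ p * osc p t) ^ (K + 1)‖ ≤ 2 := by
            refine (norm_sub_le _ _).trans ?_
            rw [norm_pow, norm_mul, hθ p hp, norm_osc]
            norm_num
          rw [e1]
          calc _ ≤ (2 * ‖∑ i ∈ I, b i * osc (ν i) t‖) ^ 2 := by gcongr
            _ = _ := by ring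
      _ = 4 * ∫ t in T..2 * T, ‖∑ i ∈ I, b i * osc (ν i) t‖ ^ 2 :=
          intervalIntegral.integral_const_mul _ _
      _ ≤ 4 * (3 * T / 2 * ((K : ℝ) + 1) ^ (s.erase p).card) := by gcongr
      _ = _ := by rw [hDp]; field_simp
  have hJ : ∀ j, ∫ t in T..2 * T, ‖R t‖ ^ 2 * ‖∑ p ∈ Q, a j p * osc p t‖ ^ 2 ≤
      3 * T / 2 * D * ∑ p ∈ Q, ‖a j p‖ ^ 2 := by
    intro j
    obtain ⟨ι, I, ν, b, hν, h1, h2, hdvd, hb, hcard, hsum⟩ := exists_prod_geom_sum_eq s hs θ hθ K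
    have hnd : ∀ i ∈ I, ∀ p ∈ Q, ¬ p ∣ ν i := fun i hi p hp h ↦
      (Finset.disjoint_left.1 hsQ) (hdvd i hi p (hQ p hp) h) hp
    have hub := (integral_norm_sq_bounds (I ×ˢ Q) (fun x ↦ ν x.1 * x.2)
      (fun x ↦ b x.1 * a j x.2) (N := N) (T := T) ?_ ?_ ?_ hT).2
    · have e1 : ∀ t, ∑ i ∈ I ×ˢ Q, b i.1 * a j i.2 * osc (ν i.1 * i.2) t =
          R t * ∑ p ∈ Q, a j p * osc p t := by
        intro t
        simp only [R]
        rw [hsum, Finset.sum_mul_sum, Finset.sum_product]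
        refine Finset.sum_congr rfl fun i hi ↦ Finset.sum_congr rfl fun p hp ↦ ?_
        rw [osc_mul (Nat.one_le_iff_ne_zero.1 (h1 i hi)) (hQ p hp).ne_zero]
        ring
      have e2 : ∑ i ∈ I ×ˢ Q, ‖b i.1 * a j i.2‖ ^ 2 = D * ∑ p ∈ Q, ‖a j p‖ ^ 2 := by
        rw [Finset.sum_product]
        have : ∀ i ∈ I, ∑ p ∈ Q, ‖b i * a j p‖ ^ 2 = ∑ p ∈ Q, ‖a j p‖ ^ 2 := fun i hi ↦ by
          simp_rw [norm_mul, hb i hi, one_mul]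
        rw [Finset.sum_congr rfl this, Finset.sum_const, hcard, nsmul_eq_mul]
        push_cast
        rfl
      simp_rw [e1, e2, norm_mul, mul_pow] at hub
      linarith
    · rintro ⟨i, p⟩ hx ⟨k, r⟩ hy h
      simp only [Finset.coe_product, Set.mem_prod, Finset.mem_coe] at hx hy h
      have hpr : p = r := by
        have h3 : p ∣ ν k * r := h ▸ Dvd.intro_left _ rfl
        exact (Nat.prime_dvd_prime_iff_eq (hQ p hx.2) (hQ r hy.2)).1
          (((hQ p hx.2).dvd_mul.1 h3).resolve_left (hnd k hy.1 p hx.2))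
      subst hpr
      rw [hν hx.1 hy.1 (Nat.eq_of_mul_eq_mul_right (hQ p hx.2).pos h)]
    · rintro ⟨i, p⟩ hx
      rw [Finset.mem_product] at hx
      exact Nat.mul_pos (h1 i hx.1) (hQ p hx.2).pos
    · rintro ⟨i, p⟩ hx
      rw [Finset.mem_product] at hx
      exact (Nat.mul_le_mul (h2 i hx.1) (hQZ p hx.2)).trans hN
  by_contra! hcon
  have hbig : 4 * e * (T / 2 * D) ≤ ∫ t in T..2 * T, ‖R t‖ ^ 2 *
      (∑ p ∈ s, w p * ‖1 - θ p * osc p t‖ ^ 2 + ∑ j, ‖∑ p ∈ Q, a j p * osc p t‖ ^ 2) := by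
    calc _ ≤ 4 * e * ∫ t in T..2 * T, ‖R t‖ ^ 2 := by gcongr
      _ = ∫ t in T..2 * T, ‖R t‖ ^ 2 * (4 * e) := by
        rw [intervalIntegral.integral_mul_const, mul_comm]
      _ ≤ _ := by
        refine intervalIntegral.integral_mono_on (by linarith) (Continuous.intervalIntegrable
            (by fun_prop) _ _) (Continuous.intervalIntegrable (by fun_prop) _ _) fun t ht ↦ ?_
        have := (hcon t ht).le
        gcongr
  have hsmall : ∫ t in T..2 * T, ‖R t‖ ^ 2 *
      (∑ p ∈ s, w p * ‖1 - θ p * osc p t‖ ^ 2 + ∑ j, ‖∑ p ∈ Q, a j p * osc p t‖ ^ 2) ≤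
      3 * T / 2 * D * e := by
    have e1 : ∀ t, ‖R t‖ ^ 2 *
        (∑ p ∈ s, w p * ‖1 - θ p * osc p t‖ ^ 2 + ∑ j, ‖∑ p ∈ Q, a j p * osc p t‖ ^ 2) =
        ∑ p ∈ s, w p * (‖R t‖ ^ 2 * ‖1 - θ p * osc p t‖ ^ 2) +
          ∑ j, ‖R t‖ ^ 2 * ‖∑ p ∈ Q, a j p * osc p t‖ ^ 2 := by
      intro t
      rw [mul_add, Finset.mul_sum, Finset.mul_sum]
      congr 1
      exact Finset.sum_congr rfl fun p _ ↦ by ring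
    simp_rw [e1]
    rw [intervalIntegral.integral_add, intervalIntegral.integral_finsetSum,
      intervalIntegral.integral_finsetSum]
    · simp_rw [intervalIntegral.integral_const_mul]
      calc _ ≤ ∑ p ∈ s, w p * (3 * T / 2 * D * (4 / (K + 1))) +
            ∑ j, 3 * T / 2 * D * ∑ p ∈ Q, ‖a j p‖ ^ 2 := by
            refine add_le_add (Finset.sum_le_sum fun p hp ↦ ?_) (Finset.sum_le_sum fun j _ ↦ hJ j)
            exact mul_le_mul_of_nonneg_left (hP p hp) (hw p)
        _ = 3 * T / 2 * D * (∑ p ∈ s, w p * (4 / (K + 1)) + ∑ j, ∑ p ∈ Q, ‖a j p‖ ^ 2) := by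
            rw [mul_add, Finset.mul_sum, Finset.mul_sum]
            congr 1
            exact Finset.sum_congr rfl fun p _ ↦ by ring
        _ ≤ _ := by gcongr
    · exact fun j _ ↦ Continuous.intervalIntegrable (by fun_prop) _ _
    · exact fun j _ ↦ Continuous.intervalIntegrable (by fun_prop) _ _
    · exact Continuous.intervalIntegrable (by fun_prop) _ _
    · exact Continuous.intervalIntegrable (by fun_prop) _ _
  have : 0 < T * D * e := by positivity
  linarith

open Filter Topology in
theorem exists_sum_log_pow_div_sq_le (k : ℕ) :
    ∃ C : ℝ, 0 < C ∧ ∀ (y : ℕ) (E : Finset ℕ), 1 ≤ y → (∀ n ∈ E, y ≤ n) →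
      ∑ n ∈ E, Real.log n ^ k / (n : ℝ) ^ 2 ≤ C * (y : ℝ) ^ (-(1 / 4) : ℝ) := by
  have h1 : (fun x : ℝ ↦ Real.log x ^ (k : ℝ)) =o[atTop] fun x ↦ x ^ (1 / 2 : ℝ) :=
    isLittleO_log_rpow_rpow_atTop _ (by norm_num)
  have h2 := (h1.bound one_pos).natCast_atTop
  obtain ⟨N, hN⟩ := eventually_atTop.1 h2
  have hfin : ∃ C : ℝ, 1 ≤ C ∧ ∀ n : ℕ, 1 ≤ n → Real.log n ^ k ≤ C * (n : ℝ) ^ (1 / 2 : ℝ) := by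
    refine ⟨1 + Real.log (N + 1) ^ k, ?_, fun n hn ↦ ?_⟩
    · have : 0 ≤ Real.log (N + 1) := Real.log_nonneg (by simp)
      have : 0 ≤ Real.log (N + 1) ^ k := by positivity
      linarith
    have hn1 : (1 : ℝ) ≤ n := by exact_mod_cast hn
    have hr : (1 : ℝ) ≤ (n : ℝ) ^ (1 / 2 : ℝ) := Real.one_le_rpow hn1 (by norm_num)
    have hl : 0 ≤ Real.log n := Real.log_nonneg hn1
    have hN0 : 0 ≤ Real.log (N + 1) ^ k := by
      have : 0 ≤ Real.log ((N : ℝ) + 1) := Real.log_nonneg (by simp)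
      positivity
    rcases le_total N n with h | h
    · have := hN n h
      rw [one_mul, Real.rpow_natCast, Real.norm_of_nonneg (by positivity),
        Real.norm_of_nonneg (by positivity)] at this
      nlinarith
    · have : Real.log n ^ k ≤ Real.log (N + 1) ^ k := by
        have : (n : ℝ) ≤ N := by exact_mod_cast h
        gcongr
        linarith
      nlinarith
  obtain ⟨C, hC1, hC⟩ := hfin
  have hs : Summable fun n : ℕ ↦ (n : ℝ) ^ (-(5 / 4) : ℝ) :=
    Real.summable_nat_rpow.2 (by norm_num)
  have hs0 : 0 ≤ ∑' n : ℕ, (n : ℝ) ^ (-(5 / 4) : ℝ) := tsum_nonneg fun n ↦ by positivity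
  refine ⟨C * (1 + ∑' n : ℕ, (n : ℝ) ^ (-(5 / 4) : ℝ)), by positivity, fun y E hy hE ↦ ?_⟩
  have hy0 : (0 : ℝ) < y := by exact_mod_cast hy
  calc ∑ n ∈ E, Real.log n ^ k / (n : ℝ) ^ 2
      ≤ ∑ n ∈ E, C * (y : ℝ) ^ (-(1 / 4) : ℝ) * (n : ℝ) ^ (-(5 / 4) : ℝ) := by
        refine Finset.sum_le_sum fun n hn ↦ ?_
        have hyn : (y : ℝ) ≤ n := by exact_mod_cast hE n hn
        have hn0 : (0 : ℝ) < n := hy0.trans_le hyn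
        calc _ ≤ C * (n : ℝ) ^ (1 / 2 : ℝ) / (n : ℝ) ^ 2 := by
              gcongr; exact hC n (hy.trans (hE n hn))
          _ = C * (n : ℝ) ^ (-(1 / 4) : ℝ) * (n : ℝ) ^ (-(5 / 4) : ℝ) := by
              rw [← Real.rpow_natCast, mul_div_assoc, ← Real.rpow_sub hn0, mul_assoc,
                ← Real.rpow_add hn0]
              norm_num
          _ ≤ _ := by
              gcongr ?_ * ?_ * _
              exact Real.rpow_le_rpow_of_nonpos hy0 hyn (by norm_num)
    _ = C * (y : ℝ) ^ (-(1 / 4) : ℝ) * ∑ n ∈ E, (n : ℝ) ^ (-(5 / 4) : ℝ) := by rw [Finset.mul_sum]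
    _ ≤ C * (y : ℝ) ^ (-(1 / 4) : ℝ) * (1 + ∑' n : ℕ, (n : ℝ) ^ (-(5 / 4) : ℝ)) := by
        gcongr
        have := hs.sum_le_tsum E fun n _ ↦ by positivity
        linarith
    _ = _ := by ring

theorem sum_primesLE_inv_le (y : ℕ) :
    ∑ p ∈ Nat.primesLE y, (1 : ℝ) / p ≤ 1 + Real.log y := by
  refine le_trans ?_ (harmonic_le_one_add_log y)
  rw [harmonic_eq_sum_Icc]
  push_cast
  simp_rw [one_div]
  refine Finset.sum_le_sum_of_subset_of_nonneg (fun p hp ↦ ?_) fun n _ _ ↦ by positivity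
  rw [Nat.mem_primesLE] at hp
  exact Finset.mem_Icc.2 ⟨hp.2.pos, hp.1⟩

/-- The disc automorphism used to realise prescribed values of `θ / (P - θ)`. -/
noncomputable def discAut (P : ℝ) (φ : ℂ) : ℂ := (φ * P + 1) / (P + φ)

theorem ofReal_add_ne_zero_of_norm_eq_one {P : ℝ} (hP : 1 < P) {φ : ℂ} (hφ : ‖φ‖ = 1) :
    (P : ℂ) + φ ≠ 0 := by
  intro h
  have : φ = -(P : ℂ) := by linear_combination h
  rw [this, norm_neg, Complex.norm_real, Real.norm_eq_abs, abs_of_pos (by linarith)] at hφ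
  linarith

theorem norm_discAut {P : ℝ} (hP : 1 < P) {φ : ℂ} (hφ : ‖φ‖ = 1) : ‖discAut P φ‖ = 1 := by
  have h0 := ofReal_add_ne_zero_of_norm_eq_one hP hφ
  have h1 : φ * (starRingEnd ℂ) φ = 1 := by rw [Complex.mul_conj', hφ]; simp
  have h2 : φ * P + 1 = φ * (starRingEnd ℂ) (P + φ) := by
    rw [map_add, Complex.conj_ofReal, mul_add, h1]
  rw [discAut, norm_div, h2, norm_mul, RCLike.norm_conj, hφ, one_mul, div_self (norm_ne_zero_iff.2 h0)]

theorem sub_discAut {P : ℝ} (hP : 1 < P) {φ : ℂ} (hφ : ‖φ‖ = 1) :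
    P - discAut P φ = (P ^ 2 - 1) / (P + φ) := by
  have h0 := ofReal_add_ne_zero_of_norm_eq_one hP hφ
  rw [discAut, eq_div_iff h0, sub_mul, div_mul_cancel₀ _ h0]
  ring

theorem ofReal_sq_sub_one_ne_zero {P : ℝ} (hP : 1 < P) : (P : ℂ) ^ 2 - 1 ≠ 0 := by
  have : P ^ 2 - 1 ≠ 0 := by nlinarith
  exact_mod_cast this

theorem discAut_div_sub {P : ℝ} (hP : 1 < P) {φ : ℂ} (hφ : ‖φ‖ = 1) :
    discAut P φ / (P - discAut P φ) = (1 + P * φ) / (P ^ 2 - 1) := by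
  have h0 := ofReal_add_ne_zero_of_norm_eq_one hP hφ
  have h1 := ofReal_sq_sub_one_ne_zero hP
  rw [sub_discAut hP hφ, discAut]
  field_simp
  ring

theorem discAut_mul_div_sub_sq {P : ℝ} (hP : 1 < P) {φ : ℂ} (hφ : ‖φ‖ = 1) :
    discAut P φ * P / (P - discAut P φ) ^ 2 = P * (φ * P + 1) * (P + φ) / (P ^ 2 - 1) ^ 2 := by
  have h0 := ofReal_add_ne_zero_of_norm_eq_one hP hφ
  have h1 := ofReal_sq_sub_one_ne_zero hP
  rw [sub_discAut hP hφ, discAut]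
  field_simp

theorem norm_discAut_mul_div_sub_sq_le {P : ℝ} (hP : 3 ≤ P) {φ : ℂ} (hφ : ‖φ‖ = 1) :
    ‖discAut P φ * P / (P - discAut P φ) ^ 2‖ ≤ 2 * (P / (P ^ 2 - 1)) := by
  have h : 0 < P ^ 2 - 1 := by nlinarith
  have e : ‖((P : ℂ) ^ 2 - 1) ^ 2‖ = (P ^ 2 - 1) ^ 2 := by
    rw [norm_pow]
    congr 1
    rw [← Complex.ofReal_pow, ← Complex.ofReal_one, ← Complex.ofReal_sub, Complex.norm_real,
      Real.norm_of_nonneg h.le]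
  have eP : ‖(P : ℂ)‖ = P := by rw [Complex.norm_real, Real.norm_of_nonneg (by linarith)]
  rw [discAut_mul_div_sub_sq (by linarith) hφ, norm_div, e, norm_mul, norm_mul, eP]
  have h1 : ‖φ * P + 1‖ ≤ P + 1 := by
    refine (norm_add_le _ _).trans ?_
    rw [norm_mul, hφ, eP, norm_one, one_mul]
  have h2 : ‖(P : ℂ) + φ‖ ≤ P + 1 := by
    refine (norm_add_le _ _).trans ?_
    rw [hφ, eP]
  calc _ ≤ P * (P + 1) * (P + 1) / (P ^ 2 - 1) ^ 2 := by gcongr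
    _ ≤ _ := by
      rw [div_le_iff₀ (by positivity)]
      have : 2 * (P / (P ^ 2 - 1)) * (P ^ 2 - 1) ^ 2 = 2 * P * (P ^ 2 - 1) := by field_simp
      rw [this]
      nlinarith [mul_nonneg (by linarith : 0 ≤ P * (P + 1)) (by linarith : 0 ≤ P - 3)]

theorem le_discAut_sub_discAut {P : ℝ} (hP : 1 < P) :
    ∃ x : ℝ, 2 * (P / (P ^ 2 - 1)) ≤ x ∧ discAut P 1 * P / (P - discAut P 1) ^ 2 -
      discAut P (-1) * P / (P - discAut P (-1)) ^ 2 = x := by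
  have h : 0 < P ^ 2 - 1 := by nlinarith
  refine ⟨P * (2 * P ^ 2 + 2) / (P ^ 2 - 1) ^ 2, ?_, ?_⟩
  · rw [le_div_iff₀ (by positivity)]
    have : 2 * (P / (P ^ 2 - 1)) * (P ^ 2 - 1) ^ 2 = 2 * P * (P ^ 2 - 1) := by field_simp
    rw [this]
    nlinarith
  · rw [discAut_mul_div_sub_sq hP (by simp), discAut_mul_div_sub_sq hP (by simp), ← sub_div]
    push_cast
    ring

theorem exists_add_eq_of_abs_sub_le {R₁ R₂ : ℝ} (h₁ : 0 ≤ R₁) (h₂ : 0 ≤ R₂) {w : ℂ}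
    (hl : |R₁ - R₂| ≤ ‖w‖) (hu : ‖w‖ ≤ R₁ + R₂) :
    ∃ φ₁ φ₂ : ℂ, ‖φ₁‖ = 1 ∧ ‖φ₂‖ = 1 ∧ R₁ * φ₁ + R₂ * φ₂ = w := by
  have hf : ContinuousOn (fun β : ℝ ↦ ‖(R₁ : ℂ) + R₂ * Complex.exp (β * Complex.I)‖)
      (Set.Icc 0 Real.pi) := by fun_prop
  have hmem := intermediate_value_Icc' Real.pi_pos.le hf (a := 0) (b := Real.pi)
  have hw : ‖w‖ ∈ Set.Icc ‖(R₁ : ℂ) + R₂ * Complex.exp ((Real.pi : ℝ) * Complex.I)‖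
      ‖(R₁ : ℂ) + R₂ * Complex.exp ((0 : ℝ) * Complex.I)‖ := by
    rw [Complex.exp_pi_mul_I]
    simp only [Complex.ofReal_zero, zero_mul, Complex.exp_zero, mul_one, mul_neg, ← sub_eq_add_neg]
    rw [← Complex.ofReal_sub, ← Complex.ofReal_add, Complex.norm_real, Complex.norm_real,
      Real.norm_eq_abs, Real.norm_eq_abs, abs_of_nonneg (add_nonneg h₁ h₂)]
    exact ⟨hl, hu⟩
  obtain ⟨β, -, hβ⟩ := hmem hw
  simp only at hβ
  set z := (R₁ : ℂ) + R₂ * Complex.exp (β * Complex.I) with hz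
  have he := Complex.norm_exp_ofReal_mul_I β
  by_cases h0 : w = 0
  · refine ⟨1, Complex.exp (β * Complex.I), by simp, he, ?_⟩
    rw [h0, norm_zero, norm_eq_zero] at hβ
    rw [h0, mul_one, ← hz, hβ]
  · have hz0 : z ≠ 0 := by
      rw [← norm_ne_zero_iff, hβ]
      exact norm_ne_zero_iff.2 h0
    have hwz : ‖w / z‖ = 1 := by
      rw [norm_div, hβ, div_self (norm_ne_zero_iff.2 h0)]
    refine ⟨w / z, w / z * Complex.exp (β * Complex.I), hwz, by rw [norm_mul, hwz, he, one_mul], ?_⟩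
    calc _ = w / z * z := by rw [hz]; ring
      _ = w := div_mul_cancel₀ _ hz0

/-- The argument assigned to a generic prime: the one making `χ p * baseAngle χ p` equal to `1`. -/
noncomputable def baseAngle {q : ℕ} (χ : DirichletCharacter ℂ q) (p : ℕ) : ℂ :=
  if p ∣ q then 1 else (starRingEnd ℂ) (χ p)

theorem norm_dirichletCharacter_of_prime {q : ℕ} (χ : DirichletCharacter ℂ q) {p : ℕ}
    (hp : p.Prime) (h : ¬ p ∣ q) : ‖χ p‖ = 1 := by
  have hu : IsUnit (p : ZMod q) := (ZMod.isUnit_iff_coprime _ _).2 ((hp.coprime_iff_not_dvd).2 h)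
  obtain ⟨u, hu⟩ := hu
  rw [← hu]
  exact χ.unit_norm_eq_one u

theorem dirichletCharacter_apply_of_dvd {q : ℕ} (χ : DirichletCharacter ℂ q) {p : ℕ}
    (hp : p.Prime) (h : p ∣ q) : χ p = 0 :=
  χ.map_nonunit fun hu ↦ (hp.coprime_iff_not_dvd.1 ((ZMod.isUnit_iff_coprime _ _).1 hu)) h

theorem norm_baseAngle {q : ℕ} (χ : DirichletCharacter ℂ q) {p : ℕ} (hp : p.Prime) :
    ‖baseAngle χ p‖ = 1 := by
  unfold baseAngle
  split_ifs with h
  · simp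
  · rw [RCLike.norm_conj, norm_dirichletCharacter_of_prime χ hp h]

theorem one_sub_rpow_neg_le {x δ : ℝ} (hx : 0 < x) : 1 - x ^ (-δ) ≤ δ * Real.log x := by
  have := Real.add_one_le_exp (-(δ * Real.log x))
  rw [Real.rpow_def_of_pos hx]
  have e : Real.log x * -δ = -(δ * Real.log x) := by ring
  rw [e]
  linarith

theorem natCast_le_rpow_one_add {p : ℕ} (hp : 1 ≤ p) {δ : ℝ} (hδ : 0 ≤ δ) :
    (p : ℝ) ≤ (p : ℝ) ^ (1 + δ) := by
  have h1 : (1 : ℝ) ≤ p := by exact_mod_cast hp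
  calc (p : ℝ) = (p : ℝ) ^ (1 : ℝ) := (Real.rpow_one _).symm
    _ ≤ _ := Real.rpow_le_rpow_of_exponent_le h1 (by linarith)

theorem inv_sub_inv_rpow_le {p : ℕ} (hp : 1 ≤ p) {δ : ℝ} :
    1 / (p : ℝ) - 1 / (p : ℝ) ^ (1 + δ) ≤ δ * Real.log p / p := by
  have h0 : (0 : ℝ) < p := by exact_mod_cast hp
  have h := one_sub_rpow_neg_le h0 (δ := δ)
  rw [Real.rpow_add h0, Real.rpow_one]
  rw [Real.rpow_neg h0.le] at h
  calc 1 / (p : ℝ) - 1 / (p * (p : ℝ) ^ δ) = (1 - ((p : ℝ) ^ δ)⁻¹) / p := by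
        have := Real.rpow_pos_of_pos h0 δ
        field_simp
    _ ≤ _ := by gcongr

theorem norm_div_sub_sub_le {p : ℕ} (hp : 2 ≤ p) {δ : ℝ} (hδ : 0 ≤ δ) {θ : ℂ} (hθ : ‖θ‖ = 1) :
    ‖θ / (((p : ℝ) ^ (1 + δ) : ℝ) - θ) - θ / p‖ ≤ δ * Real.log p / p + 2 / (p : ℝ) ^ 2 := by
  set P : ℝ := (p : ℝ) ^ (1 + δ) with hP
  have hp2 : (2 : ℝ) ≤ p := by exact_mod_cast hp
  have hpP : (p : ℝ) ≤ P := natCast_le_rpow_one_add (by omega) hδ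
  have hP0 : (P : ℂ) ≠ 0 := by exact_mod_cast (by linarith : P ≠ 0)
  have hp0 : (p : ℂ) ≠ 0 := by exact_mod_cast (by omega : p ≠ 0)
  have hPn : ‖(P : ℂ)‖ = P := by rw [Complex.norm_real, Real.norm_of_nonneg (by linarith)]
  have hlow : P / 2 ≤ ‖(P : ℂ) - θ‖ := by
    have := norm_sub_norm_le (P : ℂ) θ
    rw [hPn, hθ] at this
    linarith
  have hne : (P : ℂ) - θ ≠ 0 := norm_pos_iff.1 (by linarith)
  have e : θ / (P - θ) - θ / p = θ ^ 2 / (P * (P - θ)) - θ * ((1 / (p : ℝ) - 1 / P : ℝ) : ℂ) := by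
    push_cast
    field_simp
    ring
  have h1 : ‖θ ^ 2 / (P * (P - θ))‖ ≤ 2 / (p : ℝ) ^ 2 := by
    rw [norm_div, norm_pow, hθ, norm_mul, hPn, one_pow]
    calc 1 / (P * ‖(P : ℂ) - θ‖) ≤ 1 / (p * (p / 2)) := by
          gcongr
          linarith
      _ = _ := by field_simp
  have h2 : ‖θ * ((1 / (p : ℝ) - 1 / P : ℝ) : ℂ)‖ ≤ δ * Real.log p / p := by
    have : 0 ≤ 1 / (p : ℝ) - 1 / P := sub_nonneg.2 (one_div_le_one_div_of_le (by linarith) hpP)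
    rw [norm_mul, hθ, one_mul, Complex.norm_real, Real.norm_of_nonneg this]
    exact inv_sub_inv_rpow_le (by omega)
  rw [e]
  refine (norm_sub_le _ _).trans ?_
  linarith

theorem exists_norm_sum_baseAngle_le {q : ℕ} [NeZero q] {χ : DirichletCharacter ℂ q} (hχ : χ ≠ 1) :
    ∃ A : ℝ, 0 ≤ A ∧ ∀ (y : ℕ) (δ : ℝ), 1 ≤ y → 0 ≤ δ → δ ≤ 1 → δ * Real.log y ^ 3 ≤ 1 →
      ‖∑ p ∈ Nat.primesLE y, Real.log p *
        (baseAngle χ p / (((p : ℝ) ^ (1 + δ) : ℝ) - baseAngle χ p))‖ ≤ A := by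
  obtain ⟨A, hA⟩ := exists_norm_sum_primes_mul_log_div_le hχ
  obtain ⟨C, hC0, hC⟩ := exists_sum_log_pow_div_sq_le 1
  have hA0 : 0 ≤ A := (norm_nonneg _).trans (hA 0)
  have hq0 : 0 ≤ ∑ p ∈ q.primeFactors, Real.log p :=
    Finset.sum_nonneg fun p _ ↦ Real.log_natCast_nonneg p
  refine ⟨A + (∑ p ∈ q.primeFactors, Real.log p) + (2 + 2 * C), by positivity,
    fun y δ hy hδ hδ1 hδy ↦ ?_⟩
  set F : ℕ → ℂ := fun p ↦ baseAngle χ p / (((p : ℝ) ^ (1 + δ) : ℝ) - baseAngle χ p) with hF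
  have hdec : ∑ p ∈ Nat.primesLE y, Real.log p * F p =
      ∑ p ∈ Nat.primesLE y, (starRingEnd ℂ) (χ p * Real.log p / p) +
      ∑ p ∈ Nat.primesLE y, (if p ∣ q then (Real.log p / p : ℂ) else 0) +
      ∑ p ∈ Nat.primesLE y, Real.log p * (F p - baseAngle χ p / p) := by
    rw [← Finset.sum_add_distrib, ← Finset.sum_add_distrib]
    refine Finset.sum_congr rfl fun p hp ↦ ?_
    have hpp := (Nat.mem_primesLE.1 hp).2
    have hb : baseAngle χ p = (starRingEnd ℂ) (χ p) + if p ∣ q then 1 else 0 := by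
      unfold baseAngle
      split_ifs with h
      · simp [dirichletCharacter_apply_of_dvd χ hpp h]
      · simp
    rw [hb]
    simp only [map_div₀, map_mul, Complex.conj_ofReal, map_natCast]
    split_ifs <;> ring
  have h1 : ‖∑ p ∈ Nat.primesLE y, (starRingEnd ℂ) (χ p * Real.log p / p)‖ ≤ A := by
    rw [← map_sum, RCLike.norm_conj]
    exact hA y
  have h2 : ‖∑ p ∈ Nat.primesLE y, (if p ∣ q then (Real.log p / p : ℂ) else 0)‖ ≤
      ∑ p ∈ q.primeFactors, Real.log p := by
    rw [← Finset.sum_filter]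
    refine (norm_sum_le _ _).trans ?_
    calc ∑ p ∈ (Nat.primesLE y).filter (· ∣ q), ‖(Real.log p / p : ℂ)‖
        ≤ ∑ p ∈ (Nat.primesLE y).filter (· ∣ q), Real.log p := by
          refine Finset.sum_le_sum fun p hp ↦ ?_
          have hpp := (Nat.mem_primesLE.1 (Finset.mem_filter.1 hp).1).2
          have h1 : (1 : ℝ) ≤ p := by exact_mod_cast hpp.one_lt.le
          rw [norm_div, Complex.norm_real, Complex.norm_natCast,
            Real.norm_of_nonneg (Real.log_natCast_nonneg p)]
          exact div_le_self (Real.log_natCast_nonneg p) h1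
      _ ≤ _ := by
          refine Finset.sum_le_sum_of_subset_of_nonneg (fun p hp ↦ ?_)
            fun p _ _ ↦ Real.log_natCast_nonneg p
          rw [Finset.mem_filter] at hp
          exact Nat.mem_primeFactors.2 ⟨(Nat.mem_primesLE.1 hp.1).2, hp.2, NeZero.ne q⟩
  have h3 : ‖∑ p ∈ Nat.primesLE y, Real.log p * (F p - baseAngle χ p / p)‖ ≤ 2 + 2 * C := by
    refine (norm_sum_le _ _).trans ?_
    calc _ ≤ ∑ p ∈ Nat.primesLE y, (δ * Real.log y ^ 2 * (1 / p) +
          2 * (Real.log p ^ 1 / (p : ℝ) ^ 2)) := by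
          refine Finset.sum_le_sum fun p hp ↦ ?_
          obtain ⟨hpy, hpp⟩ := Nat.mem_primesLE.1 hp
          have hl := Real.log_natCast_nonneg p
          have hll : Real.log p ≤ Real.log y := by
            have : (0 : ℝ) < p := by exact_mod_cast hpp.pos
            gcongr
          rw [norm_mul, Complex.norm_real, Real.norm_of_nonneg hl]
          calc _ ≤ Real.log p * (δ * Real.log p / p + 2 / (p : ℝ) ^ 2) := by
                gcongr; exact norm_div_sub_sub_le hpp.two_le hδ (norm_baseAngle χ hpp)
            _ = δ * Real.log p ^ 2 * (1 / p) + 2 * (Real.log p ^ 1 / (p : ℝ) ^ 2) := by ring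
            _ ≤ _ := by gcongr
      _ = δ * Real.log y ^ 2 * ∑ p ∈ Nat.primesLE y, (1 : ℝ) / p +
          2 * ∑ p ∈ Nat.primesLE y, Real.log p ^ 1 / (p : ℝ) ^ 2 := by
          rw [Finset.sum_add_distrib, Finset.mul_sum, Finset.mul_sum]
      _ ≤ δ * Real.log y ^ 2 * (1 + Real.log y) + 2 * C := by
          have := hC 1 (Nat.primesLE y) le_rfl fun p hp ↦ (Nat.mem_primesLE.1 hp).2.pos
          rw [Nat.cast_one, Real.one_rpow, mul_one] at this
          gcongr
          exact sum_primesLE_inv_le y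
      _ ≤ _ := by
          gcongr
          have hl := Real.log_natCast_nonneg y
          have e : δ * Real.log y ^ 2 * (1 + Real.log y) =
            δ * Real.log y ^ 2 + δ * Real.log y ^ 3 := by ring
          have : δ * Real.log y ^ 2 ≤ 1 := by
            rcases le_total (Real.log y) 1 with h | h
            · exact mul_le_one₀ hδ1 (by positivity) (pow_le_one₀ hl h)
            · exact le_trans (by gcongr; norm_num) hδy
          linarith
  rw [hdec]
  exact norm_add₃_le.trans (by linarith)

open Filter Topology in
theorem exists_sum_primes_mem_Icc {B : ℝ} (hB : 0 < B) (X : ℕ) :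
    ∃ Y : ℕ, X < Y ∧ ∑ p ∈ Nat.primesLE Y \ Nat.primesLE X,
      (Real.log p * (p / ((p : ℝ) ^ 2 - 1))) ∈ Set.Icc B (B + 1) := by
  classical
  set g : ℕ → ℝ := fun p ↦ if p.Prime then Real.log p * (p / ((p : ℝ) ^ 2 - 1)) else 0 with hg
  have hlow : ∀ p : ℕ, p.Prime → Real.log 2 * (1 / p) ≤ g p := by
    intro p hp
    have h2 : (2 : ℝ) ≤ p := by exact_mod_cast hp.two_le
    have hsq : (0 : ℝ) < (p : ℝ) ^ 2 - 1 := by nlinarith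
    rw [hg]
    simp only [if_pos hp]
    have : (1 : ℝ) / p ≤ p / ((p : ℝ) ^ 2 - 1) := by
      rw [div_le_div_iff₀ (by positivity) hsq]
      nlinarith
    have := Real.log_nonneg (by norm_num : (1 : ℝ) ≤ 2)
    gcongr
  have hup : ∀ p : ℕ, g p ≤ 1 := by
    intro p
    rw [hg]
    simp only
    split_ifs with hp
    · have h2 : (2 : ℝ) ≤ p := by exact_mod_cast hp.two_le
      have hsq : (0 : ℝ) < (p : ℝ) ^ 2 - 1 := by nlinarith
      rw [← mul_div_assoc, div_le_one hsq]
      have := Real.log_le_sub_one_of_pos (by linarith : (0 : ℝ) < p)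
      nlinarith
    · norm_num
  have hnn : ∀ p, 0 ≤ g p := by
    intro p
    by_cases hp : p.Prime
    · refine le_trans ?_ (hlow p hp)
      have := Real.log_nonneg (by norm_num : (1 : ℝ) ≤ 2)
      positivity
    · simp [hg, hp]
  have hns : ¬ Summable g := by
    intro h
    refine not_summable_one_div_on_primes ?_
    have h2 : 0 < Real.log 2 := Real.log_pos (by norm_num)
    refine Summable.of_nonneg_of_le (fun n ↦ Set.indicator_nonneg (fun _ _ ↦ by positivity) _)
      (fun n ↦ ?_) (h.mul_left (Real.log 2)⁻¹)
    by_cases hp : n.Prime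
    · rw [Set.indicator_of_mem (by exact hp), inv_mul_eq_div, le_div_iff₀ h2, mul_comm]
      exact hlow n hp
    · rw [Set.indicator_of_notMem (by exact hp)]
      exact mul_nonneg (by positivity) (hnn n)
  have htend := (not_summable_iff_tendsto_nat_atTop_of_nonneg hnn).1 hns
  have heq : ∀ Y, ∑ p ∈ Nat.primesLE Y \ Nat.primesLE X,
      (Real.log p * (p / ((p : ℝ) ^ 2 - 1))) = ∑ p ∈ Finset.Ico (X + 1) (Y + 1), g p := by
    intro Y
    rw [hg, ← Finset.sum_filter]
    refine Finset.sum_congr ?_ fun _ _ ↦ rfl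
    ext p
    simp only [Finset.mem_sdiff, Nat.mem_primesLE, Finset.mem_filter, Finset.mem_Ico]
    constructor
    · rintro ⟨⟨h1, h2⟩, h3⟩
      exact ⟨⟨by by_contra h; exact h3 ⟨by omega, h2⟩, by omega⟩, h2⟩
    · rintro ⟨⟨h1, h2⟩, h3⟩
      exact ⟨⟨by omega, h3⟩, fun h ↦ by omega⟩
  have hex : ∃ Y, B ≤ ∑ p ∈ Finset.Ico (X + 1) (Y + 1), g p := by
    obtain ⟨n, hn1, hn2⟩ := ((htend.eventually_ge_atTop
      (B + ∑ i ∈ Finset.range (X + 1), g i)).and (eventually_ge_atTop (X + 1))).exists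
    refine ⟨n, ?_⟩
    have := Finset.sum_range_add_sum_Ico g (show X + 1 ≤ n + 1 by omega)
    rw [Finset.sum_range_succ g n] at this
    linarith [hnn n]
  refine ⟨Nat.find hex, ?_, ?_⟩
  · by_contra! h
    have := Nat.find_spec hex
    rw [Finset.Ico_eq_empty (by omega), Finset.sum_empty] at this
    linarith
  · rw [heq]
    refine ⟨Nat.find_spec hex, ?_⟩
    have hXY : X < Nat.find hex := by
      by_contra! h
      have := Nat.find_spec hex
      rw [Finset.Ico_eq_empty (by omega), Finset.sum_empty] at this
      linarith
    have hmin := Nat.find_min hex (m := Nat.find hex - 1) (by omega)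
    rw [Nat.sub_add_cancel (by omega)] at hmin
    rw [Finset.sum_Ico_succ_top (by omega)]
    linarith [hup (Nat.find hex)]

theorem sum_piecewise₃ (U S₁ S₂ S₃ : Finset ℕ) (h₁ : S₁ ⊆ U) (h₂ : S₂ ⊆ U) (h₃ : S₃ ⊆ U)
    (h₁₂ : Disjoint S₁ S₂) (h₁₃ : Disjoint S₁ S₃) (h₂₃ : Disjoint S₂ S₃) (a a₁ a₂ a₃ : ℕ → ℂ)
    (F : ℕ → ℂ → ℂ) :
    ∑ p ∈ U, F p (if p ∈ S₁ then a₁ p else if p ∈ S₂ then a₂ p else if p ∈ S₃ then a₃ p else a p) =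
      (∑ p ∈ U, F p (a p) - ∑ p ∈ S₁, F p (a p) - ∑ p ∈ S₂, F p (a p) - ∑ p ∈ S₃, F p (a p)) +
      ∑ p ∈ S₁, F p (a₁ p) + ∑ p ∈ S₂, F p (a₂ p) + ∑ p ∈ S₃, F p (a₃ p) := by
  have e : ∀ (S : Finset ℕ) (f : ℕ → ℂ), S ⊆ U → ∑ p ∈ S, f p = ∑ p ∈ U, if p ∈ S then f p else 0 :=
    fun S f hS ↦ by rw [← Finset.sum_filter, Finset.filter_mem_eq_inter,
      Finset.inter_eq_right.2 hS]
  rw [e S₁ _ h₁, e S₂ _ h₂, e S₃ _ h₃, e S₁ _ h₁, e S₂ _ h₂, e S₃ _ h₃, ← Finset.sum_sub_distrib,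
    ← Finset.sum_sub_distrib, ← Finset.sum_sub_distrib, ← Finset.sum_add_distrib,
    ← Finset.sum_add_distrib, ← Finset.sum_add_distrib]
  refine Finset.sum_congr rfl fun p _ ↦ ?_
  by_cases m₁ : p ∈ S₁
  · have m₂ := Finset.disjoint_left.1 h₁₂ m₁
    have m₃ := Finset.disjoint_left.1 h₁₃ m₁
    simp [m₁, m₂, m₃]
  · by_cases m₂ : p ∈ S₂
    · have m₃ := Finset.disjoint_left.1 h₂₃ m₂
      simp [m₁, m₂, m₃]
    · by_cases m₃ : p ∈ S₃ <;> simp [m₁, m₂, m₃]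

open Filter Topology in
theorem eventually_sum_mem_Ioo {S : Finset ℕ} (hS : ∀ p ∈ S, 2 ≤ p) {B : ℝ}
    (h : ∑ p ∈ S, (Real.log p * (p / ((p : ℝ) ^ 2 - 1))) ∈ Set.Icc (B + 1) (B + 1 + 1)) :
    ∀ᶠ δ : ℝ in 𝓝 0, ∑ p ∈ S, (Real.log p * ((p : ℝ) ^ (1 + δ) / (((p : ℝ) ^ (1 + δ)) ^ 2 - 1))) ∈
      Set.Ioo B (B + 3) := by
  have hc : Tendsto (fun δ : ℝ ↦ ∑ p ∈ S,
      (Real.log p * ((p : ℝ) ^ (1 + δ) / (((p : ℝ) ^ (1 + δ)) ^ 2 - 1)))) (𝓝 0)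
      (𝓝 (∑ p ∈ S, (Real.log p * (p / ((p : ℝ) ^ 2 - 1))))) := by
    refine tendsto_finsetSum _ fun p hp ↦ ?_
    have hp2 : (2 : ℝ) ≤ p := by exact_mod_cast hS p hp
    have hP : Tendsto (fun δ : ℝ ↦ (p : ℝ) ^ (1 + δ)) (𝓝 0) (𝓝 p) := by
      have : ContinuousAt (fun δ : ℝ ↦ (p : ℝ) ^ (1 + δ)) 0 :=
        ContinuousAt.rpow continuousAt_const (by fun_prop) (Or.inl (by positivity))
      simpa [ContinuousAt] using this
    exact (hP.div ((hP.pow 2).sub_const 1) (by nlinarith)).const_mul _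
  exact hc (Ioo_mem_nhds (by linarith [h.1]) (by linarith [h.2]))

theorem norm_sum_discAut_le {S : Finset ℕ} {δ L : ℝ} (hδ : 0 ≤ δ) (hS : ∀ p ∈ S, 3 ≤ p)
    (hL : ∀ p ∈ S, Real.log p ≤ L) {φ : ℂ} (hφ : ‖φ‖ = 1) :
    ‖∑ p ∈ S, (Real.log p : ℂ) ^ 2 * (discAut ((p : ℝ) ^ (1 + δ)) φ * ((p : ℝ) ^ (1 + δ) : ℝ) /
        (((p : ℝ) ^ (1 + δ) : ℝ) - discAut ((p : ℝ) ^ (1 + δ)) φ) ^ 2)‖ ≤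
      2 * L * ∑ p ∈ S, (Real.log p * ((p : ℝ) ^ (1 + δ) / (((p : ℝ) ^ (1 + δ)) ^ 2 - 1))) := by
  rw [Finset.mul_sum]
  refine (norm_sum_le _ _).trans (Finset.sum_le_sum fun p hp ↦ ?_)
  have hl := Real.log_natCast_nonneg p
  have h3 : (3 : ℝ) ≤ p := by exact_mod_cast hS p hp
  have hP : (3 : ℝ) ≤ (p : ℝ) ^ (1 + δ) :=
    h3.trans (natCast_le_rpow_one_add (by have := hS p hp; omega) hδ)
  have hsq : (0 : ℝ) < ((p : ℝ) ^ (1 + δ)) ^ 2 - 1 := by nlinarith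
  rw [norm_mul, norm_pow, Complex.norm_real, Real.norm_of_nonneg hl]
  calc _ ≤ Real.log p ^ 2 * (2 * ((p : ℝ) ^ (1 + δ) / (((p : ℝ) ^ (1 + δ)) ^ 2 - 1))) := by
        gcongr
        exact norm_discAut_mul_div_sub_sq_le hP hφ
    _ = 2 * Real.log p *
        (Real.log p * ((p : ℝ) ^ (1 + δ) / (((p : ℝ) ^ (1 + δ)) ^ 2 - 1))) := by ring
    _ ≤ _ := by
        gcongr
        exact hL p hp

theorem le_norm_sum_discAut_sub {S : Finset ℕ} {δ L : ℝ} (hδ : 0 ≤ δ) (hS : ∀ p ∈ S, 3 ≤ p)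
    (hL : ∀ p ∈ S, L ≤ Real.log p) :
    2 * L * ∑ p ∈ S, (Real.log p * ((p : ℝ) ^ (1 + δ) / (((p : ℝ) ^ (1 + δ)) ^ 2 - 1))) ≤
    ‖∑ p ∈ S, (Real.log p : ℂ) ^ 2 * (discAut ((p : ℝ) ^ (1 + δ)) 1 * ((p : ℝ) ^ (1 + δ) : ℝ) /
        (((p : ℝ) ^ (1 + δ) : ℝ) - discAut ((p : ℝ) ^ (1 + δ)) 1) ^ 2) -
      ∑ p ∈ S, (Real.log p : ℂ) ^ 2 * (discAut ((p : ℝ) ^ (1 + δ)) (-1) * ((p : ℝ) ^ (1 + δ) : ℝ) /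
        (((p : ℝ) ^ (1 + δ) : ℝ) - discAut ((p : ℝ) ^ (1 + δ)) (-1)) ^ 2)‖ := by
  have hP : ∀ p ∈ S, (3 : ℝ) ≤ (p : ℝ) ^ (1 + δ) := fun p hp ↦ by
    have h3 : (3 : ℝ) ≤ p := by exact_mod_cast hS p hp
    exact h3.trans (natCast_le_rpow_one_add (by have := hS p hp; omega) hδ)
  choose! x hx1 hx2 using fun p (hp : p ∈ S) ↦
    le_discAut_sub_discAut (P := (p : ℝ) ^ (1 + δ)) (by linarith [hP p hp])
  have e : ∑ p ∈ S, (Real.log p : ℂ) ^ 2 * (discAut ((p : ℝ) ^ (1 + δ)) 1 *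
        ((p : ℝ) ^ (1 + δ) : ℝ) / (((p : ℝ) ^ (1 + δ) : ℝ) - discAut ((p : ℝ) ^ (1 + δ)) 1) ^ 2) -
      ∑ p ∈ S, (Real.log p : ℂ) ^ 2 * (discAut ((p : ℝ) ^ (1 + δ)) (-1) * ((p : ℝ) ^ (1 + δ) : ℝ) /
        (((p : ℝ) ^ (1 + δ) : ℝ) - discAut ((p : ℝ) ^ (1 + δ)) (-1)) ^ 2) =
      ((∑ p ∈ S, Real.log p ^ 2 * x p : ℝ) : ℂ) := by
    rw [← Finset.sum_sub_distrib]
    push_cast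
    refine Finset.sum_congr rfl fun p hp ↦ ?_
    rw [← hx2 p hp]
    ring
  rw [e, Complex.norm_real]
  refine le_trans ?_ (le_abs_self _)
  rw [Finset.mul_sum]
  refine Finset.sum_le_sum fun p hp ↦ ?_
  have hsq : (0 : ℝ) < ((p : ℝ) ^ (1 + δ)) ^ 2 - 1 := by nlinarith [hP p hp]
  have hl := Real.log_natCast_nonneg p
  have h0 : 0 ≤ (p : ℝ) ^ (1 + δ) / (((p : ℝ) ^ (1 + δ)) ^ 2 - 1) := by positivity
  calc _ ≤ 2 * Real.log p *
        (Real.log p * ((p : ℝ) ^ (1 + δ) / (((p : ℝ) ^ (1 + δ)) ^ 2 - 1))) := by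
        gcongr
        exact hL p hp
    _ = Real.log p ^ 2 * (2 * ((p : ℝ) ^ (1 + δ) / (((p : ℝ) ^ (1 + δ)) ^ 2 - 1))) := by ring
    _ ≤ _ := by
        gcongr
        exact hx1 p hp

theorem sum_discAut_div_sub {S : Finset ℕ} {δ : ℝ} (hδ : 0 ≤ δ) (hS : ∀ p ∈ S, 3 ≤ p) {φ : ℂ}
    (hφ : ‖φ‖ = 1) :
    ∑ p ∈ S, (Real.log p : ℂ) * (discAut ((p : ℝ) ^ (1 + δ)) φ /
        (((p : ℝ) ^ (1 + δ) : ℝ) - discAut ((p : ℝ) ^ (1 + δ)) φ)) =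
      ((∑ p ∈ S, Real.log p / (((p : ℝ) ^ (1 + δ)) ^ 2 - 1) : ℝ) : ℂ) +
      ((∑ p ∈ S, (Real.log p * ((p : ℝ) ^ (1 + δ) / (((p : ℝ) ^ (1 + δ)) ^ 2 - 1))) : ℝ) : ℂ) *
        φ := by
  push_cast
  rw [Finset.sum_mul, ← Finset.sum_add_distrib]
  refine Finset.sum_congr rfl fun p hp ↦ ?_
  have h3 : (3 : ℝ) ≤ p := by exact_mod_cast hS p hp
  have hP : (3 : ℝ) ≤ (p : ℝ) ^ (1 + δ) :=
    h3.trans (natCast_le_rpow_one_add (by have := hS p hp; omega) hδ)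
  rw [discAut_div_sub (by linarith) hφ]
  ring

open Filter Topology in
/-- Choice of target arguments for which the truncated Euler product model of `ζ'/ζ` vanishes
while its derivative does not. -/
theorem exists_angles {q : ℕ} [NeZero q] {χ : DirichletCharacter ℂ q} (hχ : χ ≠ 1) {η : ℝ}
    (hη : 0 < η) :
    ∃ S : Finset ℕ, (∀ p ∈ S, p.Prime) ∧ ∑ p ∈ S, (1 : ℝ) / p ≤ η ∧ ∃ δ₀ : ℝ, 0 < δ₀ ∧ ∃ y₀ : ℕ,
      ∀ (y : ℕ) (δ : ℝ), y₀ ≤ y → 0 < δ → δ ≤ δ₀ → δ * Real.log y ^ 3 ≤ 1 →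
      ∃ θ : ℕ → ℂ, (∀ p, p.Prime → ‖θ p‖ = 1) ∧ (∀ p, p ∉ S → θ p = baseAngle χ p) ∧
        ∑ p ∈ Nat.primesLE y, Real.log p * (θ p / (((p : ℝ) ^ (1 + δ) : ℝ) - θ p)) = 0 ∧
        1 ≤ ‖∑ p ∈ Nat.primesLE y, (Real.log p : ℂ) ^ 2 *
          (θ p * ((p : ℝ) ^ (1 + δ) : ℝ) / (((p : ℝ) ^ (1 + δ) : ℝ) - θ p) ^ 2)‖ := by
  classical
  obtain ⟨A, hA0, hA⟩ := exists_norm_sum_baseAngle_le hχ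
  obtain ⟨C, hC0, hC⟩ := exists_sum_log_pow_div_sq_le 1
  set B : ℝ := 7 * A + 6 * C + 3 with hB
  have hB3 : 3 ≤ B := by linarith
  obtain ⟨X, hX⟩ := exists_nat_ge (Real.exp (3 * (B + 2) / η) + 2)
  obtain ⟨Y₁, hXY₁, hg₁⟩ := exists_sum_primes_mem_Icc (by linarith : 0 < B + 1) X
  obtain ⟨Y₂, hY₁₂, hg₂⟩ := exists_sum_primes_mem_Icc (by linarith : 0 < B + 1) Y₁
  obtain ⟨X₃, hX₃⟩ := exists_nat_ge (Real.exp (8 * Real.log Y₂ + 1) + Y₂)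
  obtain ⟨Y₃, hXY₃, hg₃⟩ := exists_sum_primes_mem_Icc (by linarith : 0 < B + 1) X₃
  have hX2 : 2 ≤ X := by
    have := Real.exp_pos (3 * (B + 2) / η)
    exact_mod_cast (by linarith : (2 : ℝ) ≤ X)
  have hYX₃ : Y₂ ≤ X₃ := by
    have := Real.exp_pos (8 * Real.log Y₂ + 1)
    exact_mod_cast (by linarith : (Y₂ : ℝ) ≤ X₃)
  set S₁ := Nat.primesLE Y₁ \ Nat.primesLE X with hS₁
  set S₂ := Nat.primesLE Y₂ \ Nat.primesLE Y₁ with hS₂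
  set S₃ := Nat.primesLE Y₃ \ Nat.primesLE X₃ with hS₃
  have hmem : ∀ {a b p : ℕ}, p ∈ Nat.primesLE b \ Nat.primesLE a → p.Prime ∧ a < p ∧ p ≤ b := by
    intro a b p hp
    rw [Finset.mem_sdiff, Nat.mem_primesLE, Nat.mem_primesLE] at hp
    exact ⟨hp.1.2, by by_contra h; exact hp.2 ⟨by omega, hp.1.2⟩, hp.1.1⟩
  have hd₁₂ : Disjoint S₁ S₂ := Finset.disjoint_left.2 fun p h1 h2 ↦ by
    have := hmem h1; have := hmem h2; omega
  have hd₁₃ : Disjoint S₁ S₃ := Finset.disjoint_left.2 fun p h1 h2 ↦ by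
    have := hmem h1; have := hmem h2; omega
  have hd₂₃ : Disjoint S₂ S₃ := Finset.disjoint_left.2 fun p h1 h2 ↦ by
    have := hmem h1; have := hmem h2; omega
  have h3₁ : ∀ p ∈ S₁, 3 ≤ p := fun p h ↦ by have := hmem h; omega
  have h3₂ : ∀ p ∈ S₂, 3 ≤ p := fun p h ↦ by have := hmem h; omega
  have h3₃ : ∀ p ∈ S₃, 3 ≤ p := fun p h ↦ by have := hmem h; omega
  have hev := ((eventually_sum_mem_Ioo (fun p h ↦ (by have := h3₁ p h; omega)) hg₁).and
    ((eventually_sum_mem_Ioo (fun p h ↦ (by have := h3₂ p h; omega)) hg₂).and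
    (eventually_sum_mem_Ioo (fun p h ↦ (by have := h3₃ p h; omega)) hg₃))).and
    (eventually_le_nhds (one_pos : (0 : ℝ) < 1))
  obtain ⟨d, hd0, hd⟩ := Metric.eventually_nhds_iff.1 hev
  refine ⟨S₁ ∪ S₂ ∪ S₃, ?_, ?_, d / 2, by linarith, Y₃, fun y δ hy hδ hδd hδy ↦ ?_⟩
  · intro p hp
    simp only [Finset.mem_union] at hp
    rcases hp with (h | h) | h <;> exact (hmem h).1
  · have hsum : ∀ a b : ℕ, X ≤ a → ∑ p ∈ Nat.primesLE b \ Nat.primesLE a,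
        (Real.log p * (p / ((p : ℝ) ^ 2 - 1))) ∈ Set.Icc (B + 1) (B + 1 + 1) →
        ∑ p ∈ Nat.primesLE b \ Nat.primesLE a, (1 : ℝ) / p ≤ η / 3 := by
      intro a b hab hs
      have hpos : 0 < 3 * (B + 2) / η := by positivity
      calc _ ≤ ∑ p ∈ Nat.primesLE b \ Nat.primesLE a,
            (Real.log p * (p / ((p : ℝ) ^ 2 - 1))) * (3 * (B + 2) / η)⁻¹ := by
            refine Finset.sum_le_sum fun p hp ↦ ?_
            have hp' := hmem hp
            have hXp : (X : ℝ) ≤ p := by exact_mod_cast (by omega : X ≤ p)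
            have hp3 : (3 : ℝ) ≤ p := by exact_mod_cast (by omega : 3 ≤ p)
            have hlog : 3 * (B + 2) / η ≤ Real.log p := by
              rw [Real.le_log_iff_exp_le (by linarith)]
              linarith
            have h1 : (1 : ℝ) / p ≤ p / ((p : ℝ) ^ 2 - 1) := by
              rw [div_le_div_iff₀ (by positivity) (by nlinarith)]
              nlinarith
            rw [← div_eq_mul_inv, le_div_iff₀ hpos, mul_comm]
            gcongr
        _ ≤ (B + 2) * (3 * (B + 2) / η)⁻¹ := by
            rw [← Finset.sum_mul]
            gcongr
            linarith [hs.2]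
        _ = _ := by
            have : B + 2 ≠ 0 := by linarith
            field_simp
    rw [Finset.sum_union (Finset.disjoint_union_left.2 ⟨hd₁₃, hd₂₃⟩), Finset.sum_union hd₁₂]
    have e1 := hsum X Y₁ le_rfl hg₁
    have e2 := hsum Y₁ Y₂ hXY₁.le hg₂
    have e3 := hsum X₃ Y₃ (by omega) hg₃
    rw [← hS₁] at e1
    rw [← hS₂] at e2
    rw [← hS₃] at e3
    linarith
  · obtain ⟨⟨hR₁, hR₂, hR₃⟩, hδ1⟩ := hd (show dist δ 0 < d by
      rw [Real.dist_eq, sub_zero, abs_of_pos hδ]; linarith)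
    set R₁ := ∑ p ∈ S₁, (Real.log p * ((p : ℝ) ^ (1 + δ) / (((p : ℝ) ^ (1 + δ)) ^ 2 - 1))) with hR₁e
    set R₂ := ∑ p ∈ S₂, (Real.log p * ((p : ℝ) ^ (1 + δ) / (((p : ℝ) ^ (1 + δ)) ^ 2 - 1))) with hR₂e
    set R₃ := ∑ p ∈ S₃, (Real.log p * ((p : ℝ) ^ (1 + δ) / (((p : ℝ) ^ (1 + δ)) ^ 2 - 1))) with hR₃e
    set U := Nat.primesLE y with hU
    let g : ℕ → ℂ → ℂ := fun p θ ↦ (Real.log p : ℂ) * (θ / (((p : ℝ) ^ (1 + δ) : ℝ) - θ))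
    let h : ℕ → ℂ → ℂ := fun p θ ↦ (Real.log p : ℂ) ^ 2 *
      (θ * ((p : ℝ) ^ (1 + δ) : ℝ) / (((p : ℝ) ^ (1 + δ) : ℝ) - θ) ^ 2)
    have hsub : ∀ a b : ℕ, b ≤ Y₃ → Nat.primesLE b \ Nat.primesLE a ⊆ U := fun a b hb ↦
      Finset.sdiff_subset.trans (Nat.primesLE_mono (hb.trans hy))
    have hsub₁ : S₁ ⊆ U := hsub _ _ (by omega)
    have hsub₂ : S₂ ⊆ U := hsub _ _ (by omega)
    have hsub₃ : S₃ ⊆ U := hsub _ _ le_rfl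
    have hAb : ∀ b : ℕ, 1 ≤ b → b ≤ Y₃ → ‖∑ p ∈ Nat.primesLE b, g p (baseAngle χ p)‖ ≤ A := by
      intro b hb hbY
      refine hA b δ hb hδ.le hδ1 (le_trans ?_ hδy)
      have : (1 : ℝ) ≤ b := by exact_mod_cast hb
      have hby : (b : ℝ) ≤ y := by exact_mod_cast hbY.trans hy
      have := Real.log_nonneg this
      gcongr
    have hAi : ∀ a b : ℕ, 1 ≤ a → a ≤ b → b ≤ Y₃ →
        ‖∑ p ∈ Nat.primesLE b \ Nat.primesLE a, g p (baseAngle χ p)‖ ≤ 2 * A := by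
      intro a b ha hab hb
      have e := Finset.sum_sdiff (f := fun p ↦ g p (baseAngle χ p)) (Nat.primesLE_mono hab)
      rw [← eq_sub_iff_add_eq] at e
      rw [e]
      refine (norm_sub_le _ _).trans ?_
      linarith [hAb a ha (by omega), hAb b (by omega) hb]
    have hcS : ∀ S : Finset ℕ, (∀ p ∈ S, 3 ≤ p) →
        ‖((∑ p ∈ S, Real.log p / (((p : ℝ) ^ (1 + δ)) ^ 2 - 1) : ℝ) : ℂ)‖ ≤ 2 * C := by
      intro S hS
      have h0 : ∀ p ∈ S, 0 ≤ Real.log p / (((p : ℝ) ^ (1 + δ)) ^ 2 - 1) ∧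
          Real.log p / (((p : ℝ) ^ (1 + δ)) ^ 2 - 1) ≤ 2 * (Real.log p ^ 1 / (p : ℝ) ^ 2) := by
        intro p hp
        have hp3 : (3 : ℝ) ≤ p := by exact_mod_cast hS p hp
        have hP := natCast_le_rpow_one_add (p := p) (by have := hS p hp; omega) hδ.le
        have hl := Real.log_natCast_nonneg p
        have hlow : (p : ℝ) ^ 2 / 2 ≤ ((p : ℝ) ^ (1 + δ)) ^ 2 - 1 := by nlinarith
        have hpos : (0 : ℝ) < (p : ℝ) ^ 2 / 2 := by positivity
        refine ⟨div_nonneg hl (hpos.le.trans hlow), ?_⟩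
        calc _ ≤ Real.log p / ((p : ℝ) ^ 2 / 2) := by gcongr
          _ = _ := by field_simp
      rw [Complex.norm_real, Real.norm_of_nonneg (Finset.sum_nonneg fun p hp ↦ (h0 p hp).1)]
      refine (Finset.sum_le_sum fun p hp ↦ (h0 p hp).2).trans ?_
      rw [← Finset.mul_sum]
      have := hC 1 S le_rfl fun p hp ↦ by have := hS p hp; omega
      rw [Nat.cast_one, Real.one_rpow, mul_one] at this
      linarith
    set c₁ : ℂ := ((∑ p ∈ S₁, Real.log p / (((p : ℝ) ^ (1 + δ)) ^ 2 - 1) : ℝ) : ℂ) with hc₁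
    set c₂ : ℂ := ((∑ p ∈ S₂, Real.log p / (((p : ℝ) ^ (1 + δ)) ^ 2 - 1) : ℝ) : ℂ) with hc₂
    set c₃ : ℂ := ((∑ p ∈ S₃, Real.log p / (((p : ℝ) ^ (1 + δ)) ^ 2 - 1) : ℝ) : ℂ) with hc₃
    set M : ℂ := ∑ p ∈ U, g p (baseAngle χ p) - ∑ p ∈ S₁, g p (baseAngle χ p) -
      ∑ p ∈ S₂, g p (baseAngle χ p) - ∑ p ∈ S₃, g p (baseAngle χ p) with hM
    have hw : ‖-(M + c₁ + c₂ + c₃)‖ ≤ 7 * A + 6 * C := by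
      have hy1 : (1 : ℕ) ≤ y := by omega
      have m0 : ‖∑ p ∈ U, g p (baseAngle χ p)‖ ≤ A := hA y δ hy1 hδ.le hδ1 hδy
      have m1 : ‖∑ p ∈ S₁, g p (baseAngle χ p)‖ ≤ 2 * A := hAi _ _ (by omega) hXY₁.le (by omega)
      have m2 : ‖∑ p ∈ S₂, g p (baseAngle χ p)‖ ≤ 2 * A := hAi _ _ (by omega) hY₁₂.le (by omega)
      have m3 : ‖∑ p ∈ S₃, g p (baseAngle χ p)‖ ≤ 2 * A := hAi _ _ (by omega) hXY₃.le le_rfl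
      have n1 := hcS S₁ h3₁
      have n2 := hcS S₂ h3₂
      have n3 := hcS S₃ h3₃
      rw [norm_neg, hM]
      refine (norm_add_le _ _).trans ?_
      have k1 := norm_add_le (∑ p ∈ U, g p (baseAngle χ p) - ∑ p ∈ S₁, g p (baseAngle χ p) -
        ∑ p ∈ S₂, g p (baseAngle χ p) - ∑ p ∈ S₃, g p (baseAngle χ p) + c₁) c₂
      have k2 := norm_add_le (∑ p ∈ U, g p (baseAngle χ p) - ∑ p ∈ S₁, g p (baseAngle χ p) -
        ∑ p ∈ S₂, g p (baseAngle χ p) - ∑ p ∈ S₃, g p (baseAngle χ p)) c₁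
      have k3 := norm_sub_le (∑ p ∈ U, g p (baseAngle χ p) - ∑ p ∈ S₁, g p (baseAngle χ p) -
        ∑ p ∈ S₂, g p (baseAngle χ p)) (∑ p ∈ S₃, g p (baseAngle χ p))
      have k4 := norm_sub_le (∑ p ∈ U, g p (baseAngle χ p) - ∑ p ∈ S₁, g p (baseAngle χ p))
        (∑ p ∈ S₂, g p (baseAngle χ p))
      have k5 := norm_sub_le (∑ p ∈ U, g p (baseAngle χ p)) (∑ p ∈ S₁, g p (baseAngle χ p))
      linarith
    have hsol : ∀ σ : ℝ, |σ| = 1 → ∃ φ₁ φ₂ : ℂ, ‖φ₁‖ = 1 ∧ ‖φ₂‖ = 1 ∧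
        R₁ * φ₁ + R₂ * φ₂ = -(M + c₁ + c₂ + c₃) - R₃ * σ := by
      intro σ hσ
      have hn : ‖(R₃ : ℂ) * σ‖ = R₃ := by
        rw [norm_mul, Complex.norm_real, Complex.norm_real, Real.norm_eq_abs, Real.norm_eq_abs, hσ,
          mul_one, abs_of_pos (by linarith [hR₃.1])]
      refine exists_add_eq_of_abs_sub_le (by linarith [hR₁.1]) (by linarith [hR₂.1]) ?_ ?_
      · have := norm_sub_norm_le ((R₃ : ℂ) * σ) (-(M + c₁ + c₂ + c₃))
        rw [norm_sub_rev, hn] at this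
        rw [abs_le]
        constructor <;> linarith [hR₁.1, hR₁.2, hR₂.1, hR₂.2, hR₃.1]
      · have := norm_sub_le (-(M + c₁ + c₂ + c₃)) ((R₃ : ℂ) * σ)
        rw [hn] at this
        linarith [hR₁.1, hR₂.1, hR₃.2]
    obtain ⟨φ₁, φ₂, hφ₁, hφ₂, hφ⟩ := hsol 1 (by simp)
    obtain ⟨ψ₁, ψ₂, hψ₁, hψ₂, hψ⟩ := hsol (-1) (by simp)
    let ang : ℂ → ℂ → ℂ → ℕ → ℂ := fun a b c p ↦
      if p ∈ S₁ then discAut ((p : ℝ) ^ (1 + δ)) a else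
      if p ∈ S₂ then discAut ((p : ℝ) ^ (1 + δ)) b else
      if p ∈ S₃ then discAut ((p : ℝ) ^ (1 + δ)) c else baseAngle χ p
    have hang : ∀ a b c : ℂ, ‖a‖ = 1 → ‖b‖ = 1 → ‖c‖ = 1 →
        R₁ * a + R₂ * b = -(M + c₁ + c₂ + c₃) - R₃ * c →
        (∀ p, p.Prime → ‖ang a b c p‖ = 1) ∧
        (∀ p, p ∉ S₁ ∪ S₂ ∪ S₃ → ang a b c p = baseAngle χ p) ∧
        ∑ p ∈ U, g p (ang a b c p) = 0 := by
      intro a b c ha hb hc habc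
      refine ⟨fun p hp ↦ ?_, fun p hp ↦ ?_, ?_⟩
      · have hP : (1 : ℝ) < (p : ℝ) ^ (1 + δ) := by
          refine lt_of_lt_of_le ?_ (natCast_le_rpow_one_add hp.one_lt.le hδ.le)
          exact_mod_cast hp.one_lt
        simp only [ang]
        split_ifs
        · exact norm_discAut hP ha
        · exact norm_discAut hP hb
        · exact norm_discAut hP hc
        · exact norm_baseAngle χ hp
      · simp only [Finset.mem_union, not_or] at hp
        simp only [ang, if_neg hp.1.1, if_neg hp.1.2, if_neg hp.2]
      · have e := sum_piecewise₃ U S₁ S₂ S₃ hsub₁ hsub₂ hsub₃ hd₁₂ hd₁₃ hd₂₃ (baseAngle χ)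
          (fun p ↦ discAut ((p : ℝ) ^ (1 + δ)) a) (fun p ↦ discAut ((p : ℝ) ^ (1 + δ)) b)
          (fun p ↦ discAut ((p : ℝ) ^ (1 + δ)) c) g
        rw [← hM] at e
        simp only [ang]
        rw [e]
        simp only [g]
        rw [sum_discAut_div_sub hδ.le h3₁ ha, sum_discAut_div_sub hδ.le h3₂ hb,
          sum_discAut_div_sub hδ.le h3₃ hc]
        linear_combination habc
    have hA1 := hang φ₁ φ₂ 1 hφ₁ hφ₂ (by simp) (by simpa using hφ)
    have hA2 := hang ψ₁ ψ₂ (-1) hψ₁ hψ₂ (by simp) (by simpa using hψ)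
    have hdiff : 2 ≤ ‖∑ p ∈ U, h p (ang φ₁ φ₂ 1 p) - ∑ p ∈ U, h p (ang ψ₁ ψ₂ (-1) p)‖ := by
      have e := fun a b c : ℂ ↦ sum_piecewise₃ U S₁ S₂ S₃ hsub₁ hsub₂ hsub₃ hd₁₂ hd₁₃ hd₂₃
          (baseAngle χ) (fun p ↦ discAut ((p : ℝ) ^ (1 + δ)) a)
          (fun p ↦ discAut ((p : ℝ) ^ (1 + δ)) b) (fun p ↦ discAut ((p : ℝ) ^ (1 + δ)) c) h
      simp only [ang]
      rw [e, e]
      have hlog₂ : ∀ S, S ⊆ Nat.primesLE Y₂ → ∀ p ∈ S, Real.log p ≤ Real.log Y₂ := by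
        intro S hS p hp
        obtain ⟨h1, h2⟩ := Nat.mem_primesLE.1 (hS hp)
        have : (0 : ℝ) < p := by exact_mod_cast h2.pos
        gcongr
      have hl₁ := hlog₂ S₁ (Finset.sdiff_subset.trans (Nat.primesLE_mono hY₁₂.le))
      have hl₂ := hlog₂ S₂ Finset.sdiff_subset
      have hl₃ : ∀ p ∈ S₃, 8 * Real.log Y₂ + 1 ≤ Real.log p := by
        intro p hp
        obtain ⟨h1, h2, -⟩ := hmem hp
        have h2' : (X₃ : ℝ) ≤ p := by exact_mod_cast h2.le
        rw [Real.le_log_iff_exp_le (by exact_mod_cast h1.pos)]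
        have : (0 : ℝ) ≤ Y₂ := Nat.cast_nonneg _
        linarith
      have b1 := norm_sum_discAut_le hδ.le h3₁ hl₁ hφ₁
      have b2 := norm_sum_discAut_le hδ.le h3₁ hl₁ hψ₁
      have b3 := norm_sum_discAut_le hδ.le h3₂ hl₂ hφ₂
      have b4 := norm_sum_discAut_le hδ.le h3₂ hl₂ hψ₂
      have b5 := le_norm_sum_discAut_sub hδ.le h3₃ hl₃
      rw [← hR₁e] at b1 b2
      rw [← hR₂e] at b3 b4
      rw [← hR₃e] at b5
      simp only [h]
      generalize (∑ p ∈ U, _ - _ - _ - _ : ℂ) = m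
      have key : ∀ x1 x2 x3 y1 y2 y3 : ℂ, ‖x3 - y3‖ - ‖x1‖ - ‖y1‖ - ‖x2‖ - ‖y2‖ ≤
          ‖m + x1 + x2 + x3 - (m + y1 + y2 + y3)‖ := by
        intro x1 x2 x3 y1 y2 y3
        have e1 : x3 - y3 = (m + x1 + x2 + x3 - (m + y1 + y2 + y3)) - x1 + y1 - x2 + y2 := by ring
        have k1 := norm_add_le ((m + x1 + x2 + x3 - (m + y1 + y2 + y3)) - x1 + y1 - x2) y2
        have k2 := norm_sub_le ((m + x1 + x2 + x3 - (m + y1 + y2 + y3)) - x1 + y1) x2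
        have k3 := norm_add_le ((m + x1 + x2 + x3 - (m + y1 + y2 + y3)) - x1) y1
        have k4 := norm_sub_le (m + x1 + x2 + x3 - (m + y1 + y2 + y3)) x1
        rw [← e1] at k1
        linarith
      refine le_trans ?_ (key _ _ _ _ _ _)
      have hY₂0 : 0 ≤ Real.log Y₂ := Real.log_natCast_nonneg _
      have c1 : Real.log Y₂ * (R₁ + R₂) ≤ Real.log Y₂ * (4 * R₃) := by
        gcongr
        linarith [hR₁.2, hR₂.2, hR₃.1]
      have c2 : 2 * (8 * Real.log Y₂ + 1) * R₃ = 16 * (Real.log Y₂ * R₃) + 2 * R₃ := by ring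
      linarith [hR₃.1]
    have hor : 1 ≤ ‖∑ p ∈ U, h p (ang φ₁ φ₂ 1 p)‖ ∨ 1 ≤ ‖∑ p ∈ U, h p (ang ψ₁ ψ₂ (-1) p)‖ := by
      by_contra! hcon
      have := norm_sub_le (∑ p ∈ U, h p (ang φ₁ φ₂ 1 p)) (∑ p ∈ U, h p (ang ψ₁ ψ₂ (-1) p))
      linarith [hcon.1, hcon.2]
    rcases hor with h1 | h1
    · exact ⟨_, hA1.1, hA1.2.1, hA1.2.2, h1⟩
    · exact ⟨_, hA2.1, hA2.2.1, hA2.2.2, h1⟩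

theorem inv_rpow_one_add_le_sub {κ : ℝ} (hκ : 0 < κ) (n : ℕ) (hn : 1 ≤ n) :
    1 / ((n + 1 : ℕ) : ℝ) ^ (1 + κ) ≤ ((n : ℝ) ^ (-κ) - ((n + 1 : ℕ) : ℝ) ^ (-κ)) / κ := by
  have hn0 : (0 : ℝ) < n := by exact_mod_cast hn
  have hm0 : (0 : ℝ) < ((n + 1 : ℕ) : ℝ) := by positivity
  have hx0 : 0 < (n : ℝ) / ((n + 1 : ℕ) : ℝ) := by positivity
  have hx : 1 + κ * (1 - (n : ℝ) / ((n + 1 : ℕ) : ℝ)) ≤ ((n : ℝ) / ((n + 1 : ℕ) : ℝ)) ^ (-κ) := by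
    rw [Real.rpow_def_of_pos hx0]
    have h1 := Real.log_le_sub_one_of_pos hx0
    have h2 := Real.add_one_le_exp (Real.log ((n : ℝ) / ((n + 1 : ℕ) : ℝ)) * -κ)
    nlinarith
  have h3 : 1 - (n : ℝ) / ((n + 1 : ℕ) : ℝ) = 1 / ((n + 1 : ℕ) : ℝ) := by
    push_cast; field_simp; ring
  rw [h3, Real.div_rpow hn0.le hm0.le] at hx
  set m : ℝ := ((n + 1 : ℕ) : ℝ)
  have hmk : 0 < m ^ (-κ) := Real.rpow_pos_of_pos hm0 _
  rw [le_div_iff₀ hmk] at hx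
  rw [le_div_iff₀ hκ, Real.rpow_add hm0, Real.rpow_one]
  have h4 : m ^ κ * m ^ (-κ) = 1 := by rw [← Real.rpow_add hm0]; simp
  have h5 : 1 / (m * m ^ κ) = 1 / m * m ^ (-κ) := by
    rw [Real.rpow_neg hm0.le]; field_simp
  rw [h5]
  linarith

theorem sum_range_inv_rpow_one_add_le {κ : ℝ} (hκ : 0 < κ) (N : ℕ) :
    ∑ n ∈ Finset.range N, 1 / (n : ℝ) ^ (1 + κ) ≤ 1 + 1 / κ := by
  have key : ∀ N : ℕ, ∑ n ∈ Finset.range (N + 2), 1 / (n : ℝ) ^ (1 + κ) ≤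
      1 + (1 - ((N + 1 : ℕ) : ℝ) ^ (-κ)) / κ := by
    intro N
    induction N with
    | zero => simp [Finset.sum_range_succ, Real.zero_rpow (by positivity : 1 + κ ≠ 0)]
    | succ N ih =>
      rw [Finset.sum_range_succ]
      have := inv_rpow_one_add_le_sub hκ (N + 1) (by omega)
      have h2 : ((((N + 1 : ℕ) : ℝ) ^ (-κ) - ((N + 1 + 1 : ℕ) : ℝ) ^ (-κ)) / κ) =
        (1 - ((N + 1 + 1 : ℕ) : ℝ) ^ (-κ)) / κ - (1 - ((N + 1 : ℕ) : ℝ) ^ (-κ)) / κ := by ring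
      linarith
  refine (Finset.sum_le_sum_of_subset_of_nonneg
    (Finset.range_mono (by omega : N ≤ N + 2)) fun _ _ _ ↦ by positivity).trans ((key N).trans ?_)
  have : 0 ≤ ((N + 1 : ℕ) : ℝ) ^ (-κ) := by positivity
  gcongr
  linarith

theorem exists_tsum_log_pow_div_le (k : ℕ) :
    ∃ C : ℝ, 0 < C ∧ ∀ δ : ℝ, 0 < δ → δ ≤ 1 →
      Summable (fun n : ℕ ↦ Real.log n ^ k / (n : ℝ) ^ (1 + δ)) ∧
      ∑' n : ℕ, Real.log n ^ k / (n : ℝ) ^ (1 + δ) ≤ C / δ ^ (k + 1) := by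
  refine ⟨(2 * (k + 1)) ^ k * 3, by positivity, fun δ hδ hδ1 ↦ ?_⟩
  have hterm : ∀ n : ℕ, Real.log n ^ k / (n : ℝ) ^ (1 + δ) ≤
      (2 * (k + 1) / δ) ^ k * (1 / (n : ℝ) ^ (1 + δ / 2)) := by
    intro n
    rcases Nat.eq_zero_or_pos n with rfl | hn
    · simp [Real.zero_rpow (by positivity : 1 + δ ≠ 0), Real.zero_rpow (by positivity : 1 + δ / 2 ≠ 0)]
    have hn1 : (1 : ℝ) ≤ n := by exact_mod_cast hn
    have hn0 : (0 : ℝ) < n := by linarith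
    set κ : ℝ := δ / (2 * (k + 1)) with hκ
    have hκ0 : 0 < κ := by positivity
    have h1 : Real.log n ^ k ≤ ((n : ℝ) ^ κ / κ) ^ k :=
      pow_le_pow_left₀ (Real.log_nonneg hn1) (Real.log_le_rpow_div hn0.le hκ0) _
    have h2 : ((n : ℝ) ^ κ) ^ k ≤ (n : ℝ) ^ (δ / 2) := by
      rw [← Real.rpow_natCast, ← Real.rpow_mul hn0.le]
      apply Real.rpow_le_rpow_of_exponent_le hn1
      rw [hκ, div_mul_eq_mul_div, div_le_div_iff₀ (by positivity) (by positivity)]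
      nlinarith
    have h3 : (n : ℝ) ^ (1 + δ) = (n : ℝ) ^ (1 + δ / 2) * (n : ℝ) ^ (δ / 2) := by
      rw [← Real.rpow_add hn0]; congr 1; ring
    have h4 : 0 < (n : ℝ) ^ (1 + δ / 2) := by positivity
    have h5 : 0 < (n : ℝ) ^ (δ / 2) := by positivity
    have h6 : 2 * (k + 1) / δ = 1 / κ := by rw [hκ]; field_simp
    rw [h6, h3, div_le_iff₀ (by positivity)]
    calc _ ≤ _ := h1
      _ = (1 / κ) ^ k * ((n : ℝ) ^ κ) ^ k := by rw [← mul_pow]; congr 1; ring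
      _ ≤ (1 / κ) ^ k * (n : ℝ) ^ (δ / 2) := by gcongr
      _ = _ := by field_simp
  have hnn : ∀ n : ℕ, 0 ≤ Real.log n ^ k / (n : ℝ) ^ (1 + δ) := fun n ↦
    div_nonneg (pow_nonneg (Real.log_natCast_nonneg n) _) (by positivity)
  have hs : ∀ N : ℕ, ∑ n ∈ Finset.range N, Real.log n ^ k / (n : ℝ) ^ (1 + δ) ≤
      (2 * (k + 1)) ^ k * 3 / δ ^ (k + 1) := by
    intro N
    refine (Finset.sum_le_sum fun n _ ↦ hterm n).trans ?_
    rw [← Finset.mul_sum]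
    refine (mul_le_mul_of_nonneg_left (sum_range_inv_rpow_one_add_le (half_pos hδ) N)
      (by positivity)).trans ?_
    have : 1 + 1 / (δ / 2) ≤ 3 / δ := by
      rw [show 1 / (δ / 2) = 2 / δ by field_simp, le_div_iff₀ hδ]; field_simp; linarith
    refine (mul_le_mul_of_nonneg_left this (by positivity)).trans (le_of_eq ?_)
    rw [div_pow, pow_succ]; field_simp
  exact ⟨summable_of_sum_range_le hnn hs, Real.tsum_le_of_sum_range_le hnn hs⟩

theorem exists_tsum_tail_log_pow_div_le (k : ℕ) :
    ∃ C : ℝ, 0 < C ∧ ∀ (δ : ℝ) (Z : ℕ), 0 < δ → δ ≤ 1 → 1 ≤ Z →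
      ∑' n : ℕ, Real.log (n + Z : ℕ) ^ k / ((n + Z : ℕ) : ℝ) ^ (1 + δ) ≤
        C * (Z : ℝ) ^ (-(δ / 2)) / δ ^ (k + 1) := by
  obtain ⟨C, hC, h⟩ := exists_tsum_log_pow_div_le k
  refine ⟨C * 2 ^ (k + 1), by positivity, fun δ Z hδ hδ1 hZ ↦ ?_⟩
  obtain ⟨hs1, -⟩ := h δ hδ hδ1
  obtain ⟨hs, hle⟩ := h (δ / 2) (half_pos hδ) (by linarith)
  have hZ0 : (0 : ℝ) < Z := by exact_mod_cast hZ
  have hnn : ∀ n : ℕ, 0 ≤ Real.log n ^ k / (n : ℝ) ^ (1 + δ / 2) := fun n ↦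
    div_nonneg (pow_nonneg (Real.log_natCast_nonneg n) _) (by positivity)
  calc ∑' n : ℕ, Real.log (n + Z : ℕ) ^ k / ((n + Z : ℕ) : ℝ) ^ (1 + δ)
      ≤ ∑' n : ℕ, (Z : ℝ) ^ (-(δ / 2)) *
        (Real.log (n + Z : ℕ) ^ k / ((n + Z : ℕ) : ℝ) ^ (1 + δ / 2)) := by
        refine Summable.tsum_le_tsum (fun n ↦ ?_)
          ((summable_nat_add_iff (f := fun n : ℕ ↦ Real.log n ^ k / (n : ℝ) ^ (1 + δ)) Z).2 hs1)
          (((summable_nat_add_iff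
            (f := fun n : ℕ ↦ Real.log n ^ k / (n : ℝ) ^ (1 + δ / 2)) Z).2 hs).mul_left _)
        have hm0 : (0 : ℝ) < ((n + Z : ℕ) : ℝ) := by exact_mod_cast (by omega : 0 < n + Z)
        have hmZ : (Z : ℝ) ≤ ((n + Z : ℕ) : ℝ) := by exact_mod_cast (by omega : Z ≤ n + Z)
        have e1 : ((n + Z : ℕ) : ℝ) ^ (1 + δ) =
            ((n + Z : ℕ) : ℝ) ^ (1 + δ / 2) * ((n + Z : ℕ) : ℝ) ^ (δ / 2) := by
          rw [← Real.rpow_add hm0]; congr 1; ring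
        have e2 : (Z : ℝ) ^ (δ / 2) ≤ ((n + Z : ℕ) : ℝ) ^ (δ / 2) :=
          Real.rpow_le_rpow hZ0.le hmZ (by linarith)
        have e3 : 0 ≤ Real.log (n + Z : ℕ) ^ k := pow_nonneg (Real.log_natCast_nonneg _) _
        have e4 : 0 < (Z : ℝ) ^ (δ / 2) := by positivity
        rw [e1, Real.rpow_neg hZ0.le, inv_mul_eq_div, div_div]
        gcongr
    _ = (Z : ℝ) ^ (-(δ / 2)) * ∑' n : ℕ,
        (Real.log (n + Z : ℕ) ^ k / ((n + Z : ℕ) : ℝ) ^ (1 + δ / 2)) := tsum_mul_left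
    _ ≤ (Z : ℝ) ^ (-(δ / 2)) * (C / (δ / 2) ^ (k + 1)) := by
        gcongr
        refine le_trans ?_ hle
        have := hs.sum_add_tsum_nat_add Z
        have h0 := Finset.sum_nonneg fun n (_ : n ∈ Finset.range Z) ↦ hnn n
        linarith
    _ = _ := by rw [div_pow]; field_simp

theorem sum_primesLE_div_mul_le {y k : ℕ} {d : ℕ → ℝ} (hd : ∀ p, 0 ≤ d p) {E : ℝ}
    (hE : 0 ≤ E) (h : ∑ p ∈ Nat.primesLE y, (1 : ℝ) / p * d p ^ 2 ≤ E ^ 2) :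
    ∑ p ∈ Nat.primesLE y, Real.log p ^ k / p * d p ≤ (1 + Real.log y) ^ (k + 1) * E := by
  have hl : 0 ≤ Real.log y := Real.log_natCast_nonneg y
  have h1 : ∑ p ∈ Nat.primesLE y, (1 : ℝ) / p * d p ≤ (1 + Real.log y) * E := by
    have hcs : (∑ p ∈ Nat.primesLE y, (1 : ℝ) / p * d p) ^ 2 ≤
        (∑ p ∈ Nat.primesLE y, (1 : ℝ) / p) * ∑ p ∈ Nat.primesLE y, (1 : ℝ) / p * d p ^ 2 :=
      Finset.sum_sq_le_sum_mul_sum_of_sq_le_mul _ (fun _ _ ↦ by positivity)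
        (fun p _ ↦ by have := hd p; positivity) (fun p _ ↦ le_of_eq (by ring))
    refine abs_le_of_sq_le_sq' (hcs.trans ?_) (by positivity) |>.2
    calc _ ≤ (1 + Real.log y) * E ^ 2 :=
          mul_le_mul (sum_primesLE_inv_le y) h
            (Finset.sum_nonneg fun p _ ↦ by have := hd p; positivity) (by positivity)
      _ ≤ (1 + Real.log y) * (1 + Real.log y) * E ^ 2 := by
          have : 0 ≤ (1 + Real.log y) * E ^ 2 * Real.log y := by positivity
          linarith
      _ = _ := by ring
  calc _ ≤ ∑ p ∈ Nat.primesLE y, (1 + Real.log y) ^ k * ((1 : ℝ) / p * d p) := by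
        refine Finset.sum_le_sum fun p hp ↦ ?_
        rw [Nat.mem_primesLE] at hp
        have hp1 : (1 : ℝ) ≤ p := by exact_mod_cast hp.2.one_lt.le
        have : Real.log p ≤ 1 + Real.log y := by
          have := Real.log_le_log (by linarith) (by exact_mod_cast hp.1 : (p : ℝ) ≤ y)
          linarith
        have h0 := Real.log_nonneg hp1
        rw [div_mul_eq_mul_div, one_div_mul_eq_div, ← mul_div_assoc]
        have := hd p
        gcongr
    _ = (1 + Real.log y) ^ k * ∑ p ∈ Nat.primesLE y, (1 : ℝ) / p * d p := by
        rw [Finset.mul_sum]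
    _ ≤ (1 + Real.log y) ^ k * ((1 + Real.log y) * E) := by gcongr
    _ = _ := by ring

/-- If the local factors of a sum over primes are close to model values for `p ≤ y`, nearly linear
for larger `p`, and the linear parts over `y < p ≤ Z` nearly cancel, then the whole sum is
close to its truncated model. -/
theorem exists_norm_tsum_primes_sub_sum_le (k : ℕ) {c : ℝ} (hc : 0 ≤ c) :
    ∃ C : ℝ, 0 < C ∧ ∀ (Φ : ℕ → ℂ → ℂ) (a θ : ℕ → ℂ) (t δ E : ℝ) (y Z : ℕ),
      0 < δ → δ ≤ 1 → 0 ≤ E → 1 ≤ y → y ≤ Z →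
      (∀ p ∈ Nat.primesLE y, ‖Φ p (osc p t) - Φ p (θ p)‖ ≤
        c * (Real.log p ^ k / p) * ‖1 - (starRingEnd ℂ) (θ p) * osc p t‖) →
      (∀ p, p.Prime → ‖Φ p (osc p t) - a p / ((p : ℝ) ^ (1 + δ) : ℝ) * osc p t‖ ≤
        c * (Real.log p ^ k / (p : ℝ) ^ 2)) →
      (∀ p, p.Prime → ‖a p‖ ≤ Real.log p ^ k) →
      ∑ p ∈ Nat.primesLE y, (1 : ℝ) / p * ‖1 - (starRingEnd ℂ) (θ p) * osc p t‖ ^ 2 ≤ E ^ 2 →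
      ‖∑ p ∈ Nat.primesLE Z \ Nat.primesLE y, a p / ((p : ℝ) ^ (1 + δ) : ℝ) * osc p t‖ ≤ E →
      Summable (fun p : Nat.Primes ↦ Φ p (osc p t)) ∧
      ‖∑' p : Nat.Primes, Φ p (osc p t) - ∑ p ∈ Nat.primesLE y, Φ p (θ p)‖ ≤
        C * ((1 + Real.log y) ^ (k + 1) * E + (y : ℝ) ^ (-(1 / 4) : ℝ) +
          (Z : ℝ) ^ (-(δ / 2)) / δ ^ (k + 1)) := by
  obtain ⟨C₁, hC₁, h₁⟩ := exists_sum_log_pow_div_sq_le k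
  obtain ⟨C₂, hC₂, h₂⟩ := exists_tsum_tail_log_pow_div_le k
  obtain ⟨C₃, hC₃, h₃⟩ := exists_tsum_log_pow_div_le k
  refine ⟨(c + 1) + c * C₁ + (1 + c) * C₂, by positivity, ?_⟩
  intro Φ a θ t δ E y Z hδ hδ1 hE hy hyZ hLip hlin ha hE1 hE2
  have hZ1 : 1 ≤ Z := hy.trans hyZ
  set h : ℕ → ℂ := fun n ↦ if n.Prime then Φ n (osc n t) else 0 with hh
  have hlog : ∀ n : ℕ, 0 ≤ Real.log n ^ k := fun n ↦ pow_nonneg (Real.log_natCast_nonneg n) k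
  have hbd : ∀ n, ‖h n‖ ≤ (1 + c) * (Real.log n ^ k / (n : ℝ) ^ (1 + δ)) := by
    intro n
    by_cases hn : n.Prime
    · simp only [hh, hn, if_true]
      have hn1 : (1 : ℝ) ≤ n := by exact_mod_cast hn.one_lt.le
      have hP : (0 : ℝ) < (n : ℝ) ^ (1 + δ) := by positivity
      have e1 : ‖a n / ((n : ℝ) ^ (1 + δ) : ℝ) * osc n t‖ ≤ Real.log n ^ k / (n : ℝ) ^ (1 + δ) := by
        rw [norm_mul, norm_osc, mul_one, norm_div, Complex.norm_real, Real.norm_of_nonneg hP.le]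
        gcongr
        exact ha n hn
      have e2 : Real.log n ^ k / (n : ℝ) ^ 2 ≤ Real.log n ^ k / (n : ℝ) ^ (1 + δ) := by
        refine div_le_div_of_nonneg_left (hlog n) hP ?_
        rw [← Real.rpow_natCast]
        exact Real.rpow_le_rpow_of_exponent_le hn1 (by push_cast; linarith)
      have e3 := norm_le_norm_add_norm_sub' (Φ n (osc n t))
        (a n / ((n : ℝ) ^ (1 + δ) : ℝ) * osc n t)
      have e4 := hlin n hn
      nlinarith [mul_le_mul_of_nonneg_left e2 hc]
    · simp only [hh, hn, if_false, norm_zero]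
      have := hlog n
      positivity
  have hsb : Summable fun n : ℕ ↦ (1 + c) * (Real.log n ^ k / (n : ℝ) ^ (1 + δ)) :=
    (h₃ δ hδ hδ1).1.mul_left _
  have hsn : Summable fun n ↦ ‖h n‖ := Summable.of_nonneg_of_le (fun _ ↦ norm_nonneg _) hbd hsb
  have hs : Summable h := hsn.of_norm
  have hind : h = Set.indicator {n : ℕ | n.Prime} fun n ↦ Φ n (osc n t) := by
    ext n; simp [hh, Set.indicator_apply]
  have hsum : Summable (fun p : Nat.Primes ↦ Φ p (osc p t)) := by
    rw [hind] at hs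
    exact summable_subtype_iff_indicator.2 hs
  have htsum : ∑' p : Nat.Primes, Φ p (osc p t) = ∑' n, h n := by
    rw [hind]
    exact tsum_subtype {n : ℕ | n.Prime} fun n ↦ Φ n (osc n t)
  refine ⟨hsum, ?_⟩
  have hfin : ∑ n ∈ Finset.range (Z + 1), h n = ∑ p ∈ Nat.primesLE Z, Φ p (osc p t) := by
    rw [hh, ← Finset.sum_filter]
    refine Finset.sum_congr ?_ fun _ _ ↦ rfl
    ext p
    simp [Nat.mem_primesLE]
  have hsub : Nat.primesLE y ⊆ Nat.primesLE Z := fun p hp ↦ by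
    rw [Nat.mem_primesLE] at hp ⊢
    exact ⟨hp.1.trans hyZ, hp.2⟩
  have hsplit : ∑' p : Nat.Primes, Φ p (osc p t) - ∑ p ∈ Nat.primesLE y, Φ p (θ p) =
      ∑ p ∈ Nat.primesLE y, (Φ p (osc p t) - Φ p (θ p)) +
      (∑ p ∈ Nat.primesLE Z \ Nat.primesLE y,
        (Φ p (osc p t) - a p / ((p : ℝ) ^ (1 + δ) : ℝ) * osc p t) +
      ∑ p ∈ Nat.primesLE Z \ Nat.primesLE y, a p / ((p : ℝ) ^ (1 + δ) : ℝ) * osc p t) +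
      ∑' n, h (n + (Z + 1)) := by
    rw [htsum, ← hs.sum_add_tsum_nat_add (Z + 1), hfin, ← Finset.sum_sdiff hsub,
      Finset.sum_sub_distrib, Finset.sum_sub_distrib]
    ring
  have b1 : ‖∑ p ∈ Nat.primesLE y, (Φ p (osc p t) - Φ p (θ p))‖ ≤
      c * ((1 + Real.log y) ^ (k + 1) * E) := by
    refine (norm_sum_le_of_le _ hLip).trans ?_
    have := sum_primesLE_div_mul_le (k := k) (y := y)
      (fun p ↦ norm_nonneg (1 - (starRingEnd ℂ) (θ p) * osc p t)) hE hE1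
    simp_rw [mul_assoc, ← Finset.mul_sum]
    gcongr
  have b2 : ‖∑ p ∈ Nat.primesLE Z \ Nat.primesLE y,
        (Φ p (osc p t) - a p / ((p : ℝ) ^ (1 + δ) : ℝ) * osc p t)‖ ≤
      c * (C₁ * (y : ℝ) ^ (-(1 / 4) : ℝ)) := by
    refine (norm_sum_le_of_le _ fun p hp ↦ hlin p ?_).trans ?_
    · exact (Nat.mem_primesLE.1 (Finset.mem_sdiff.1 hp).1).2
    rw [← Finset.mul_sum]
    refine mul_le_mul_of_nonneg_left (h₁ y _ hy fun n hn ↦ ?_) hc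
    rw [Finset.mem_sdiff, Nat.mem_primesLE, Nat.mem_primesLE] at hn
    by_contra hlt
    exact hn.2 ⟨by omega, hn.1.2⟩
  have b3 : ‖∑' n, h (n + (Z + 1))‖ ≤ (1 + c) * (C₂ * ((Z : ℝ) ^ (-(δ / 2)) / δ ^ (k + 1))) := by
    have e0 : Summable fun n ↦ ‖h (n + (Z + 1))‖ :=
      (summable_nat_add_iff (f := fun n ↦ ‖h n‖) (Z + 1)).2 hsn
    refine (norm_tsum_le_tsum_norm e0).trans ?_
    have e1 := e0.tsum_le_tsum (fun n ↦ hbd (n + (Z + 1)))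
      ((summable_nat_add_iff (f := fun n : ℕ ↦ (1 + c) * (Real.log n ^ k / (n : ℝ) ^ (1 + δ)))
        (Z + 1)).2 hsb)
    rw [tsum_mul_left] at e1
    refine e1.trans (mul_le_mul_of_nonneg_left ((h₂ δ (Z + 1) hδ hδ1 (by omega)).trans ?_)
      (by positivity))
    rw [mul_div_assoc]
    have hZ0 : (0 : ℝ) < Z := by exact_mod_cast hZ1
    have : ((Z + 1 : ℕ) : ℝ) ^ (-(δ / 2)) ≤ (Z : ℝ) ^ (-(δ / 2)) :=
      Real.rpow_le_rpow_of_nonpos hZ0 (by push_cast; linarith) (by linarith)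
    gcongr
  rw [hsplit]
  have hl : 0 ≤ Real.log y := Real.log_natCast_nonneg y
  have hE' : E ≤ (1 + Real.log y) ^ (k + 1) * E :=
    le_mul_of_one_le_left hE (one_le_pow₀ (by linarith))
  set X₁ := (1 + Real.log y) ^ (k + 1) * E
  have hy4 : (0 : ℝ) ≤ (y : ℝ) ^ (-(1 / 4) : ℝ) := by positivity
  have hz4 : (0 : ℝ) ≤ (Z : ℝ) ^ (-(δ / 2)) / δ ^ (k + 1) := by positivity
  set X₂ := (y : ℝ) ^ (-(1 / 4) : ℝ)
  set X₃ := (Z : ℝ) ^ (-(δ / 2)) / δ ^ (k + 1)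
  have hX₁ : 0 ≤ X₁ := hE.trans hE'
  refine (norm_add₃_le.trans (add_le_add_three b1
    ((norm_add_le _ _).trans (add_le_add b2 (hE2.trans hE'))) b3)).trans ?_
  have : 0 ≤ c * X₂ + c * X₃ + X₂ + X₃ + c * C₁ * (X₁ + X₃) + (1 + c) * C₂ * (X₁ + X₂) := by
    positivity
  linarith

theorem half_le_norm_ofReal_sub {P : ℝ} (hP : 2 ≤ P) {a : ℂ} (ha : ‖a‖ = 1) :
    P / 2 ≤ ‖(P : ℂ) - a‖ := by
  have := norm_sub_norm_le (P : ℂ) a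
  rw [Complex.norm_real, Real.norm_of_nonneg (by linarith), ha] at this
  linarith

theorem ofReal_sub_ne_zero_of_norm_eq_one {P : ℝ} (hP : 2 ≤ P) {a : ℂ} (ha : ‖a‖ = 1) :
    (P : ℂ) - a ≠ 0 :=
  norm_pos_iff.1 (lt_of_lt_of_le (by linarith) (half_le_norm_ofReal_sub hP ha))

theorem norm_div_sub_sub_div_sub_le {P : ℝ} (hP : 2 ≤ P) {a b : ℂ} (ha : ‖a‖ = 1) (hb : ‖b‖ = 1) :
    ‖a / (P - a) - b / (P - b)‖ ≤ 4 / P * ‖a - b‖ := by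
  have h1 := half_le_norm_ofReal_sub hP ha
  have h2 := half_le_norm_ofReal_sub hP hb
  have e : a / (P - a) - b / (P - b) = P * (a - b) / ((P - a) * (P - b)) := by
    have := ofReal_sub_ne_zero_of_norm_eq_one hP ha
    have := ofReal_sub_ne_zero_of_norm_eq_one hP hb
    field_simp
    ring
  have hP0 : 0 < P := by linarith
  rw [e, norm_div, norm_mul, norm_mul, Complex.norm_real, Real.norm_of_nonneg hP0.le]
  calc _ ≤ P * ‖a - b‖ / (P / 2 * (P / 2)) := by gcongr
    _ = _ := by field_simp; ring

theorem norm_div_sub_sub_div_le {P : ℝ} (hP : 2 ≤ P) {a : ℂ} (ha : ‖a‖ = 1) :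
    ‖a / (P - a) - a / P‖ ≤ 2 / P ^ 2 := by
  have h1 := half_le_norm_ofReal_sub hP ha
  have hP0 : 0 < P := by linarith
  have e : a / (P - a) - a / P = a ^ 2 / (P * (P - a)) := by
    have := ofReal_sub_ne_zero_of_norm_eq_one hP ha
    have : (P : ℂ) ≠ 0 := by exact_mod_cast hP0.ne'
    field_simp
    ring
  rw [e, norm_div, norm_mul, norm_pow, ha, Complex.norm_real, Real.norm_of_nonneg hP0.le]
  calc _ ≤ 1 ^ 2 / (P * (P / 2)) := by gcongr
    _ = _ := by field_simp; 

theorem norm_mul_div_sub_sq_sub_le {P : ℝ} (hP : 2 ≤ P) {a b : ℂ} (ha : ‖a‖ = 1) (hb : ‖b‖ = 1) :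
    ‖a * P / (P - a) ^ 2 - b * P / (P - b) ^ 2‖ ≤ 32 / P * ‖a - b‖ := by
  have h1 := half_le_norm_ofReal_sub hP ha
  have h2 := half_le_norm_ofReal_sub hP hb
  have e : a * P / (P - a) ^ 2 - b * P / (P - b) ^ 2 =
      P * ((P : ℂ) ^ 2 - a * b) * (a - b) / ((P - a) ^ 2 * (P - b) ^ 2) := by
    have := ofReal_sub_ne_zero_of_norm_eq_one hP ha
    have := ofReal_sub_ne_zero_of_norm_eq_one hP hb
    field_simp
    ring
  have hP0 : 0 < P := by linarith
  have h3 : ‖(P : ℂ) ^ 2 - a * b‖ ≤ 2 * P ^ 2 := by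
    refine (norm_sub_le _ _).trans ?_
    rw [norm_pow, norm_mul, ha, hb, Complex.norm_real, Real.norm_of_nonneg hP0.le]
    nlinarith
  rw [e, norm_div, norm_mul, norm_mul, norm_mul, norm_pow, norm_pow, Complex.norm_real,
    Real.norm_of_nonneg hP0.le]
  calc _ ≤ P * (2 * P ^ 2) * ‖a - b‖ / ((P / 2) ^ 2 * (P / 2) ^ 2) := by gcongr
    _ = _ := by field_simp; ring

theorem norm_mul_div_sub_sq_sub_div_le {P : ℝ} (hP : 2 ≤ P) {a : ℂ} (ha : ‖a‖ = 1) :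
    ‖a * P / (P - a) ^ 2 - a / P‖ ≤ 12 / P ^ 2 := by
  have h1 := half_le_norm_ofReal_sub hP ha
  have hP0 : 0 < P := by linarith
  have e : a * P / (P - a) ^ 2 - a / P = a ^ 2 * (2 * P - a) / (P * (P - a) ^ 2) := by
    have := ofReal_sub_ne_zero_of_norm_eq_one hP ha
    have : (P : ℂ) ≠ 0 := by exact_mod_cast hP0.ne'
    field_simp
    ring
  have h3 : ‖(2 * P - a : ℂ)‖ ≤ 3 * P := by
    refine (norm_sub_le _ _).trans ?_
    rw [norm_mul, ha, Complex.norm_real, Real.norm_of_nonneg hP0.le, RCLike.norm_ofNat]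
    linarith
  rw [e, norm_div, norm_mul, norm_mul, norm_pow, norm_pow, ha, Complex.norm_real,
    Real.norm_of_nonneg hP0.le]
  calc _ ≤ 1 ^ 2 * (3 * P) / (P * (P / 2) ^ 2) := by gcongr
    _ = _ := by field_simp; ring

theorem norm_log_one_sub_sub_log_one_sub_le {z w : ℂ} (hz : ‖z‖ ≤ 1 / 2) (hw : ‖w‖ ≤ 1 / 2) :
    ‖Complex.log (1 - z) - Complex.log (1 - w)‖ ≤ 2 * ‖z - w‖ := by
  have hre : ∀ x ∈ Metric.closedBall (0 : ℂ) (1 / 2), 1 - x ∈ Complex.slitPlane := by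
    intro x hx
    rw [mem_closedBall_zero_iff] at hx
    have := Complex.re_le_norm x
    exact Or.inl (by simp; linarith)
  refine Convex.norm_image_sub_le_of_norm_hasDerivWithin_le
    (f := fun x ↦ Complex.log (1 - x)) (f' := fun x ↦ -1 / (1 - x))
    (s := Metric.closedBall (0 : ℂ) (1 / 2)) (fun x hx ↦ ?_) (fun x hx ↦ ?_)
    (convex_closedBall _ _) (by simpa using hw) (by simpa using hz)
  · exact (((hasDerivAt_id x).const_sub 1).clog (hre x hx)).hasDerivWithinAt
  · rw [mem_closedBall_zero_iff] at hx
    have h1 := norm_sub_norm_le (1 : ℂ) x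
    rw [norm_one] at h1
    rw [norm_div, norm_neg, norm_one, div_le_iff₀ (by linarith)]
    linarith

theorem norm_neg_log_one_sub_sub_le {z : ℂ} (hz : ‖z‖ ≤ 1 / 2) :
    ‖-Complex.log (1 - z) - z‖ ≤ ‖z‖ ^ 2 := by
  have h := Complex.norm_log_one_add_sub_self_le (z := -z) (by rw [norm_neg]; linarith)
  rw [norm_neg] at h
  have e : -Complex.log (1 - z) - z = -(Complex.log (1 + -z) - -z) := by
    rw [← sub_eq_add_neg]; ring
  rw [e, norm_neg]
  refine h.trans ?_
  have : (1 - ‖z‖)⁻¹ ≤ 2 := by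
    rw [inv_le_comm₀ (by linarith) (by norm_num)]; linarith
  nlinarith [sq_nonneg ‖z‖]

theorem norm_one_sub_conj_mul {a b : ℂ} (hb : ‖b‖ = 1) :
    ‖1 - (starRingEnd ℂ) b * a‖ = ‖a - b‖ := by
  have h : (starRingEnd ℂ) b * b = 1 := by
    rw [mul_comm, Complex.mul_conj, Complex.normSq_eq_norm_sq, hb]; simp
  rw [← h, ← mul_sub, norm_mul, RCLike.norm_conj, hb, one_mul, norm_sub_rev]

/-- The von Mangoldt function with complex values. -/
noncomputable abbrev complexVonMangoldt (n : ℕ) : ℂ := (ArithmeticFunction.vonMangoldt n : ℂ)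

theorem abscissaOfAbsConv_complexVonMangoldt_lt {s : ℂ} (hs : 1 < s.re) :
    LSeries.abscissaOfAbsConv complexVonMangoldt < s.re := by
  have h := (ArithmeticFunction.LSeriesSummable_vonMangoldt
    (s := (((1 + s.re) / 2 : ℝ) : ℂ)) (by rw [Complex.ofReal_re]; linarith)).abscissaOfAbsConv_le
  refine lt_of_le_of_lt h ?_
  rw [Complex.ofReal_re]
  exact_mod_cast (by linarith : (1 + s.re) / 2 < s.re)

theorem abscissaOfAbsConv_logMul_complexVonMangoldt_lt {s : ℂ} (hs : 1 < s.re) :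
    LSeries.abscissaOfAbsConv (LSeries.logMul complexVonMangoldt) < s.re := by
  rw [LSeries.abscissaOfAbsConv_logMul]
  exact abscissaOfAbsConv_complexVonMangoldt_lt hs

theorem norm_logMul_logMul_complexVonMangoldt_le (n : ℕ) :
    ‖LSeries.logMul (LSeries.logMul complexVonMangoldt) n‖ ≤ Real.log n ^ 3 := by
  have h0 := Real.log_natCast_nonneg n
  have h1 : ArithmeticFunction.vonMangoldt n ≤ Real.log n := ArithmeticFunction.vonMangoldt_le_log
  have h2 : (0 : ℝ) ≤ ArithmeticFunction.vonMangoldt n := ArithmeticFunction.vonMangoldt_nonneg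
  simp only [LSeries.logMul, complexVonMangoldt, ← Complex.natCast_log, norm_mul, Complex.norm_real,
    Real.norm_of_nonneg h0, Real.norm_of_nonneg h2]
  calc _ ≤ Real.log n * (Real.log n * Real.log n) := by gcongr
    _ = _ := by ring

theorem exists_norm_LSeries_logMul_logMul_le :
    ∃ C : ℝ, 0 < C ∧ ∀ (δ : ℝ) (z : ℂ), 0 < δ → δ ≤ 1 → 1 + δ ≤ z.re →
      ‖LSeries (LSeries.logMul (LSeries.logMul complexVonMangoldt)) z‖ ≤ C / δ ^ 4 := by
  obtain ⟨C, hC, h⟩ := exists_tsum_log_pow_div_le 3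
  refine ⟨C, hC, fun δ z hδ hδ1 hz ↦ ?_⟩
  obtain ⟨hs, hle⟩ := h δ hδ hδ1
  refine (tsum_of_norm_bounded hs.hasSum fun n ↦ ?_).trans hle
  rw [LSeries.norm_term_eq]
  split_ifs with hn
  · simp [hn]
  · have hn1 : (1 : ℝ) ≤ n := by exact_mod_cast Nat.one_le_iff_ne_zero.2 hn
    have := norm_logMul_logMul_complexVonMangoldt_le n
    have h3 : (n : ℝ) ^ (1 + δ) ≤ (n : ℝ) ^ z.re := Real.rpow_le_rpow_of_exponent_le hn1 hz
    have h4 := pow_nonneg (Real.log_nonneg hn1) 3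
    gcongr

/-- A quantitative inverse function argument producing critical points of `ζ`. -/
theorem exists_deriv_riemannZeta_eq_zero_of_norm_lt :
    ∃ C : ℝ, 0 < C ∧ ∀ (w : ℂ) (δ r : ℝ), 0 < δ → δ ≤ 1 → w.re = 1 + δ → 0 < r → r ≤ δ / 2 →
      C * r ≤ δ ^ 4 → ‖LSeries complexVonMangoldt w‖ < r / 8 →
      1 / 2 ≤ ‖LSeries (LSeries.logMul complexVonMangoldt) w‖ →
      ∃ ρ : ℂ, ‖ρ - w‖ ≤ r ∧ deriv riemannZeta ρ = 0 := by
  obtain ⟨C, hC, h⟩ := exists_norm_LSeries_logMul_logMul_le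
  refine ⟨4 * (16 * C), by positivity, fun w δ r hδ hδ1 hw hr hrδ hCr h0 h1 ↦ ?_⟩
  set F := LSeries complexVonMangoldt
  set G := LSeries (LSeries.logMul complexVonMangoldt)
  have hre : ∀ z ∈ Metric.closedBall w r, 1 + δ / 2 ≤ z.re := by
    intro z hz
    rw [mem_closedBall_iff_norm] at hz
    have h2 := (abs_le.1 (Complex.abs_re_le_norm (z - w))).1
    rw [Complex.sub_re, hw] at h2
    linarith
  have hF : ∀ z ∈ Metric.closedBall w r, HasDerivAt F (-G z) z := fun z hz ↦
    LSeries_hasDerivAt (abscissaOfAbsConv_complexVonMangoldt_lt (by linarith [hre z hz]))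
  have hG : ∀ z ∈ Metric.closedBall w r,
      HasDerivAt G (-LSeries (LSeries.logMul (LSeries.logMul complexVonMangoldt)) z) z := fun z hz ↦
    LSeries_hasDerivAt (abscissaOfAbsConv_logMul_complexVonMangoldt_lt (by linarith [hre z hz]))
  have hw0 : w ∈ Metric.closedBall w r := Metric.mem_closedBall_self hr.le
  have hGd : ∀ z ∈ Metric.closedBall w r, ‖G z - G w‖ ≤ 1 / 4 := by
    intro z hz
    have h2 := Convex.norm_image_sub_le_of_norm_hasDerivWithin_le
      (fun x hx ↦ (hG x hx).hasDerivWithinAt)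
      (fun x hx ↦ by rw [norm_neg]; exact h (δ / 2) x (by linarith) (by linarith) (hre x hx))
      (convex_closedBall w r) hw0 hz
    rw [mem_closedBall_iff_norm] at hz
    refine h2.trans ((mul_le_mul_of_nonneg_left hz (by positivity)).trans ?_)
    rw [div_pow, div_div_eq_mul_div, div_mul_eq_mul_div, div_le_iff₀ (by positivity)]
    linarith
  have hFd : ∀ z ∈ Metric.closedBall w r, ‖F z - F w + G w * (z - w)‖ ≤ 1 / 4 * ‖z - w‖ := by
    intro z hz
    have h2 := Convex.norm_image_sub_le_of_norm_hasDerivWithin_le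
      (f := fun x ↦ F x + G w * (x - w)) (f' := fun x ↦ -G x + G w * 1)
      (fun x hx ↦ ((hF x hx).add (((hasDerivAt_id x).sub_const w).const_mul
        (G w))).hasDerivWithinAt)
      (fun x hx ↦ by rw [mul_one, neg_add_eq_sub, norm_sub_rev]; exact hGd x hx)
      (convex_closedBall w r) hw0 hz
    have e : F z - F w + G w * (z - w) = F z + G w * (z - w) - (F w + G w * (w - w)) := by ring
    rw [e]
    exact h2
  have hlow : ∀ z ∈ Metric.closedBall w r, 1 / 4 * ‖z - w‖ ≤ ‖F z - F w‖ := by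
    intro z hz
    have h2 := norm_sub_norm_le (G w * (z - w)) (F z - F w + G w * (z - w))
    have h3 : G w * (z - w) - (F z - F w + G w * (z - w)) = -(F z - F w) := by ring
    rw [h3, norm_neg, norm_mul] at h2
    have := hFd z hz
    nlinarith [norm_nonneg (z - w)]
  have hdiff : DiffContOnCl ℂ F (Metric.ball w r) := by
    refine DifferentiableOn.diffContOnCl fun z hz ↦ ?_
    rw [closure_ball w hr.ne'] at hz
    exact (hF z hz).differentiableAt.differentiableWithinAt
  have hfreq : ∃ᶠ z in nhds w, F z ≠ F w := by
    have : ∃ᶠ z in nhdsWithin w {w}ᶜ, z ∈ Metric.closedBall w r :=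
      Filter.Eventually.frequently
        (mem_nhdsWithin_of_mem_nhds (Metric.closedBall_mem_nhds w hr))
    refine ((this.and_eventually self_mem_nhdsWithin).filter_mono nhdsWithin_le_nhds).mono ?_
    rintro z ⟨hz, hzw⟩ heq
    have h2 := hlow z hz
    rw [heq, sub_self, norm_zero] at h2
    have h3 : 0 < ‖z - w‖ := norm_pos_iff.2 (sub_ne_zero.2 hzw)
    linarith
  have hsub := hdiff.ball_subset_image_closedBall hr (ε := r / 4) (fun z hz ↦ by
    have h2 := hlow z (Metric.sphere_subset_closedBall hz)
    rw [mem_sphere_iff_norm] at hz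
    rw [hz] at h2
    linarith) hfreq
  have h0mem : (0 : ℂ) ∈ Metric.ball (F w) (r / 4 / 2) := by
    rw [mem_ball_iff_norm, zero_sub, norm_neg]
    linarith
  obtain ⟨ρ, hρ, hρ0⟩ := hsub h0mem
  refine ⟨ρ, mem_closedBall_iff_norm.1 hρ, ?_⟩
  have hρ1 : 1 < ρ.re := by linarith [hre ρ hρ]
  have h2 : F ρ = -deriv riemannZeta ρ / riemannZeta ρ :=
    ArithmeticFunction.LSeries_vonMangoldt_eq_deriv_riemannZeta_div hρ1
  rw [hρ0, eq_comm, div_eq_zero_iff, neg_eq_zero] at h2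
  exact h2.resolve_right (riemannZeta_ne_zero_of_one_lt_re hρ1)

theorem natCast_cpow_mul_osc {n : ℕ} (hn : 1 ≤ n) (σ t : ℝ) :
    (n : ℂ) ^ ((σ : ℂ) + t * Complex.I) * osc n t = ((n : ℝ) ^ σ : ℝ) := by
  have hn0 : (n : ℂ) ≠ 0 := by exact_mod_cast (by omega : n ≠ 0)
  have hn1 : (0 : ℝ) < n := by exact_mod_cast hn
  rw [Complex.cpow_def_of_ne_zero hn0, osc, ← Complex.exp_add, Real.rpow_def_of_pos hn1,
    Complex.ofReal_exp, ← Complex.natCast_log]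
  congr 1
  push_cast
  ring

theorem inv_natCast_cpow {n : ℕ} (hn : 1 ≤ n) (σ t : ℝ) :
    ((n : ℂ) ^ ((σ : ℂ) + t * Complex.I))⁻¹ = osc n t / ((n : ℝ) ^ σ : ℝ) := by
  have hn0 : (n : ℂ) ≠ 0 := by exact_mod_cast (by omega : n ≠ 0)
  have hne : (n : ℂ) ^ ((σ : ℂ) + t * Complex.I) ≠ 0 := by simp [Complex.cpow_eq_zero_iff, hn0]
  have ho : osc n t ≠ 0 := norm_pos_iff.1 (by rw [norm_osc]; norm_num)
  rw [← natCast_cpow_mul_osc hn σ t]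
  field_simp

theorem inv_natCast_pow_cpow {n : ℕ} (hn : 1 ≤ n) (σ t : ℝ) (k : ℕ) :
    (((n ^ k : ℕ) : ℂ) ^ ((σ : ℂ) + t * Complex.I))⁻¹ = (osc n t / ((n : ℝ) ^ σ : ℝ)) ^ k := by
  rw [inv_natCast_cpow (Nat.one_le_pow _ _ hn), osc_pow (by omega), div_pow]
  congr 1
  rw [← Complex.ofReal_pow, Nat.cast_pow, ← Real.rpow_natCast, ← Real.rpow_natCast,
    ← Real.rpow_mul (by positivity), ← Real.rpow_mul (by positivity), mul_comm]

theorem norm_osc_div_rpow_lt_one {p : ℕ} (hp : p.Prime) {δ : ℝ} (hδ : 0 < δ) (t : ℝ) :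
    ‖osc p t / ((p : ℝ) ^ (1 + δ) : ℝ)‖ < 1 := by
  have h := natCast_le_rpow_one_add hp.one_lt.le hδ.le
  have h2 : (2 : ℝ) ≤ p := by exact_mod_cast hp.two_le
  rw [norm_div, norm_osc, Complex.norm_real, Real.norm_of_nonneg (by linarith),
    div_lt_one (by linarith)]
  linarith

theorem re_ofReal_add_ofReal_mul_I (σ t : ℝ) : ((σ : ℂ) + t * Complex.I).re = σ := by simp

theorem LSeries_complexVonMangoldt_eq_tsum {δ : ℝ} (hδ : 0 < δ) (t : ℝ) :
    LSeries complexVonMangoldt (((1 + δ : ℝ) : ℂ) + t * Complex.I) =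
      ∑' p : Nat.Primes, (Real.log p : ℂ) *
        (osc p t / ((((p : ℕ) : ℝ) ^ (1 + δ) : ℝ) - osc p t)) := by
  have hs : 1 < ((((1 + δ : ℝ) : ℂ) + t * Complex.I)).re := by
    rw [re_ofReal_add_ofReal_mul_I]; linarith
  rw [LSeries, tsum_eq_tsum_primes_of_support_subset_prime_powers
    (LSeriesSummable_of_abscissaOfAbsConv_lt_re (abscissaOfAbsConv_complexVonMangoldt_lt hs))]
  · refine tsum_congr fun p ↦ ?_
    have hp := p.2
    have hp1 : 1 ≤ (p : ℕ) := hp.one_lt.le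
    set v : ℂ := osc p t / (((p : ℕ) : ℝ) ^ (1 + δ) : ℝ) with hv
    have hv1 : ‖v‖ < 1 := norm_osc_div_rpow_lt_one hp hδ t
    have hP : ((((p : ℕ) : ℝ) ^ (1 + δ) : ℝ) : ℂ) ≠ 0 := by
      have : (0 : ℝ) < ((p : ℕ) : ℝ) ^ (1 + δ) :=
        Real.rpow_pos_of_pos (by exact_mod_cast hp.pos) _
      exact_mod_cast this.ne'
    have hterm : ∀ k : ℕ, LSeries.term complexVonMangoldt (((1 + δ : ℝ) : ℂ) + t * Complex.I)
        ((p : ℕ) ^ (k + 1)) = (Real.log p * v) * v ^ k := by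
      intro k
      rw [LSeries.term_of_ne_zero (pow_ne_zero _ hp.ne_zero), div_eq_mul_inv,
        inv_natCast_pow_cpow hp1, complexVonMangoldt,
        ArithmeticFunction.vonMangoldt_apply_pow (by omega),
        ArithmeticFunction.vonMangoldt_apply_prime hp]
      ring
    simp_rw [hterm]
    rw [tsum_mul_left, tsum_geometric_of_norm_lt_one hv1, mul_assoc, ← div_eq_mul_inv]
    congr 1
    rw [hv]
    field_simp
  · intro n hn
    rw [Function.mem_support, LSeries.term_def] at hn
    rw [Set.mem_ofPred_eq, ← ArithmeticFunction.vonMangoldt_ne_zero_iff]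
    intro h0
    simp [complexVonMangoldt, h0] at hn

theorem LSeries_logMul_complexVonMangoldt_eq_tsum {δ : ℝ} (hδ : 0 < δ) (t : ℝ) :
    LSeries (LSeries.logMul complexVonMangoldt) (((1 + δ : ℝ) : ℂ) + t * Complex.I) =
      ∑' p : Nat.Primes, (Real.log p : ℂ) ^ 2 *
        (osc p t * (((p : ℕ) : ℝ) ^ (1 + δ) : ℝ) /
          ((((p : ℕ) : ℝ) ^ (1 + δ) : ℝ) - osc p t) ^ 2) := by
  have hs : 1 < ((((1 + δ : ℝ) : ℂ) + t * Complex.I)).re := by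
    rw [re_ofReal_add_ofReal_mul_I]; linarith
  rw [LSeries, tsum_eq_tsum_primes_of_support_subset_prime_powers
    (LSeriesSummable_of_abscissaOfAbsConv_lt_re
      (abscissaOfAbsConv_logMul_complexVonMangoldt_lt hs))]
  · refine tsum_congr fun p ↦ ?_
    have hp := p.2
    have hp1 : 1 ≤ (p : ℕ) := hp.one_lt.le
    set v : ℂ := osc p t / (((p : ℕ) : ℝ) ^ (1 + δ) : ℝ) with hv
    have hv1 : ‖v‖ < 1 := norm_osc_div_rpow_lt_one hp hδ t
    have hP : ((((p : ℕ) : ℝ) ^ (1 + δ) : ℝ) : ℂ) ≠ 0 := by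
      have : (0 : ℝ) < ((p : ℕ) : ℝ) ^ (1 + δ) :=
        Real.rpow_pos_of_pos (by exact_mod_cast hp.pos) _
      exact_mod_cast this.ne'
    have hterm : ∀ k : ℕ, LSeries.term (LSeries.logMul complexVonMangoldt)
        (((1 + δ : ℝ) : ℂ) + t * Complex.I) ((p : ℕ) ^ (k + 1)) =
        (Real.log p) ^ 2 * (((k + 1 : ℕ) : ℂ) * v ^ (k + 1)) := by
      intro k
      rw [LSeries.term_of_ne_zero (pow_ne_zero _ hp.ne_zero), div_eq_mul_inv,
        inv_natCast_pow_cpow hp1, LSeries.logMul, complexVonMangoldt,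
        ArithmeticFunction.vonMangoldt_apply_pow (by omega),
        ArithmeticFunction.vonMangoldt_apply_prime hp, ← Complex.natCast_log, Nat.cast_pow,
        Real.log_pow]
      push_cast
      ring
    simp_rw [hterm]
    have hsum : Summable fun k : ℕ ↦ (k : ℂ) * v ^ k := by
      simpa using summable_pow_mul_geometric_of_norm_lt_one 1 hv1
    have hgeom := tsum_coe_mul_geometric_of_norm_lt_one hv1
    rw [hsum.tsum_eq_zero_add] at hgeom
    rw [tsum_mul_left]
    simp only [Nat.cast_zero, zero_mul, zero_add] at hgeom
    rw [hgeom, hv]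
    congr 1
    field_simp
  · intro n hn
    rw [Function.mem_support, LSeries.term_def] at hn
    rw [Set.mem_ofPred_eq, ← ArithmeticFunction.vonMangoldt_ne_zero_iff]
    intro h0
    simp [complexVonMangoldt, h0] at hn

theorem two_le_rpow_one_add {p : ℕ} (hp : p.Prime) {δ : ℝ} (hδ : 0 ≤ δ) :
    2 ≤ (p : ℝ) ^ (1 + δ) :=
  (by exact_mod_cast hp.two_le : (2 : ℝ) ≤ p).trans (natCast_le_rpow_one_add hp.one_lt.le hδ)

theorem div_rpow_one_add_le {p : ℕ} (hp : p.Prime) {δ : ℝ} (hδ : 0 ≤ δ) {c : ℝ} (hc : 0 ≤ c) :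
    c / (p : ℝ) ^ (1 + δ) ≤ c / p :=
  div_le_div_of_nonneg_left hc (by exact_mod_cast hp.pos) (natCast_le_rpow_one_add hp.one_lt.le hδ)

theorem div_rpow_one_add_sq_le {p : ℕ} (hp : p.Prime) {δ : ℝ} (hδ : 0 ≤ δ) {c : ℝ} (hc : 0 ≤ c) :
    c / ((p : ℝ) ^ (1 + δ)) ^ 2 ≤ c / (p : ℝ) ^ 2 := by
  have hp0 : (0 : ℝ) < p := by exact_mod_cast hp.pos
  exact div_le_div_of_nonneg_left hc (by positivity)
    (pow_le_pow_left₀ hp0.le (natCast_le_rpow_one_add hp.one_lt.le hδ) 2)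

theorem norm_mul_div_rpow_le {p : ℕ} (hp : p.Prime) {δ : ℝ} (hδ : 0 ≤ δ) {b a : ℂ}
    (hb : ‖b‖ ≤ 1) (ha : ‖a‖ = 1) :
    ‖b * a / ((p : ℝ) ^ (1 + δ) : ℝ)‖ ≤ 1 / (p : ℝ) ^ (1 + δ) := by
  have h2 := two_le_rpow_one_add hp hδ
  rw [norm_div, norm_mul, ha, mul_one, Complex.norm_real, Real.norm_of_nonneg (by linarith)]
  gcongr

theorem norm_mul_div_rpow_le_half {p : ℕ} (hp : p.Prime) {δ : ℝ} (hδ : 0 ≤ δ) {b a : ℂ}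
    (hb : ‖b‖ ≤ 1) (ha : ‖a‖ = 1) : ‖b * a / ((p : ℝ) ^ (1 + δ) : ℝ)‖ ≤ 1 / 2 :=
  (norm_mul_div_rpow_le hp hδ hb ha).trans
    (one_div_le_one_div_of_le two_pos (two_le_rpow_one_add hp hδ))

/-- The coefficients of the linear parts of `-ζ'/ζ`, of its derivative and of `log L(s, χ)`. -/
noncomputable def linearCoeff {q : ℕ} (χ : DirichletCharacter ℂ q) (j : Fin 3) (p : ℕ) : ℂ :=
  ![(Real.log p : ℂ), (Real.log p : ℂ) ^ 2, χ p] j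

/-- Comparison of `ζ'/ζ`, its derivative and `log L(s, χ)` with truncated models. -/
theorem exists_comparison {q : ℕ} (χ : DirichletCharacter ℂ q) :
    ∃ C : ℝ, 0 < C ∧ ∀ (θ : ℕ → ℂ) (t δ E : ℝ) (y Z : ℕ),
      0 < δ → δ ≤ 1 → 0 ≤ E → 1 ≤ y → y ≤ Z → (∀ p, p.Prime → ‖θ p‖ = 1) →
      ∑ p ∈ Nat.primesLE y, (1 : ℝ) / p * ‖1 - (starRingEnd ℂ) (θ p) * osc p t‖ ^ 2 ≤ E ^ 2 →
      (∀ j, ‖∑ p ∈ Nat.primesLE Z \ Nat.primesLE y,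
        linearCoeff χ j p / ((p : ℝ) ^ (1 + δ) : ℝ) * osc p t‖ ≤ E) →
      ∀ D : ℝ, D = (1 + Real.log y) ^ 3 * E + (y : ℝ) ^ (-(1 / 4) : ℝ) +
          (Z : ℝ) ^ (-(δ / 2)) / δ ^ 3 →
      ‖LSeries complexVonMangoldt (((1 + δ : ℝ) : ℂ) + t * Complex.I) -
        ∑ p ∈ Nat.primesLE y, Real.log p * (θ p / (((p : ℝ) ^ (1 + δ) : ℝ) - θ p))‖ ≤ C * D ∧
      ‖LSeries (LSeries.logMul complexVonMangoldt) (((1 + δ : ℝ) : ℂ) + t * Complex.I) -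
        ∑ p ∈ Nat.primesLE y, (Real.log p : ℂ) ^ 2 *
          (θ p * ((p : ℝ) ^ (1 + δ) : ℝ) / (((p : ℝ) ^ (1 + δ) : ℝ) - θ p) ^ 2)‖ ≤ C * D ∧
      Summable (fun p : Nat.Primes ↦
        -Complex.log (1 - χ p * osc p t / (((p : ℕ) : ℝ) ^ (1 + δ) : ℝ))) ∧
      ‖∑' p : Nat.Primes, -Complex.log (1 - χ p * osc p t / (((p : ℕ) : ℝ) ^ (1 + δ) : ℝ)) -
        ∑ p ∈ Nat.primesLE y, -Complex.log (1 - χ p * θ p / ((p : ℝ) ^ (1 + δ) : ℝ))‖ ≤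
        C * D := by
  obtain ⟨C₀, hC₀, h₀⟩ := exists_norm_tsum_primes_sub_sum_le 0 (c := 32) (by norm_num)
  obtain ⟨C₁, hC₁, h₁⟩ := exists_norm_tsum_primes_sub_sum_le 1 (c := 32) (by norm_num)
  obtain ⟨C₂, hC₂, h₂⟩ := exists_norm_tsum_primes_sub_sum_le 2 (c := 32) (by norm_num)
  refine ⟨C₀ + C₁ + C₂, by positivity, ?_⟩
  intro θ t δ E y Z hδ hδ1 hE hy hyZ hθ hE1 hE2 D hD
  have hl : 0 ≤ Real.log y := Real.log_natCast_nonneg y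
  have hmono : ∀ (c : ℝ) (k : ℕ), k ≤ 2 → 0 ≤ c → c ≤ C₀ + C₁ + C₂ →
      c * ((1 + Real.log y) ^ (k + 1) * E + (y : ℝ) ^ (-(1 / 4) : ℝ) +
        (Z : ℝ) ^ (-(δ / 2)) / δ ^ (k + 1)) ≤ (C₀ + C₁ + C₂) * D := by
    intro c k hk hc hcC
    have e1 : (1 + Real.log y) ^ (k + 1) ≤ (1 + Real.log y) ^ 3 :=
      pow_le_pow_right₀ (by linarith) (by omega)
    have e2 : (Z : ℝ) ^ (-(δ / 2)) / δ ^ (k + 1) ≤ (Z : ℝ) ^ (-(δ / 2)) / δ ^ 3 :=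
      div_le_div_of_nonneg_left (by positivity) (by positivity)
        (pow_le_pow_of_le_one hδ.le hδ1 (by omega))
    rw [hD]
    gcongr
  have hpr : ∀ {p : ℕ}, p ∈ Nat.primesLE y → p.Prime := fun hp ↦ (Nat.mem_primesLE.1 hp).2
  have hχ1 : ∀ p : ℕ, ‖χ p‖ ≤ 1 := fun p ↦ χ.norm_le_one _
  refine ⟨?_, ?_, ?_⟩
  · rw [LSeries_complexVonMangoldt_eq_tsum hδ]
    refine (h₁ (fun p a ↦ Real.log p * (a / (((p : ℝ) ^ (1 + δ) : ℝ) - a)))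
      (linearCoeff χ 0) θ t δ E y Z hδ hδ1 hE hy hyZ ?_ ?_ ?_ hE1 (hE2 0)).2.trans
      (hmono C₁ 1 (by norm_num) hC₁.le (by linarith))
    · intro p hp
      have hpp := hpr hp
      have hlp := Real.log_natCast_nonneg p
      rw [norm_one_sub_conj_mul (hθ p hpp), ← mul_sub, norm_mul, Complex.norm_real,
        Real.norm_of_nonneg hlp]
      refine (mul_le_mul_of_nonneg_left (norm_div_sub_sub_div_sub_le (two_le_rpow_one_add hpp hδ.le)
        (norm_osc p t) (hθ p hpp)) hlp).trans ?_
      calc _ ≤ Real.log p * (4 / p * ‖osc p t - θ p‖) := by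
            exact mul_le_mul_of_nonneg_left (mul_le_mul_of_nonneg_right
              (div_rpow_one_add_le hpp hδ.le (by norm_num)) (norm_nonneg _)) (by positivity)
        _ ≤ Real.log p * (32 / p * ‖osc p t - θ p‖) := by gcongr; norm_num
        _ = _ := by ring
    · intro p hpp
      have hlp := Real.log_natCast_nonneg p
      have e : linearCoeff χ 0 p / ((p : ℝ) ^ (1 + δ) : ℝ) * osc p t =
          Real.log p * (osc p t / ((p : ℝ) ^ (1 + δ) : ℝ)) := by
        simp only [linearCoeff, Matrix.cons_val_zero]; ring
      rw [e, ← mul_sub, norm_mul, Complex.norm_real, Real.norm_of_nonneg hlp]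
      refine (mul_le_mul_of_nonneg_left (norm_div_sub_sub_div_le (two_le_rpow_one_add hpp hδ.le)
        (norm_osc p t)) hlp).trans ?_
      calc _ ≤ Real.log p * (2 / (p : ℝ) ^ 2) := by
            exact mul_le_mul_of_nonneg_left (div_rpow_one_add_sq_le hpp hδ.le (by norm_num))
              (by positivity)
        _ ≤ Real.log p * (32 / (p : ℝ) ^ 2) := by gcongr; norm_num
        _ = _ := by ring
    · intro p hpp
      simp only [linearCoeff, Matrix.cons_val_zero]
      rw [Complex.norm_real, Real.norm_of_nonneg (Real.log_natCast_nonneg p), pow_one]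
  · rw [LSeries_logMul_complexVonMangoldt_eq_tsum hδ]
    refine (h₂ (fun p a ↦ (Real.log p : ℂ) ^ 2 *
        (a * ((p : ℝ) ^ (1 + δ) : ℝ) / (((p : ℝ) ^ (1 + δ) : ℝ) - a) ^ 2))
      (linearCoeff χ 1) θ t δ E y Z hδ hδ1 hE hy hyZ ?_ ?_ ?_ hE1 (hE2 1)).2.trans
      (hmono C₂ 2 (by norm_num) hC₂.le (by linarith))
    · intro p hp
      have hpp := hpr hp
      have hlp := Real.log_natCast_nonneg p
      rw [norm_one_sub_conj_mul (hθ p hpp), ← mul_sub, norm_mul, norm_pow, Complex.norm_real,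
        Real.norm_of_nonneg hlp]
      refine (mul_le_mul_of_nonneg_left (norm_mul_div_sub_sq_sub_le (two_le_rpow_one_add hpp hδ.le)
        (norm_osc p t) (hθ p hpp)) (by positivity)).trans ?_
      calc _ ≤ Real.log p ^ 2 * (32 / p * ‖osc p t - θ p‖) := by
            exact mul_le_mul_of_nonneg_left (mul_le_mul_of_nonneg_right
              (div_rpow_one_add_le hpp hδ.le (by norm_num)) (norm_nonneg _)) (by positivity)
        _ = _ := by ring
    · intro p hpp
      have hlp := Real.log_natCast_nonneg p
      have e : linearCoeff χ 1 p / ((p : ℝ) ^ (1 + δ) : ℝ) * osc p t =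
          (Real.log p : ℂ) ^ 2 * (osc p t / ((p : ℝ) ^ (1 + δ) : ℝ)) := by
        simp only [linearCoeff, Matrix.cons_val_one, Matrix.cons_val_zero]; ring
      rw [e, ← mul_sub, norm_mul, norm_pow, Complex.norm_real, Real.norm_of_nonneg hlp]
      refine (mul_le_mul_of_nonneg_left (norm_mul_div_sub_sq_sub_div_le
        (two_le_rpow_one_add hpp hδ.le) (norm_osc p t)) (by positivity)).trans ?_
      calc _ ≤ Real.log p ^ 2 * (12 / (p : ℝ) ^ 2) := by
            exact mul_le_mul_of_nonneg_left (div_rpow_one_add_sq_le hpp hδ.le (by norm_num))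
              (by positivity)
        _ ≤ Real.log p ^ 2 * (32 / (p : ℝ) ^ 2) := by gcongr; norm_num
        _ = _ := by ring
    · intro p hpp
      simp only [linearCoeff, Matrix.cons_val_one, Matrix.cons_val_zero]
      rw [norm_pow, Complex.norm_real, Real.norm_of_nonneg (Real.log_natCast_nonneg p)]
  · have h := h₀ (fun p a ↦ -Complex.log (1 - χ p * a / ((p : ℝ) ^ (1 + δ) : ℝ)))
      (linearCoeff χ 2) θ t δ E y Z hδ hδ1 hE hy hyZ ?_ ?_ ?_ hE1 (hE2 2)
    · exact ⟨h.1, h.2.trans (hmono C₀ 0 (by norm_num) hC₀.le (by linarith))⟩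
    · intro p hp
      have hpp := hpr hp
      have hP := two_le_rpow_one_add hpp hδ.le
      rw [norm_one_sub_conj_mul (hθ p hpp), ← neg_sub', norm_neg]
      refine (norm_log_one_sub_sub_log_one_sub_le
        (norm_mul_div_rpow_le_half hpp hδ.le (hχ1 p) (norm_osc p t))
        (norm_mul_div_rpow_le_half hpp hδ.le (hχ1 p) (hθ p hpp))).trans ?_
      have e : χ p * osc p t / ((p : ℝ) ^ (1 + δ) : ℝ) - χ p * θ p / ((p : ℝ) ^ (1 + δ) : ℝ) =
          χ p * (osc p t - θ p) / ((p : ℝ) ^ (1 + δ) : ℝ) := by ring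
      rw [e, norm_div, norm_mul, Complex.norm_real, Real.norm_of_nonneg (by linarith)]
      calc _ ≤ 2 * (1 * ‖osc p t - θ p‖ / (p : ℝ) ^ (1 + δ)) := by gcongr; exact hχ1 p
        _ ≤ 2 * (1 * ‖osc p t - θ p‖ / p) := by
            exact mul_le_mul_of_nonneg_left (div_rpow_one_add_le hpp hδ.le (by positivity))
              (by norm_num)
        _ ≤ 32 * (1 * ‖osc p t - θ p‖ / p) := by gcongr; norm_num
        _ = _ := by ring
    · intro p hpp
      have e : linearCoeff χ 2 p / ((p : ℝ) ^ (1 + δ) : ℝ) * osc p t =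
          χ p * osc p t / ((p : ℝ) ^ (1 + δ) : ℝ) := by
        simp only [linearCoeff, Matrix.cons_val]; ring
      rw [e]
      refine (norm_neg_log_one_sub_sub_le
        (norm_mul_div_rpow_le_half hpp hδ.le (hχ1 p) (norm_osc p t))).trans ?_
      calc _ ≤ (1 / (p : ℝ) ^ (1 + δ)) ^ 2 := by
            gcongr; exact norm_mul_div_rpow_le hpp hδ.le (hχ1 p) (norm_osc p t)
        _ = 1 / ((p : ℝ) ^ (1 + δ)) ^ 2 := by rw [div_pow, one_pow]
        _ ≤ 1 / (p : ℝ) ^ 2 := div_rpow_one_add_sq_le hpp hδ.le (by norm_num)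
        _ ≤ 32 * (1 / (p : ℝ) ^ 2) := le_mul_of_one_le_left (by positivity) (by norm_num)
        _ = _ := by rw [pow_zero]
    · intro p hpp
      simpa [linearCoeff] using hχ1 p

theorem norm_natCast_cpow_neg_sub_le {p : ℕ} (hp : p.Prime) {δ : ℝ} {ρ w : ℂ}
    (hρ : 1 + δ ≤ ρ.re) (hw : 1 + δ ≤ w.re) :
    ‖(p : ℂ) ^ (-ρ) - (p : ℂ) ^ (-w)‖ ≤ Real.log p / (p : ℝ) ^ (1 + δ) * ‖ρ - w‖ := by
  have hp0 : (p : ℂ) ≠ 0 := by exact_mod_cast hp.ne_zero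
  have hpp : (0 : ℝ) < p := by exact_mod_cast hp.pos
  have hp1 : (1 : ℝ) ≤ p := by exact_mod_cast hp.one_lt.le
  have hl := Real.log_natCast_nonneg p
  refine Convex.norm_image_sub_le_of_norm_hasDerivWithin_le (f := fun z : ℂ ↦ (p : ℂ) ^ (-z))
    (f' := fun z ↦ (p : ℂ) ^ (-z) * Complex.log p * -1) (s := {z : ℂ | 1 + δ ≤ z.re})
    (fun z hz ↦ ?_) (fun z hz ↦ ?_) (convex_halfSpace_re_ge _) hw hρ
  · exact ((hasDerivAt_neg z).const_cpow (Or.inl hp0)).hasDerivWithinAt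
  · rw [norm_mul, norm_mul, norm_neg, norm_one, mul_one, ← Complex.natCast_log, Complex.norm_real,
      Real.norm_of_nonneg hl, Complex.norm_natCast_cpow_of_pos hp.pos, Complex.neg_re,
      Real.rpow_neg hpp.le, mul_comm, ← div_eq_mul_inv]
    have : (p : ℝ) ^ (1 + δ) ≤ (p : ℝ) ^ z.re := Real.rpow_le_rpow_of_exponent_le hp1 hz
    gcongr

theorem norm_dirichlet_mul_cpow_neg_le_half {q : ℕ} (χ : DirichletCharacter ℂ q) {p : ℕ}
    (hp : p.Prime) {s : ℂ} (hs : 1 < s.re) : ‖χ p * (p : ℂ) ^ (-s)‖ ≤ 1 / 2 := by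
  have hp2 : (2 : ℝ) ≤ p := by exact_mod_cast hp.two_le
  rw [norm_mul, Complex.norm_natCast_cpow_of_pos hp.pos, Complex.neg_re,
    Real.rpow_neg (by positivity), ← one_div]
  have h1 : (2 : ℝ) ≤ (p : ℝ) ^ s.re := hp2.trans (by
    simpa using Real.rpow_le_rpow_of_exponent_le (by linarith : (1 : ℝ) ≤ p) hs.le)
  calc _ ≤ 1 * (1 / (2 : ℝ)) := by
        gcongr
        exact χ.norm_le_one _
    _ = _ := one_mul _

theorem exists_norm_tsum_log_sub_le {q : ℕ} (χ : DirichletCharacter ℂ q) :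
    ∃ C : ℝ, 0 < C ∧ ∀ (δ r : ℝ) (ρ w : ℂ), 0 < δ → δ ≤ 1 → 1 + δ ≤ ρ.re → 1 + δ ≤ w.re →
      ‖ρ - w‖ ≤ r →
      ‖∑' p : Nat.Primes, -Complex.log (1 - χ p * (p : ℂ) ^ (-ρ)) -
        ∑' p : Nat.Primes, -Complex.log (1 - χ p * (p : ℂ) ^ (-w))‖ ≤ C * r / δ ^ 2 := by
  obtain ⟨C, hC, h⟩ := exists_tsum_log_pow_div_le 1
  refine ⟨2 * C, by positivity, fun δ r ρ w hδ hδ1 hρ hw hr ↦ ?_⟩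
  obtain ⟨hs, hle⟩ := h δ hδ hδ1
  simp only [pow_one] at hs hle
  have hr0 : 0 ≤ r := (norm_nonneg _).trans hr
  have hsρ := DirichletCharacter.summable_neg_log_one_sub_mul_prime_cpow χ
    (by linarith : 1 < ρ.re)
  have hsw := DirichletCharacter.summable_neg_log_one_sub_mul_prime_cpow χ
    (by linarith : 1 < w.re)
  rw [← hsρ.tsum_sub hsw]
  have hsp : Summable fun p : Nat.Primes ↦ Real.log p / ((p : ℕ) : ℝ) ^ (1 + δ) :=
    hs.comp_injective Nat.Primes.coe_nat_injective
  have hbd : ∀ p : Nat.Primes, ‖-Complex.log (1 - χ p * (p : ℂ) ^ (-ρ)) -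
      -Complex.log (1 - χ p * (p : ℂ) ^ (-w))‖ ≤
      2 * r * (Real.log p / ((p : ℕ) : ℝ) ^ (1 + δ)) := by
    intro p
    rw [← neg_sub', norm_neg]
    refine (norm_log_one_sub_sub_log_one_sub_le
      (norm_dirichlet_mul_cpow_neg_le_half χ p.2 (by linarith))
      (norm_dirichlet_mul_cpow_neg_le_half χ p.2 (by linarith))).trans ?_
    rw [← mul_sub, norm_mul]
    have h1 := norm_natCast_cpow_neg_sub_le p.2 hρ hw
    have hl := Real.log_natCast_nonneg p
    calc _ ≤ 2 * (1 * (Real.log p / ((p : ℕ) : ℝ) ^ (1 + δ) * ‖ρ - w‖)) :=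
          mul_le_mul_of_nonneg_left (mul_le_mul (χ.norm_le_one _) h1 (norm_nonneg _) zero_le_one)
            zero_le_two
      _ ≤ 2 * (1 * (Real.log p / ((p : ℕ) : ℝ) ^ (1 + δ) * r)) := by gcongr
      _ = _ := by ring
  refine (tsum_of_norm_bounded (hsp.mul_left (2 * r)).hasSum hbd).trans ?_
  rw [tsum_mul_left]
  have h2 : ∑' p : Nat.Primes, Real.log p / ((p : ℕ) : ℝ) ^ (1 + δ) ≤ C / δ ^ 2 :=
    (Summable.tsum_subtype_le (fun n : ℕ ↦ Real.log n / (n : ℝ) ^ (1 + δ)) {n | n.Prime}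
      (fun n ↦ div_nonneg (Real.log_natCast_nonneg n) (by positivity)) hs).trans hle
  calc _ ≤ 2 * r * (C / δ ^ 2) := by gcongr
    _ = _ := by ring

theorem eulerLog_le_two_div {p : ℕ} (hp : p.Prime) : eulerLog p ≤ 2 / p := by
  have hp2 : (2 : ℝ) ≤ p := by exact_mod_cast hp.two_le
  have h1 : (p : ℝ)⁻¹ ≤ 1 / 2 := by rw [← one_div]; exact one_div_le_one_div_of_le two_pos hp2
  have h2 := Real.one_sub_inv_le_log_of_pos (by linarith : 0 < 1 - (p : ℝ)⁻¹)
  have h3 : (1 - (p : ℝ)⁻¹)⁻¹ - 1 ≤ 2 / p := by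
    have : (1 - (p : ℝ)⁻¹)⁻¹ = p / (p - 1) := by
      have : (p : ℝ) - 1 ≠ 0 := by linarith
      field_simp
    rw [this, div_sub_one (by linarith), div_le_div_iff₀ (by linarith) (by linarith)]
    linarith
  rw [eulerLog]
  linarith

theorem neg_re_log_one_sub {z : ℂ} : (-Complex.log (1 - z)).re = -Real.log ‖1 - z‖ := by
  rw [Complex.neg_re, Complex.log_re]

theorem eulerLog_sub_le {p : ℕ} (hp : p.Prime) {δ : ℝ} (hδ : 0 ≤ δ) :
    eulerLog p - 2 * δ * Real.log p / p ≤ -Real.log (1 - ((p : ℝ) ^ (1 + δ))⁻¹) := by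
  have hp2 : (2 : ℝ) ≤ p := by exact_mod_cast hp.two_le
  have hP := two_le_rpow_one_add hp hδ
  have hd := inv_sub_inv_rpow_le hp.one_lt.le (δ := δ)
  set P := (p : ℝ) ^ (1 + δ)
  have h1 : (p : ℝ)⁻¹ ≤ 1 / 2 := by rw [← one_div]; exact one_div_le_one_div_of_le two_pos hp2
  have h2 : P⁻¹ ≤ 1 / 2 := by rw [← one_div]; exact one_div_le_one_div_of_le two_pos hP
  have hpP : P⁻¹ ≤ (p : ℝ)⁻¹ :=
    inv_anti₀ (by linarith) (natCast_le_rpow_one_add hp.one_lt.le hδ)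
  have h3 := Real.log_le_sub_one_of_pos
    (div_pos (by linarith : 0 < 1 - P⁻¹) (by linarith : 0 < 1 - (p : ℝ)⁻¹))
  rw [Real.log_div (by linarith) (by linarith)] at h3
  have h4 : (1 - P⁻¹) / (1 - (p : ℝ)⁻¹) - 1 ≤ 2 * (1 / p - 1 / P) := by
    rw [div_sub_one (by linarith), div_le_iff₀ (by linarith), one_div, one_div]
    nlinarith
  have h5 : 2 * δ * Real.log p / p = 2 * (δ * Real.log p / p) := by ring
  rw [eulerLog, h5]
  linarith

/-- Lower bound for the truncated model of `log ‖L(s, χ)‖`. -/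
theorem le_re_sum_neg_log {q : ℕ} [NeZero q] (χ : DirichletCharacter ℂ q) {S : Finset ℕ}
    {η : ℝ} (hη : ∑ p ∈ S, (1 : ℝ) / p ≤ η) {θ : ℕ → ℂ}
    (hθ : ∀ p, p.Prime → ‖θ p‖ = 1) (hθS : ∀ p, p ∉ S → θ p = baseAngle χ p) {δ : ℝ} (hδ : 0 ≤ δ)
    (y : ℕ) :
    ∑ p ∈ Nat.primesLE y, eulerLog p - ∑ p ∈ q.primeFactors, eulerLog p - 3 * η -
      2 * δ * Real.log y * (1 + Real.log y) ≤
      (∑ p ∈ Nat.primesLE y, -Complex.log (1 - χ p * θ p / ((p : ℝ) ^ (1 + δ) : ℝ))).re := by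
  classical
  have hl : 0 ≤ Real.log y := Real.log_natCast_nonneg y
  have hterm : ∀ p ∈ Nat.primesLE y,
      eulerLog p - (if p ∈ q.primeFactors then eulerLog p else 0) -
        (if p ∈ S then 3 * ((1 : ℝ) / p) else 0) - 2 * δ * Real.log y * ((1 : ℝ) / p) ≤
      (-Complex.log (1 - χ p * θ p / ((p : ℝ) ^ (1 + δ) : ℝ))).re := by
    intro p hp
    rw [Nat.mem_primesLE] at hp
    obtain ⟨hpy, hp⟩ := hp
    have hp0 : (0 : ℝ) < p := by exact_mod_cast hp.pos
    have hlp := Real.log_natCast_nonneg p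
    have hlpy : Real.log p ≤ Real.log y := Real.log_le_log hp0 (by exact_mod_cast hpy)
    have hnn : 0 ≤ 2 * δ * Real.log y * ((1 : ℝ) / p) := by positivity
    have he := eulerLog_nonneg p
    have hif : 0 ≤ (if p ∈ q.primeFactors then eulerLog p else 0) := by split_ifs <;> simp [he]
    by_cases hpS : p ∈ S
    · rw [if_pos hpS]
      have h1 := eulerLog_le_two_div hp
      have hz := norm_mul_div_rpow_le hp hδ (χ.norm_le_one p) (hθ p hp)
      have hz2 := div_rpow_one_add_le hp hδ zero_le_one
      have hz3 := norm_mul_div_rpow_le_half hp hδ (χ.norm_le_one p) (hθ p hp)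
      set z : ℂ := χ p * θ p / ((p : ℝ) ^ (1 + δ) : ℝ)
      have h2 : ‖1 - z‖ ≤ 1 + ‖z‖ := (norm_sub_le _ _).trans (by rw [norm_one])
      have h4 : 1 - ‖z‖ ≤ ‖1 - z‖ := by simpa using norm_sub_norm_le (1 : ℂ) z
      have h3 := Real.log_le_sub_one_of_pos (by linarith : 0 < ‖1 - z‖)
      rw [neg_re_log_one_sub]
      have h5 : (2 : ℝ) / p = 2 * (1 / p) := by ring
      linarith
    · rw [if_neg hpS, hθS p hpS]
      by_cases hpq : p ∣ q
      · have hmem : p ∈ q.primeFactors := Nat.mem_primeFactors.2 ⟨hp, hpq, NeZero.ne q⟩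
        rw [if_pos hmem, dirichletCharacter_apply_of_dvd χ hp hpq]
        simp only [zero_mul, zero_div, sub_zero, Complex.log_one, neg_zero, Complex.zero_re]
        linarith
      · have hmem : p ∉ q.primeFactors := fun h ↦ hpq (Nat.dvd_of_mem_primeFactors h)
        have hone : χ p * baseAngle χ p = 1 := by
          rw [baseAngle, if_neg hpq, Complex.mul_conj, Complex.normSq_eq_norm_sq,
            norm_dirichletCharacter_of_prime χ hp hpq]
          simp
        have hP := two_le_rpow_one_add hp hδ
        have hPi : ((p : ℝ) ^ (1 + δ))⁻¹ ≤ 1 / 2 := by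
          rw [← one_div]; exact one_div_le_one_div_of_le two_pos hP
        have e : (1 : ℂ) - 1 / ((p : ℝ) ^ (1 + δ) : ℝ) = ((1 - ((p : ℝ) ^ (1 + δ))⁻¹ : ℝ) : ℂ) := by
          push_cast; ring
        rw [if_neg hmem, hone, neg_re_log_one_sub, e, Complex.norm_real,
          Real.norm_of_nonneg (by linarith)]
        have h1 := eulerLog_sub_le hp hδ
        have h2 : 2 * δ * Real.log p / p ≤ 2 * δ * Real.log y * (1 / p) := by
          rw [mul_one_div]; gcongr
        linarith
  rw [Complex.re_sum]
  refine le_trans ?_ (Finset.sum_le_sum hterm)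
  rw [Finset.sum_sub_distrib, Finset.sum_sub_distrib, Finset.sum_sub_distrib, ← Finset.mul_sum]
  have h1 : ∑ p ∈ Nat.primesLE y, (if p ∈ q.primeFactors then eulerLog p else 0) ≤
      ∑ p ∈ q.primeFactors, eulerLog p := by
    rw [← Finset.sum_filter]
    refine Finset.sum_le_sum_of_subset_of_nonneg (fun p hp ↦ (Finset.mem_filter.1 hp).2)
      fun p _ _ ↦ eulerLog_nonneg p
  have h2 : ∑ p ∈ Nat.primesLE y, (if p ∈ S then 3 * ((1 : ℝ) / p) else 0) ≤ 3 * η := by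
    rw [← Finset.sum_filter]
    refine (Finset.sum_le_sum_of_subset_of_nonneg (fun p hp ↦ (Finset.mem_filter.1 hp).2)
      fun p _ _ ↦ by positivity).trans ?_
    rw [← Finset.mul_sum]
    linarith
  have h3 : 2 * δ * Real.log y * ∑ p ∈ Nat.primesLE y, (1 : ℝ) / p ≤
      2 * δ * Real.log y * (1 + Real.log y) :=
    mul_le_mul_of_nonneg_left (sum_primesLE_inv_le y) (by positivity)
  linarith

theorem exp_neg_sum_primeFactors_eulerLog {q : ℕ} (hq : q ≠ 0) :
    Real.exp (-∑ p ∈ q.primeFactors, eulerLog p) = (Nat.totient q : ℝ) / q := by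
  have h := Nat.totient_eq_mul_prod_factors q
  have h2 : (Nat.totient q : ℝ) = q * ∏ p ∈ q.primeFactors, (1 - (p : ℝ)⁻¹) := by
    have h3 := congrArg (fun x : ℚ ↦ (x : ℝ)) h
    push_cast at h3
    exact h3
  have hq0 : (q : ℝ) ≠ 0 := by exact_mod_cast hq
  rw [h2, mul_div_cancel_left₀ _ hq0, ← Finset.sum_neg_distrib, Real.exp_sum]
  refine Finset.prod_congr rfl fun p hp ↦ ?_
  have hp2 : (1 : ℝ) < p := by exact_mod_cast (Nat.prime_of_mem_primeFactors hp).one_lt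
  rw [eulerLog, neg_neg, Real.exp_log]
  have := inv_lt_one_of_one_lt₀ hp2
  linarith

theorem eventually_const_mul_pow_mul_exp_neg_le (C : ℝ) (n : ℕ) {c ε : ℝ} (hc : 0 < c)
    (hε : 0 < ε) : ∀ᶠ x : ℝ in Filter.atTop, C * (x ^ n * Real.exp (-(c * x))) ≤ ε := by
  have h := ((Real.tendsto_pow_mul_exp_neg_atTop_nhds_zero n).comp
    (Filter.tendsto_id.const_mul_atTop hc)).const_mul (C / c ^ n)
  rw [mul_zero] at h
  filter_upwards [h.eventually (Iic_mem_nhds hε)] with x hx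
  refine le_trans (le_of_eq ?_) hx
  simp only [Function.comp_apply, id, mul_pow]
  field_simp

theorem sum_norm_sq_linearCoeff_div_le {q : ℕ} (χ : DirichletCharacter ℂ q) :
    ∃ C : ℝ, 0 < C ∧ ∀ (y Z : ℕ) (δ : ℝ), 1 ≤ y → 0 ≤ δ →
      ∑ j, ∑ p ∈ Nat.primesLE Z \ Nat.primesLE y,
        ‖linearCoeff χ j p / ((p : ℝ) ^ (1 + δ) : ℝ)‖ ^ 2 ≤ C * (y : ℝ) ^ (-(1 / 4) : ℝ) := by
  obtain ⟨C₀, hC₀, h₀⟩ := exists_sum_log_pow_div_sq_le 0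
  obtain ⟨C₂, hC₂, h₂⟩ := exists_sum_log_pow_div_sq_le 2
  obtain ⟨C₄, hC₄, h₄⟩ := exists_sum_log_pow_div_sq_le 4
  refine ⟨C₂ + C₄ + C₀, by positivity, fun y Z δ hy hδ ↦ ?_⟩
  have hmem : ∀ p ∈ Nat.primesLE Z \ Nat.primesLE y, p.Prime ∧ y ≤ p := by
    intro p hp
    rw [Finset.mem_sdiff, Nat.mem_primesLE, Nat.mem_primesLE] at hp
    exact ⟨hp.1.2, by by_contra! h; exact hp.2 ⟨h.le, hp.1.2⟩⟩
  have hterm : ∀ (j : Fin 3) (k : ℕ), (∀ p, ‖linearCoeff χ j p‖ ^ 2 ≤ Real.log p ^ k) →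
      ∑ p ∈ Nat.primesLE Z \ Nat.primesLE y, ‖linearCoeff χ j p / ((p : ℝ) ^ (1 + δ) : ℝ)‖ ^ 2 ≤
        ∑ p ∈ Nat.primesLE Z \ Nat.primesLE y, Real.log p ^ k / (p : ℝ) ^ 2 := by
    intro j k hjk
    refine Finset.sum_le_sum fun p hp ↦ ?_
    have hp1 := (hmem p hp).1
    have hpp : (0 : ℝ) < p := by exact_mod_cast hp1.pos
    have hP := natCast_le_rpow_one_add hp1.one_lt.le hδ
    rw [norm_div, div_pow, Complex.norm_real, Real.norm_of_nonneg (by positivity)]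
    have := hjk p
    gcongr
  rw [Fin.sum_univ_three, add_mul, add_mul]
  refine add_le_add (add_le_add ?_ ?_) ?_
  · refine (hterm 0 2 fun p ↦ ?_).trans (h₂ y _ hy fun n hn ↦ (hmem n hn).2)
    simp only [linearCoeff, Matrix.cons_val_zero, Complex.norm_real, Real.norm_eq_abs, sq_abs,
      le_refl]
  · refine (hterm 1 4 fun p ↦ ?_).trans (h₄ y _ hy fun n hn ↦ (hmem n hn).2)
    simp only [linearCoeff, Matrix.cons_val_one, Matrix.cons_val_zero, norm_pow, Complex.norm_real,
      Real.norm_eq_abs, sq_abs, ← pow_mul, le_refl]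
  · refine (hterm 2 0 fun p ↦ ?_).trans (h₀ y _ hy fun n hn ↦ (hmem n hn).2)
    simp only [linearCoeff, pow_zero]
    exact pow_le_one₀ (norm_nonneg _) (χ.norm_le_one _)

theorem log_prod_primesLE_pow_le (y K : ℕ) :
    Real.log ((∏ p ∈ Nat.primesLE y, p ^ K : ℕ) : ℝ) ≤ K * (2 * y) := by
  rw [Finset.prod_pow, Nat.cast_pow, Real.log_pow]
  refine mul_le_mul_of_nonneg_left ?_ (Nat.cast_nonneg K)
  have h1 : ∏ p ∈ Nat.primesLE y, p ≤ 4 ^ y := by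
    rw [← primorial_eq_prod_primesLE]
    exact primorial_le_four_pow y
  have hpos : 0 < ∏ p ∈ Nat.primesLE y, p :=
    Finset.prod_pos fun p hp ↦ (Nat.mem_primesLE.1 hp).2.pos
  have h2 : ((∏ p ∈ Nat.primesLE y, p : ℕ) : ℝ) ≤ 4 ^ y := by exact_mod_cast h1
  have h3 : Real.log 4 ≤ 2 := by
    rw [show (4 : ℝ) = 2 ^ 2 by norm_num, Real.log_pow]
    have := Real.log_two_lt_d9
    norm_num
    linarith
  calc _ ≤ Real.log (4 ^ y) := Real.log_le_log (by exact_mod_cast hpos) h2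
    _ = y * Real.log 4 := Real.log_pow _ _
    _ ≤ y * 2 := by gcongr
    _ = _ := mul_comm _ _

set_option maxHeartbeats 1000000 in
/-- An ordinate `t` at which the prime powers `p ^ (-it)` with `p ≤ y` are close to prescribed
unimodular numbers, of size controlled by `log log (t + 1) ≤ (1 + ε) log y`. -/
theorem exists_resonant_ordinate {q : ℕ} (χ : DirichletCharacter ℂ q) (T : ℝ) {ε : ℝ}
    (hε : 0 < ε) :
    ∀ᶠ ℓ : ℝ in Filter.atTop, ∀ (y : ℕ) (θ : ℕ → ℂ), 1 ≤ y → Real.log y = ℓ →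
      (∀ p, p.Prime → ‖θ p‖ = 1) → ∃ (t : ℝ) (Z : ℕ), y ≤ Z ∧
        (Z : ℝ) ^ (-((ℓ ^ 4)⁻¹ / 2)) ≤ Real.exp (-(1 / 4 * ℓ)) ∧ T < t ∧ 4 ≤ t ∧
        Real.log (Real.log (t + 1)) ≤ (1 + ε) * ℓ ∧
        ∑ p ∈ Nat.primesLE y, (1 : ℝ) / p * ‖1 - (starRingEnd ℂ) (θ p) * osc p t‖ ^ 2 ≤
          ((ℓ ^ 30)⁻¹) ^ 2 ∧
        ∀ j, ‖∑ p ∈ Nat.primesLE Z \ Nat.primesLE y,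
          linearCoeff χ j p / ((p : ℝ) ^ (1 + (ℓ ^ 4)⁻¹) : ℝ) * osc p t‖ ≤ (ℓ ^ 30)⁻¹ := by
  obtain ⟨C, hC, htail⟩ := sum_norm_sq_linearCoeff_div_le χ
  have hA : 0 < 15 + 2 * |T| := by positivity
  filter_upwards [Filter.eventually_ge_atTop (64 : ℝ),
    eventually_const_mul_pow_mul_exp_neg_le C 60 (c := 1 / 4) (ε := 1 / 8) (by norm_num)
      (by norm_num),
    eventually_const_mul_pow_mul_exp_neg_le (|Real.log (15 + 2 * |T|)| + 12) 70 hε one_pos]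
    with ℓ hℓ hexp₁ hexp₂
  intro y θ hy hyℓ hθ
  have hℓ0 : 0 < ℓ := by linarith
  have hℓ1 : 1 ≤ ℓ := by linarith
  have hy0 : (0 : ℝ) < y := by exact_mod_cast hy
  have hyexp : (y : ℝ) = Real.exp ℓ := by rw [← hyℓ, Real.exp_log hy0]
  set Z : ℕ := ⌈Real.exp (ℓ ^ 6)⌉₊ with hZdef
  set K : ℕ := ⌈ℓ ^ 70⌉₊ with hKdef
  have hZge : Real.exp (ℓ ^ 6) ≤ Z := Nat.le_ceil _
  have hZpos : (0 : ℝ) < Z := (Real.exp_pos _).trans_le hZge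
  have hℓ6 : ℓ ≤ ℓ ^ 6 := le_self_pow₀ hℓ1 (by norm_num)
  have hyZ : y ≤ Z := by
    have : (y : ℝ) ≤ Z := by
      rw [hyexp]; exact (Real.exp_le_exp.2 hℓ6).trans hZge
    exact_mod_cast this
  have hZ1 : 1 ≤ Z := hy.trans hyZ
  have hδ : 0 < (ℓ ^ 4)⁻¹ := by positivity
  have hKge : ℓ ^ 70 ≤ K := Nat.le_ceil _
  have hK0 : (0 : ℝ) < K := lt_of_lt_of_le (by positivity) hKge
  have hKle : (K : ℝ) ≤ 2 * ℓ ^ 70 := by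
    have h1 : (K : ℝ) < ℓ ^ 70 + 1 := Nat.ceil_lt_add_one (by positivity)
    have h2 : 1 ≤ ℓ ^ 70 := one_le_pow₀ hℓ1
    linarith
  have hlogZ : Real.log Z ≤ 2 * ℓ ^ 70 := by
    have h1 : (Z : ℝ) < Real.exp (ℓ ^ 6) + 1 := Nat.ceil_lt_add_one (by positivity)
    have h2 : 1 ≤ Real.exp (ℓ ^ 6) := Real.one_le_exp (by positivity)
    have h3 : (2 : ℝ) ≤ Real.exp 1 := by linarith [Real.add_one_le_exp (1 : ℝ)]
    have h4 : (Z : ℝ) ≤ Real.exp (ℓ ^ 6 + 1) := by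
      rw [Real.exp_add]; nlinarith
    have h5 := (Real.log_le_iff_le_exp hZpos).2 h4
    have h6 : ℓ ^ 6 ≤ ℓ ^ 70 := pow_le_pow_right₀ hℓ1 (by norm_num)
    have h7 : 1 ≤ ℓ ^ 70 := one_le_pow₀ hℓ1
    linarith
  set N : ℕ := (∏ p ∈ Nat.primesLE y, p ^ K) * Z with hNdef
  have hprod : 0 < ∏ p ∈ Nat.primesLE y, p ^ K :=
    Finset.prod_pos fun p hp ↦ pow_pos (Nat.prime_of_mem_primesLE hp).pos _
  have hN1 : 1 ≤ N := Nat.mul_pos hprod hZ1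
  have hN1' : (1 : ℝ) ≤ N := by exact_mod_cast hN1
  have hlogN : Real.log N ≤ 6 * ℓ ^ 70 * Real.exp ℓ := by
    rw [hNdef, Nat.cast_mul, Real.log_mul (by exact_mod_cast hprod.ne') hZpos.ne']
    have h1 := log_prod_primesLE_pow_le y K
    rw [hyexp] at h1
    have h2 : (K : ℝ) * (2 * Real.exp ℓ) ≤ 2 * ℓ ^ 70 * (2 * Real.exp ℓ) := by gcongr
    have h3 : 2 * ℓ ^ 70 * 1 ≤ 2 * ℓ ^ 70 * Real.exp ℓ := by
      gcongr; exact Real.one_le_exp hℓ0.le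
    linarith
  have hy4 : (y : ℝ) ^ (-(1 / 4) : ℝ) = Real.exp (-(1 / 4 * ℓ)) := by
    rw [hyexp, ← Real.exp_mul]; ring_nf
  obtain ⟨t, ⟨ht1, ht2⟩, ht⟩ := exists_resonance (Nat.primesLE y) (Nat.primesLE Z \ Nat.primesLE y)
    (fun p hp ↦ Nat.prime_of_mem_primesLE hp)
    (fun p hp ↦ Nat.prime_of_mem_primesLE (Finset.mem_sdiff.1 hp).1) Finset.disjoint_sdiff
    (fun p ↦ (starRingEnd ℂ) (θ p))
    (fun p hp ↦ by rw [RCLike.norm_conj]; exact hθ p (Nat.prime_of_mem_primesLE hp))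
    (K := K) hZ1 (fun p hp ↦ Nat.le_of_mem_primesLE (Finset.mem_sdiff.1 hp).1) hNdef.ge
    (T := 4 * (N : ℝ) ^ 2 + |T| + 3) (by linarith [abs_nonneg T]) (fun p ↦ (1 : ℝ) / p)
    (fun p ↦ by positivity) (fun j p ↦ linearCoeff χ j p / ((p : ℝ) ^ (1 + (ℓ ^ 4)⁻¹) : ℝ))
    (e := (ℓ ^ 60)⁻¹ / 4) (by positivity) (by
      have h1 := htail y Z _ hy hδ.le
      have h2 : C * (y : ℝ) ^ (-(1 / 4) : ℝ) ≤ (ℓ ^ 60)⁻¹ / 8 := by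
        rw [hy4, inv_eq_one_div, div_div, mul_comm (ℓ ^ 60), ← div_div, le_div_iff₀ (by positivity)]
        linarith
      have h3 := sum_primesLE_inv_le y
      rw [hyℓ] at h3
      have h4 : ∑ p ∈ Nat.primesLE y, (1 : ℝ) / p * (4 / (K + 1)) ≤ (ℓ ^ 60)⁻¹ / 8 := by
        rw [← Finset.sum_mul]
        have h5 : (4 : ℝ) / (K + 1) ≤ 4 / ℓ ^ 70 := by gcongr; linarith
        have h6 : (1 + ℓ) * (4 / ℓ ^ 70) ≤ (2 * ℓ) * (4 / ℓ ^ 70) := by gcongr; linarith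
        have h7 : (2 * ℓ) * (4 / ℓ ^ 70) = 8 * (ℓ ^ 60)⁻¹ * (ℓ ^ 9)⁻¹ := by
          field_simp; norm_num
        have h8 : (ℓ ^ 9)⁻¹ ≤ 1 / 64 := by
          rw [inv_eq_one_div]
          exact one_div_le_one_div_of_le (by norm_num)
            (hℓ.trans (le_self_pow₀ hℓ1 (by norm_num)))
        have h9 : 8 * (ℓ ^ 60)⁻¹ * (ℓ ^ 9)⁻¹ ≤ 8 * (ℓ ^ 60)⁻¹ * (1 / 64) := by gcongr
        have h10 := mul_le_mul h3 h5 (by positivity) (by positivity)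
        linarith
      linarith)
  have hE : ((ℓ ^ 30)⁻¹) ^ 2 = 4 * ((ℓ ^ 60)⁻¹ / 4) := by
    rw [inv_pow, ← pow_mul]; ring
  rw [← hE] at ht
  have hTnn := abs_nonneg T
  have hTle := le_abs_self T
  refine ⟨t, Z, hyZ, ?_, by nlinarith, by nlinarith, ?_, ?_, fun j ↦ ?_⟩
  · rw [Real.rpow_neg hZpos.le, Real.exp_neg]
    refine inv_anti₀ (Real.exp_pos _) ?_
    calc Real.exp (1 / 4 * ℓ) ≤ Real.exp (ℓ ^ 6 * ((ℓ ^ 4)⁻¹ / 2)) := by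
          apply Real.exp_le_exp.2
          rw [show ℓ ^ 6 * ((ℓ ^ 4)⁻¹ / 2) = ℓ ^ 2 / 2 by field_simp]
          nlinarith
      _ = Real.exp (ℓ ^ 6) ^ ((ℓ ^ 4)⁻¹ / 2) := Real.exp_mul _ _
      _ ≤ _ := Real.rpow_le_rpow (Real.exp_pos _).le hZge (by positivity)
  · have h1 : t + 1 ≤ (15 + 2 * |T|) * (N : ℝ) ^ 2 := by nlinarith [one_le_pow₀ hN1' (n := 2)]
    have ht3 : 1 < t + 1 := by nlinarith
    have h2 : Real.log (t + 1) ≤ Real.log (15 + 2 * |T|) + 2 * Real.log N := by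
      refine (Real.log_le_log (by linarith) h1).trans (le_of_eq ?_)
      rw [Real.log_mul hA.ne' (by positivity), Real.log_pow]; norm_num
    have h3 : Real.log (15 + 2 * |T|) + 2 * Real.log N ≤
        (|Real.log (15 + 2 * |T|)| + 12) * (ℓ ^ 70 * Real.exp ℓ) := by
      have h4 : 1 ≤ ℓ ^ 70 * Real.exp ℓ :=
        one_le_mul_of_one_le_of_one_le (one_le_pow₀ hℓ1) (Real.one_le_exp hℓ0.le)
      have h5 := le_abs_self (Real.log (15 + 2 * |T|))
      have h6 := le_mul_of_one_le_right (abs_nonneg (Real.log (15 + 2 * |T|))) h4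
      linarith
    have h7 : (|Real.log (15 + 2 * |T|)| + 12) * (ℓ ^ 70 * Real.exp ℓ) ≤
        Real.exp ((1 + ε) * ℓ) := by
      have h8 : Real.exp ((1 + ε) * ℓ) = Real.exp (ε * ℓ) * Real.exp ℓ := by
        rw [← Real.exp_add]; ring_nf
      rw [Real.exp_neg, ← mul_assoc, ← div_eq_mul_inv, div_le_one (Real.exp_pos _)] at hexp₂
      rw [h8, ← mul_assoc]
      gcongr
    exact (Real.log_le_iff_le_exp (Real.log_pos ht3)).2 (h2.trans (h3.trans h7))
  · refine le_trans ?_ ht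
    exact le_add_of_nonneg_right (Finset.sum_nonneg fun j _ ↦ by positivity)
  · have h1 : ‖∑ p ∈ Nat.primesLE Z \ Nat.primesLE y,
        linearCoeff χ j p / ((p : ℝ) ^ (1 + (ℓ ^ 4)⁻¹) : ℝ) * osc p t‖ ^ 2 ≤ ((ℓ ^ 30)⁻¹) ^ 2 := by
      refine le_trans ?_ ht
      refine le_trans ?_ (le_add_of_nonneg_left (Finset.sum_nonneg fun p _ ↦ by positivity))
      exact Finset.single_le_sum (f := fun j ↦ ‖∑ p ∈ Nat.primesLE Z \ Nat.primesLE y,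
        linearCoeff χ j p / ((p : ℝ) ^ (1 + (ℓ ^ 4)⁻¹) : ℝ) * osc p t‖ ^ 2)
        (fun j _ ↦ by positivity) (Finset.mem_univ j)
    exact (sq_le_sq₀ (norm_nonneg _) (by positivity)).1 h1

theorem dirichlet_mul_cpow_neg_eq {q : ℕ} (χ : DirichletCharacter ℂ q) {p : ℕ} (hp : p.Prime)
    (σ t : ℝ) : χ p * (p : ℂ) ^ (-((σ : ℂ) + t * Complex.I)) =
      χ p * osc p t / ((p : ℝ) ^ σ : ℝ) := by
  rw [Complex.cpow_neg, inv_natCast_cpow hp.one_lt.le, mul_div_assoc]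

theorem error_le_inv_pow {ℓ a b : ℝ} (hℓ : 64 ≤ ℓ) (ha : a ≤ Real.exp (-(1 / 4 * ℓ)))
    (hb : b ≤ Real.exp (-(1 / 4 * ℓ)))
    (h : 1 * (ℓ ^ 37 * Real.exp (-(1 / 4 * ℓ))) ≤ 1 / 4) :
    (1 + ℓ) ^ 3 * (ℓ ^ 30)⁻¹ + a + b / ((ℓ ^ 4)⁻¹) ^ 3 ≤ (ℓ ^ 25)⁻¹ := by
  have hℓ0 : 0 < ℓ := by linarith
  have h1 : (1 + ℓ) ^ 3 ≤ (2 * ℓ) ^ 3 := by gcongr; linarith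
  have h2 : (2 * ℓ) ^ 3 * (ℓ ^ 30)⁻¹ = (ℓ ^ 25)⁻¹ * (8 * (ℓ ^ 2)⁻¹) := by
    field_simp; norm_num
  have h3 : 8 * (ℓ ^ 2)⁻¹ ≤ 1 / 4 := by
    rw [← div_eq_mul_inv, div_le_iff₀ (by positivity)]; nlinarith
  have h4 : (1 + ℓ) ^ 3 * (ℓ ^ 30)⁻¹ ≤ (ℓ ^ 25)⁻¹ * (1 / 4) := by
    calc _ ≤ (2 * ℓ) ^ 3 * (ℓ ^ 30)⁻¹ := by gcongr
      _ = _ := h2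
      _ ≤ _ := by gcongr
  have h5 : ℓ ^ 12 * Real.exp (-(1 / 4 * ℓ)) ≤ (ℓ ^ 25)⁻¹ * (1 / 4) := by
    rw [inv_mul_eq_div, le_div_iff₀ (by positivity)]
    linarith
  have h6 : Real.exp (-(1 / 4 * ℓ)) ≤ ℓ ^ 12 * Real.exp (-(1 / 4 * ℓ)) :=
    le_mul_of_one_le_left (Real.exp_pos _).le (one_le_pow₀ (by linarith))
  have h7 : b / ((ℓ ^ 4)⁻¹) ^ 3 = ℓ ^ 12 * b := by
    field_simp
  have h8 : ℓ ^ 12 * b ≤ ℓ ^ 12 * Real.exp (-(1 / 4 * ℓ)) := by gcongr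
  have h9 : 0 < (ℓ ^ 25)⁻¹ := by positivity
  rw [h7]
  linarith

theorem const_mul_inv_pow_le {ℓ C ε : ℝ} {m k : ℕ} (hε : 0 < ε) (hℓ : 1 ≤ ℓ) (hC : C / ε ≤ ℓ)
    (hmk : m + 1 ≤ k) : C * (ℓ ^ k)⁻¹ ≤ ε * (ℓ ^ m)⁻¹ := by
  have hℓ0 : 0 < ℓ := by linarith
  rw [div_le_iff₀ hε] at hC
  have h1 : ℓ ^ (m + 1) ≤ ℓ ^ k := pow_le_pow_right₀ hℓ hmk
  rw [← div_eq_mul_inv, ← div_eq_mul_inv, div_le_div_iff₀ (by positivity) (by positivity)]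
  calc C * ℓ ^ m ≤ (ℓ * ε) * ℓ ^ m := by gcongr
    _ = ε * ℓ ^ (m + 1) := by ring
    _ ≤ _ := by gcongr

open Filter in
theorem exists_critical_point_large_LFunction {q : ℕ} [NeZero q] (χ : DirichletCharacter ℂ q)
    (hχ : χ ≠ 1) (T : ℝ) {ε : ℝ} (hε : 0 < ε) :
    ∃ (ρ : ℂ) (ℓ : ℝ), deriv riemannZeta ρ = 0 ∧ 1 < ρ.re ∧ T < ρ.im ∧ 0 < ℓ ∧
      0 ≤ Real.log (Real.log ρ.im) ∧ Real.log (Real.log ρ.im) ≤ (1 + ε) * ℓ ∧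
      Real.exp Real.eulerMascheroniConstant * ((Nat.totient q : ℝ) / q) * Real.exp (-(7 * ε)) * ℓ ≤
        ‖DirichletCharacter.LFunction χ ρ‖ := by
  obtain ⟨S, -, hS, δ₀, hδ₀, y₀, hang⟩ := exists_angles hχ hε
  obtain ⟨Cz, hCz, hzero⟩ := exists_deriv_riemannZeta_eq_zero_of_norm_lt
  obtain ⟨Cc, hCc, hcomp⟩ := exists_comparison χ
  obtain ⟨Cl, hCl, hlog⟩ := exists_norm_tsum_log_sub_le χ
  obtain ⟨L, hL⟩ := eventually_atTop.1
    ((exists_resonant_ordinate χ (T + 1) hε).and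
      ((eventually_const_mul_pow_mul_exp_neg_le 1 37 (c := 1 / 4) (ε := 1 / 4) (by norm_num)
        (by norm_num)).and
      ((eventually_ge_atTop (64 : ℝ)).and
      ((eventually_ge_atTop (1 / δ₀)).and
      ((eventually_ge_atTop (Cz / 1)).and
      ((eventually_ge_atTop (Cc / (1 / 16))).and
      ((eventually_ge_atTop (Cc / ε)).and
      ((eventually_ge_atTop (4 * Cl / ε)).and (eventually_ge_atTop (4 / ε))))))))))
  obtain ⟨y, hyX, hylog⟩ := exists_le_sum_eulerLog
    (show Real.eulerMascheroniConstant - ε < Real.eulerMascheroniConstant by linarith)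
    (max (max y₀ 1) ⌈Real.exp L⌉₊)
  have hy₀ : y₀ ≤ y := (le_max_left _ _).trans ((le_max_left _ _).trans hyX)
  have hy1 : 1 ≤ y := (le_max_right _ _).trans ((le_max_left _ _).trans hyX)
  have hypos : (0 : ℝ) < y := by exact_mod_cast hy1
  obtain ⟨ℓ, hℓ⟩ : ∃ ℓ : ℝ, ℓ = Real.log y := ⟨_, rfl⟩
  have hLℓ : L ≤ ℓ := by
    rw [hℓ, Real.le_log_iff_exp_le hypos]
    exact (Nat.le_ceil _).trans (by exact_mod_cast (le_max_right _ _).trans hyX)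
  obtain ⟨hres, hexp, h64, hδ₀ℓ, hCzℓ, hCcℓ, hCcℓ', hClℓ, h4ℓ⟩ := hL ℓ hLℓ
  have hℓ0 : 0 < ℓ := by linarith
  have hℓ1 : 1 ≤ ℓ := by linarith
  obtain ⟨δ, hδdef⟩ : ∃ δ : ℝ, δ = (ℓ ^ 4)⁻¹ := ⟨_, rfl⟩
  obtain ⟨r, hrdef⟩ : ∃ r : ℝ, r = (ℓ ^ 20)⁻¹ := ⟨_, rfl⟩
  have hδ : 0 < δ := by rw [hδdef]; positivity
  have hr : 0 < r := by rw [hrdef]; positivity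
  have hδ1 : δ ≤ 1 := by rw [hδdef]; exact inv_le_one_of_one_le₀ (one_le_pow₀ hℓ1)
  have hδδ₀ : δ ≤ δ₀ := by
    have := const_mul_inv_pow_le (m := 0) (k := 4) hδ₀ hℓ1 hδ₀ℓ (by norm_num)
    simpa [hδdef] using this
  have hδℓ : δ * Real.log y ^ 3 ≤ 1 := by
    rw [← hℓ, hδdef, show (ℓ ^ 4)⁻¹ * ℓ ^ 3 = ℓ⁻¹ by field_simp]
    exact inv_le_one_of_one_le₀ hℓ1
  obtain ⟨θ, hθ, hθS, hM1, hM2⟩ := hang y δ hy₀ hδ hδδ₀ hδℓ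
  obtain ⟨t, Z, hyZ, hZ, htT, ht4, htlog, hE1, hE2⟩ := hres y θ hy1 hℓ.symm hθ
  rw [← hδdef] at hZ hE2
  obtain ⟨D, hD⟩ : ∃ D : ℝ, D = (1 + Real.log y) ^ 3 * (ℓ ^ 30)⁻¹ + (y : ℝ) ^ (-(1 / 4) : ℝ) +
    (Z : ℝ) ^ (-(δ / 2)) / δ ^ 3 := ⟨_, rfl⟩
  obtain ⟨hc1, hc2, -, hc3⟩ := hcomp θ t δ (ℓ ^ 30)⁻¹ y Z hδ hδ1 (by positivity) hy1 hyZ hθ hE1 hE2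
    D hD
  have hDle : D ≤ (ℓ ^ 25)⁻¹ := by
    rw [hD, ← hℓ, hδdef]
    refine error_le_inv_pow h64 (le_of_eq ?_) (by rwa [← hδdef]) hexp
    rw [← Real.exp_log hypos, ← hℓ, ← Real.exp_mul]; ring_nf
  have hCD : Cc * D ≤ Cc * (ℓ ^ 25)⁻¹ := mul_le_mul_of_nonneg_left hDle hCc.le
  have hCD1 : Cc * D ≤ 1 / 16 * r := by
    rw [hrdef]
    exact hCD.trans (const_mul_inv_pow_le (by norm_num) hℓ1 hCcℓ (by norm_num))
  have hCD2 : Cc * D ≤ ε := by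
    have := const_mul_inv_pow_le (m := 0) (k := 25) hε hℓ1 hCcℓ' (by norm_num)
    rw [pow_zero, inv_one, mul_one] at this
    exact hCD.trans this
  have hr1 : r ≤ 1 := by rw [hrdef]; exact inv_le_one_of_one_le₀ (one_le_pow₀ hℓ1)
  have hrδ : r ≤ δ / 2 := by
    have := const_mul_inv_pow_le (ℓ := ℓ) (C := 1) (ε := 1 / 2) (m := 4) (k := 20) (by norm_num) hℓ1
      (by linarith) (by norm_num)
    rw [hrdef, hδdef]; linarith
  have hCzr : Cz * r ≤ δ ^ 4 := by
    have := const_mul_inv_pow_le (m := 16) (k := 20) one_pos hℓ1 hCzℓ (by norm_num)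
    rw [hrdef, hδdef, inv_pow, ← pow_mul]; linarith
  have hwre : ((((1 + δ : ℝ) : ℂ) + t * Complex.I)).re = 1 + δ := re_ofReal_add_ofReal_mul_I _ _
  have hwim : ((((1 + δ : ℝ) : ℂ) + t * Complex.I)).im = t := by simp
  rw [hM1, sub_zero] at hc1
  obtain ⟨ρ, hρw, hρ⟩ := hzero (((1 + δ : ℝ) : ℂ) + t * Complex.I) δ r hδ hδ1 hwre hr hrδ hCzr
    (by linarith) (by
      have := norm_sub_norm_le (∑ p ∈ Nat.primesLE y, (Real.log p : ℂ) ^ 2 *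
        (θ p * ((p : ℝ) ^ (1 + δ) : ℝ) / (((p : ℝ) ^ (1 + δ) : ℝ) - θ p) ^ 2))
        (LSeries (LSeries.logMul complexVonMangoldt) (((1 + δ : ℝ) : ℂ) + t * Complex.I))
      rw [norm_sub_rev] at this
      linarith)
  have hre : 1 + δ / 2 ≤ ρ.re := by
    have := (Complex.abs_re_le_norm _).trans hρw
    rw [Complex.sub_re, hwre, abs_le] at this
    linarith
  have him := (Complex.abs_im_le_norm _).trans hρw
  rw [Complex.sub_im, hwim, abs_le] at him
  have him3 : 3 ≤ ρ.im := by linarith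
  have hlogim : 1 ≤ Real.log ρ.im := by
    rw [Real.le_log_iff_exp_le (by linarith)]
    linarith [Real.exp_one_lt_three]
  refine ⟨ρ, ℓ, hρ, by linarith, by linarith, hℓ0, Real.log_nonneg hlogim, ?_, ?_⟩
  · refine le_trans (Real.log_le_log (by linarith) (Real.log_le_log (by linarith) ?_)) htlog
    linarith
  · have hdiff := hlog (δ / 2) r ρ _ (by linarith) (by linarith) hre (by linarith) hρw
    have htsum : ∑' p : Nat.Primes, -Complex.log (1 - χ p * (p : ℂ) ^
        (-(((1 + δ : ℝ) : ℂ) + t * Complex.I))) = ∑' p : Nat.Primes,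
          -Complex.log (1 - χ p * osc p t / (((p : ℕ) : ℝ) ^ (1 + δ) : ℝ)) :=
      tsum_congr fun p ↦ by rw [dirichlet_mul_cpow_neg_eq χ p.2]
    rw [htsum] at hdiff
    have hdiff' := (norm_sub_le_norm_sub_add_norm_sub _ _ _).trans (add_le_add hdiff hc3)
    have hre' := (Complex.abs_re_le_norm _).trans hdiff'
    rw [Complex.sub_re, abs_le] at hre'
    have hmodel := le_re_sum_neg_log χ hS hθ hθS hδ.le y
    have hClr : Cl * r / (δ / 2) ^ 2 ≤ ε := by
      have := const_mul_inv_pow_le (m := 0) (k := 12) hε hℓ1 hClℓ (by norm_num)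
      rw [pow_zero, inv_one, mul_one] at this
      refine le_trans (le_of_eq ?_) this
      rw [hrdef, hδdef]
      field_simp
      norm_num
    have hδl : 2 * δ * Real.log y * (1 + Real.log y) ≤ ε := by
      have h1 := const_mul_inv_pow_le (m := 0) (k := 2) hε hℓ1 h4ℓ (by norm_num)
      rw [pow_zero, inv_one, mul_one] at h1
      refine le_trans ?_ h1
      rw [← hℓ]
      calc 2 * δ * ℓ * (1 + ℓ) ≤ 2 * δ * ℓ * (2 * ℓ) := by gcongr; linarith
        _ = _ := by rw [hδdef]; field_simp; norm_num
    rw [DirichletCharacter.LFunction_eq_LSeries χ (by linarith : 1 < ρ.re),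
      ← DirichletCharacter.LSeries_eulerProduct_exp_log χ (by linarith : 1 < ρ.re),
      Complex.norm_exp, ← exp_neg_sum_primeFactors_eulerLog (NeZero.ne q), ← Real.exp_add,
      ← Real.exp_add]
    nth_rewrite 1 [← Real.exp_log hℓ0]
    rw [← Real.exp_add]
    apply Real.exp_le_exp.2
    rw [← hℓ] at hylog
    linarith [hre'.1]

open Complex DirichletCharacter ArithmeticFunction Finset

/-- **Theorem 2.** Unconditionally, there are critical points `ρ'` of the Riemann zeta function
with `Re ρ' > 1` and arbitrarily large imaginary part at which
`|L(ρ',χ)| ≥ (e^{C₀} φ(q)/q − ε) log log (Im ρ')`. -/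
theorem extreme_values_lower_bound (q : ℕ) [NeZero q] (hq : 2 < q)
    (χ : DirichletCharacter ℂ q) (hχ : χ.IsPrimitive) :
    ∀ ε : ℝ, 0 < ε → ∀ T : ℝ, 0 < T →
      ∃ ρ' : ℂ, deriv riemannZeta ρ' = 0 ∧ 1 < ρ'.re ∧ T < ρ'.im ∧
        (Real.exp Real.eulerMascheroniConstant * (Nat.totient q : ℝ) / q - ε) *
            Real.log (Real.log ρ'.im) ≤ ‖LFunction χ ρ'‖ := by
  intro ε hε T _
  have hχ1 : χ ≠ 1 := by
    rintro rfl
    rw [isPrimitive_def, conductor_one] at hχ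
    omega
  set c : ℝ := Real.exp Real.eulerMascheroniConstant * (Nat.totient q : ℝ) / q with hc
  obtain ⟨η, hηc, hη⟩ : ∃ η : ℝ, (c - ε) * (1 + η) ≤ c * Real.exp (-(7 * η)) ∧ 0 < η := by
    have h1 : Filter.Tendsto (fun η : ℝ ↦ c * Real.exp (-(7 * η)) - (c - ε) * (1 + η))
        (nhdsWithin 0 (Set.Ioi 0)) (nhds (c * Real.exp (-(7 * 0)) - (c - ε) * (1 + 0))) :=
      Filter.Tendsto.mono_left (Continuous.tendsto (by fun_prop) 0) nhdsWithin_le_nhds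
    have h2 : 0 < c * Real.exp (-(7 * 0)) - (c - ε) * (1 + 0) := by simpa using hε
    obtain ⟨η, h3, h4⟩ := ((h1.eventually (lt_mem_nhds h2)).and self_mem_nhdsWithin).exists
    exact ⟨η, (sub_pos.1 h3).le, h4⟩
  obtain ⟨ρ, ℓ, hρ, hre, him, hℓ, h0, hle, hL⟩ :=
    exists_critical_point_large_LFunction χ hχ1 T hη
  refine ⟨ρ, hρ, hre, him, ?_⟩
  rw [← mul_div_assoc, ← hc] at hL
  rcases le_total (c - ε) 0 with hneg | hpos
  · exact (mul_nonpos_of_nonpos_of_nonneg hneg h0).trans (norm_nonneg _)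
  · calc (c - ε) * Real.log (Real.log ρ.im) ≤ (c - ε) * ((1 + η) * ℓ) := by gcongr
      _ = (c - ε) * (1 + η) * ℓ := by ring
      _ ≤ c * Real.exp (-(7 * η)) * ℓ := by gcongr
      _ ≤ _ := hL
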